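/- Let p∈(2,3], q>p−1, and let u be a nonnegative classical solution of u_t−Δu=|∇u|^p in Q_T with u=0 on Γ_T, having an isolated gradient blowup point at (0,0,T) and satisfying x·u_x≤0 in Q_T. Set β=1/(p−1), γ=q(1−β), and for k∈(0,1) define c(x)=kx, d(y)=y^{−γ}(1+y), F(s)=s^q, J=u_x+c(x)d(y)F(u), a=−p·c'(x)·d(y)·F(u)·|∇u|^{p−2}−2c'(x)·d(y)·F'(u), b=p|∇u|^{p−2}∇u, and the operator 𝒫J = J_t − ΔJ − aJ − b·∇J. Then there exist x₁,y₁,σ>0 sufficiently small such that, for every k∈(0,1), 𝒫J ≤ 0 everywhere in Q=(0,x₁)×(0,y₁)×(T−σ,T). -/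

import Mathlib

open Real Set Filter MeasureTheory

noncomputable section

/-- Partial derivative of `u(x,y,t)` with respect to `x`. -/
def pdx (u : ℝ → ℝ → ℝ → ℝ) (x y t : ℝ) : ℝ := deriv (fun s => u s y t) x

/-- Partial derivative with respect to `y`. -/
def pdy (u : ℝ → ℝ → ℝ → ℝ) (x y t : ℝ) : ℝ := deriv (fun s => u x s t) y

/-- Partial derivative with respect to `t`. -/
def pdt (u : ℝ → ℝ → ℝ → ℝ) (x y t : ℝ) : ℝ := deriv (fun s => u x y s) t

/-- Second partial derivative with respect to `x`. -/
def pdxx (u : ℝ → ℝ → ℝ → ℝ) (x y t : ℝ) : ℝ := deriv (fun s => pdx u s y t) x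

/-- Second partial derivative with respect to `y`. -/
def pdyy (u : ℝ → ℝ → ℝ → ℝ) (x y t : ℝ) : ℝ := deriv (fun s => pdy u x s t) y

/-- Mixed second partial derivative `u_{xy}` (first `x`, then `y`). -/
def pdxy (u : ℝ → ℝ → ℝ → ℝ) (x y t : ℝ) : ℝ := deriv (fun s => pdx u x s t) y

/-- The norm of the spatial gradient, `|∇u| = (u_x² + u_y²)^{1/2}`. -/
def gradNorm (u : ℝ → ℝ → ℝ → ℝ) (x y t : ℝ) : ℝ :=
  Real.sqrt ((pdx u x y t) ^ 2 + (pdy u x y t) ^ 2)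

/-- `C^{2,1}`-type regularity of `u` at the point `(x,y,t)`: twice (continuously)
differentiable in the space variables and once in time. -/
def C21At (u : ℝ → ℝ → ℝ → ℝ) (x y t : ℝ) : Prop :=
  DifferentiableAt ℝ (fun s => u s y t) x ∧
  DifferentiableAt ℝ (fun s => u x s t) y ∧
  DifferentiableAt ℝ (fun s => u x y s) t ∧
  DifferentiableAt ℝ (fun s => pdx u s y t) x ∧
  DifferentiableAt ℝ (fun s => pdy u x s t) y ∧
  DifferentiableAt ℝ (fun s => pdx u x s t) y ∧
  ContinuousAt (fun q : ℝ × ℝ × ℝ => u q.1 q.2.1 q.2.2) (x, y, t) ∧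
  ContinuousAt (fun q : ℝ × ℝ × ℝ => pdx u q.1 q.2.1 q.2.2) (x, y, t) ∧
  ContinuousAt (fun q : ℝ × ℝ × ℝ => pdy u q.1 q.2.1 q.2.2) (x, y, t) ∧
  ContinuousAt (fun q : ℝ × ℝ × ℝ => pdt u q.1 q.2.1 q.2.2) (x, y, t) ∧
  ContinuousAt (fun q : ℝ × ℝ × ℝ => pdxx u q.1 q.2.1 q.2.2) (x, y, t) ∧
  ContinuousAt (fun q : ℝ × ℝ × ℝ => pdyy u q.1 q.2.1 q.2.2) (x, y, t) ∧
  ContinuousAt (fun q : ℝ × ℝ × ℝ => pdxy u q.1 q.2.1 q.2.2) (x, y, t)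

/-- `u` is a nonnegative classical solution of `u_t - Δu = |∇u|^p` in
`Q_T = ω × (0,T)`, `ω = (-L,L) × (0,L)`, with `u = 0` on `Γ_T = (-L,L) × {0} × (0,T)`. -/
structure ClassicalSolution (p L T : ℝ) (u : ℝ → ℝ → ℝ → ℝ) : Prop where
  nonneg : ∀ ⦃x y t : ℝ⦄, |x| ≤ L → y ∈ Icc (0:ℝ) L → t ∈ Ioo 0 T → 0 ≤ u x y t
  smooth : ∀ ⦃x y t : ℝ⦄, |x| ≤ L → y ∈ Icc (0:ℝ) L → t ∈ Ioo 0 T → C21At u x y t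
  pde : ∀ ⦃x y t : ℝ⦄, |x| < L → y ∈ Ioo (0:ℝ) L → t ∈ Ioo 0 T →
    pdt u x y t - (pdxx u x y t + pdyy u x y t) = gradNorm u x y t ^ p
  bc : ∀ ⦃x t : ℝ⦄, |x| < L → t ∈ Ioo 0 T → u x 0 t = 0

/-- `u` has an isolated gradient blow-up point at `(0,0,T)`:
`limsup |∇u| = ∞` at `(0,0,T)` while `∇u` stays bounded on `K × (0,T)` for every
compact `K ⊆ ω̄ \ {(0,0)}`. -/
structure IsolatedGBU (L T : ℝ) (u : ℝ → ℝ → ℝ → ℝ) : Prop where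
  blowup : ∀ M : ℝ, ∀ δ > (0:ℝ), ∃ x y t : ℝ, |x| ≤ L ∧ y ∈ Icc (0:ℝ) L ∧
    t ∈ Ioo 0 T ∧ |x| < δ ∧ |y| < δ ∧ T - δ < t ∧ M < gradNorm u x y t
  bounded : ∀ K : Set (ℝ × ℝ), IsCompact K →
    K ⊆ (Icc (-L) L ×ˢ Icc (0:ℝ) L) \ {((0:ℝ), (0:ℝ))} →
    ∃ M : ℝ, ∀ q ∈ K, ∀ t ∈ Ioo (0:ℝ) T, gradNorm u q.1 q.2 t ≤ M

/-- `u` extends as a `C^{2,1}` function to `(ω̄' × [T/2,T]) \ {(0,0,T)}`,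
`ω' = (-L/2,L/2) × (0,L/2)`; values and derivatives at `t = T` refer to this extension. -/
def ExtC21 (L T : ℝ) (u : ℝ → ℝ → ℝ → ℝ) : Prop :=
  ∀ ⦃x y t : ℝ⦄, |x| ≤ L / 2 → y ∈ Icc (0:ℝ) (L / 2) → t ∈ Icc (T / 2) T →
    ¬(x = 0 ∧ y = 0 ∧ t = T) → C21At u x y t

/-- The monotonicity condition `x·u_x ≤ 0` in `Q_T`. -/
def MonCond (L T : ℝ) (u : ℝ → ℝ → ℝ → ℝ) : Prop :=
  ∀ ⦃x y t : ℝ⦄, |x| < L → y ∈ Ioo (0:ℝ) L → t ∈ Ioo 0 T → x * pdx u x y t ≤ 0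

/-- The auxiliary function `J = u_x + c(x) d(y) F(u)` with `c(x) = kx`,
`d(y) = y^{-γ}(1+y)`, `F(s) = s^q`, `γ = q(1-β)`, `β = 1/(p-1)`. -/
def Jfun (p q k : ℝ) (u : ℝ → ℝ → ℝ → ℝ) (x y t : ℝ) : ℝ :=
  pdx u x y t + k * x * y ^ (-(q * (1 - 1/(p-1)))) * (1 + y) * (u x y t) ^ q

/-- The parabolic operator `𝒫J = J_t - ΔJ - aJ - b·∇J` applied to `J`, where
`a = -p c'(x) d(y) F(u) |∇u|^{p-2} - 2 c'(x) d(y) F'(u)` and `b = p|∇u|^{p-2}∇u`. -/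
def PJ (p q k : ℝ) (u : ℝ → ℝ → ℝ → ℝ) (x y t : ℝ) : ℝ :=
  pdt (Jfun p q k u) x y t
    - (pdxx (Jfun p q k u) x y t + pdyy (Jfun p q k u) x y t)
    - (-(p * k * (y ^ (-(q * (1 - 1/(p-1)))) * (1 + y)) * (u x y t) ^ q *
          gradNorm u x y t ^ (p - 2))
        - 2 * k * (y ^ (-(q * (1 - 1/(p-1)))) * (1 + y)) * (q * (u x y t) ^ (q - 1)))
        * Jfun p q k u x y t
    - p * gradNorm u x y t ^ (p - 2) *
        (pdx u x y t * pdx (Jfun p q k u) x y t +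
         pdy u x y t * pdy (Jfun p q k u) x y t)

/-- Admissible kernels. -/
structure Ker (κ : ℝ × ℝ → ℝ) : Prop where
  cont : Continuous κ
  dec : ∃ C, 0 ≤ C ∧ ∀ z, |κ z| ≤ C * (1 + ‖z‖) ^ (-(4:ℝ))

theorem one_add_norm_integrable : Integrable (fun z : ℝ × ℝ => (1 + ‖z‖) ^ (-(4:ℝ))) := by
  apply integrable_one_add_norm
  simp; norm_num

theorem one_add_norm_integrable3 : Integrable (fun z : ℝ × ℝ => (1 + ‖z‖) ^ (-(3:ℝ))) := by
  apply integrable_one_add_norm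
  simp; norm_num

theorem Ker.integrable {κ : ℝ × ℝ → ℝ} (h : Ker κ) : Integrable κ := by
  obtain ⟨C, _, hb⟩ := h.dec
  exact (one_add_norm_integrable.const_mul C).mono' h.cont.aestronglyMeasurable
    (Eventually.of_forall hb)

theorem decay_shift (z e : ℝ × ℝ) (he : ‖e‖ ≤ 1) (s : ℝ) (hs : |s| ≤ 1) :
    (1 + ‖z + s • e‖) ^ (-(4:ℝ)) ≤ 16 * (1 + ‖z‖) ^ (-(4:ℝ)) := by
  have h1 : ‖z‖ ≤ ‖z + s • e‖ + 1 := by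
    have : ‖z‖ ≤ ‖z + s • e‖ + ‖s • e‖ := by
      have := norm_sub_le (z + s • e) (s • e)
      simpa using this
    have h2 : ‖s • e‖ ≤ 1 := by
      rw [norm_smul, Real.norm_eq_abs]; nlinarith [abs_nonneg s, norm_nonneg e]
    linarith
  have h3 : (1 + ‖z‖) / 2 ≤ 1 + ‖z + s • e‖ := by
    linarith [norm_nonneg (z + s • e)]
  have hz := norm_nonneg z
  calc (1 + ‖z + s • e‖) ^ (-(4:ℝ)) ≤ ((1 + ‖z‖) / 2) ^ (-(4:ℝ)) :=
        Real.rpow_le_rpow_of_nonpos (by positivity) h3 (by norm_num)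
    _ = 16 * (1 + ‖z‖) ^ (-(4:ℝ)) := by
        rw [Real.div_rpow (by positivity) (by norm_num)]
        have : (2:ℝ) ^ (-(4:ℝ)) = 1/16 := by
          rw [Real.rpow_neg (by norm_num)]; norm_num
        rw [this]; ring

/-- Heat-type averages. -/
def Theta (κ : ℝ × ℝ → ℝ) (G : (ℝ × ℝ) × ℝ → ℝ) (τ : ℝ) (P : ℝ × ℝ) (t : ℝ) : ℝ :=
  ∫ z, κ z * G (P + √τ • z, t - τ)

theorem Theta_integrable {κ : ℝ × ℝ → ℝ} (hκ : Ker κ) {G : (ℝ × ℝ) × ℝ → ℝ} (hG : Continuous G)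
    {M : ℝ} (hM : ∀ X, |G X| ≤ M) (τ : ℝ) (P : ℝ × ℝ) (t : ℝ) :
    Integrable (fun z => κ z * G (P + √τ • z, t - τ)) := by
  refine (hκ.integrable.abs.mul_const M).mono' ?_ ?_
  · have := hκ.cont
    exact Continuous.aestronglyMeasurable (by fun_prop)
  · refine Eventually.of_forall fun z => ?_
    rw [Real.norm_eq_abs, abs_mul]
    exact mul_le_mul_of_nonneg_left (hM _) (abs_nonneg _)

theorem Theta_bound {κ : ℝ × ℝ → ℝ} (hκ : Ker κ) {G : (ℝ × ℝ) × ℝ → ℝ}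
    {M : ℝ} (hM : ∀ X, |G X| ≤ M) (τ : ℝ) (P : ℝ × ℝ) (t : ℝ) :
    |Theta κ G τ P t| ≤ (∫ z, |κ z|) * M := by
  unfold Theta
  rw [← integral_mul_const, ← Real.norm_eq_abs]
  refine norm_integral_le_of_norm_le (hκ.integrable.abs.mul_const M) ?_
  refine Eventually.of_forall fun z => ?_
  rw [Real.norm_eq_abs, abs_mul]
  exact mul_le_mul_of_nonneg_left (hM _) (abs_nonneg _)

theorem Theta_cont {κ : ℝ × ℝ → ℝ} (hκ : Ker κ) {G : (ℝ × ℝ) × ℝ → ℝ} (hG : Continuous G)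
    {M : ℝ} (hM : ∀ X, |G X| ≤ M) :
    Continuous (fun Y : ℝ × (ℝ × ℝ) × ℝ => Theta κ G Y.1 Y.2.1 Y.2.2) := by
  unfold Theta
  refine continuous_of_dominated (bound := fun z => |κ z| * M) ?_ ?_ (hκ.integrable.abs.mul_const M) ?_
  · intro Y
    exact (Theta_integrable hκ hG hM Y.1 Y.2.1 Y.2.2).aestronglyMeasurable
  · intro Y
    refine Eventually.of_forall fun z => ?_
    rw [Real.norm_eq_abs, abs_mul]
    exact mul_le_mul_of_nonneg_left (hM _) (abs_nonneg _)
  · refine Eventually.of_forall fun z => ?_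
    have := hκ.cont
    have : Continuous fun Y : ℝ × (ℝ × ℝ) × ℝ => G (Y.2.1 + √Y.1 • z, Y.2.2 - Y.1) := by fun_prop
    exact continuous_const.mul this

/-- `κ'` is the derivative of `κ` in direction `e`. -/
def DKer (κ κ' : ℝ × ℝ → ℝ) (e : ℝ × ℝ) : Prop :=
  ∀ z : ℝ × ℝ, ∀ s : ℝ, HasDerivAt (fun s : ℝ => κ (z + s • e)) (κ' (z + s • e)) s

theorem Theta_deriv {κ κ' : ℝ × ℝ → ℝ} {e : ℝ × ℝ} (he : ‖e‖ ≤ 1) (hκ : Ker κ) (hκ' : Ker κ')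
    (hd : DKer κ κ' e) {G : (ℝ × ℝ) × ℝ → ℝ} (hG : Continuous G)
    {M : ℝ} (hM : ∀ X, |G X| ≤ M) {τ : ℝ} (hτ : 0 < τ) (P : ℝ × ℝ) (t h0 : ℝ) :
    HasDerivAt (fun h : ℝ => Theta κ G τ (P + h • e) t)
      (-(√τ)⁻¹ * Theta κ' G τ (P + h0 • e) t) h0 := by
  have hs : 0 < √τ := Real.sqrt_pos.2 hτ
  obtain ⟨C, hC, hb⟩ := hκ'.dec
  have key : ∀ h : ℝ, Theta κ G τ (P + h • e) t =
      ∫ z, κ (z + (-(h - h0) * (√τ)⁻¹) • e) * G (P + h0 • e + √τ • z, t - τ) := by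
    intro h
    unfold Theta
    rw [← integral_add_right_eq_self (fun z => κ z * G (P + h • e + √τ • z, t - τ))
      ((-(h - h0) * (√τ)⁻¹) • e)]
    congr 1; ext z
    congr 3
    rw [smul_add, smul_smul]
    have : √τ * (-(h - h0) * (√τ)⁻¹) = -(h - h0) := by field_simp
    rw [this]; module
  simp_rw [key]
  have hM0 : 0 ≤ M := (abs_nonneg _).trans (hM (P, t))
  have main := hasDerivAt_integral_of_dominated_loc_of_deriv_le (μ := (volume : Measure (ℝ × ℝ)))
    (F := fun (h : ℝ) z => κ (z + (-(h - h0) * (√τ)⁻¹) • e) * G (P + h0 • e + √τ • z, t - τ))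
    (F' := fun (h : ℝ) z => κ' (z + (-(h - h0) * (√τ)⁻¹) • e) * (-(√τ)⁻¹) *
       G (P + h0 • e + √τ • z, t - τ)) (x₀ := h0)
    (s := Metric.ball h0 (√τ)) (bound := fun z => C * (16 * (1 + ‖z‖) ^ (-(4:ℝ))) * (√τ)⁻¹ * M)
    (Metric.ball_mem_nhds _ hs) ?_ ?_ ?_ ?_ ?_ ?_
  · refine main.2.congr_deriv ?_
    unfold Theta
    rw [← integral_const_mul]
    congr 1; ext z; simp; ring
  · refine Eventually.of_forall fun h => ?_
    have := hκ.cont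
    exact Continuous.aestronglyMeasurable (by fun_prop)
  · have := Theta_integrable hκ hG hM τ (P + h0 • e) t
    simpa using this
  · have := hκ'.cont
    exact Continuous.aestronglyMeasurable (by fun_prop)
  · refine Eventually.of_forall fun z h hh => ?_
    rw [Metric.mem_ball, Real.dist_eq] at hh
    rw [Real.norm_eq_abs, abs_mul, abs_mul]
    have h1 : |κ' (z + (-(h - h0) * (√τ)⁻¹) • e)| ≤ C * (16 * (1 + ‖z‖) ^ (-(4:ℝ))) := by
      refine (hb _).trans (mul_le_mul_of_nonneg_left (decay_shift z e he _ ?_) hC)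
      rw [abs_mul, abs_neg, abs_inv, abs_of_pos hs, ← div_eq_mul_inv, div_le_one hs]
      exact hh.le
    have h2 : |-(√τ)⁻¹| = (√τ)⁻¹ := by rw [abs_neg, abs_inv, abs_of_pos hs]
    rw [h2]
    gcongr
    exact hM _
  · exact ((((one_add_norm_integrable.const_mul 16).const_mul C).mul_const _).mul_const M)
  · refine Eventually.of_forall fun z h _ => ?_
    have h1 := hd z (-(h - h0) * (√τ)⁻¹)
    have h2 : HasDerivAt (fun h : ℝ => -(h - h0) * (√τ)⁻¹) (-(√τ)⁻¹) h := by
      have := (((hasDerivAt_id h).sub_const h0).neg).mul_const ((√τ)⁻¹)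
      simpa using! this
    exact (h1.comp h h2).mul_const _

/-- derivative falling on `G` -/
theorem Theta_deriv' {κ : ℝ × ℝ → ℝ} {e : ℝ × ℝ} (hκ : Ker κ)
    {G G' : (ℝ × ℝ) × ℝ → ℝ} (hG : Continuous G) (hG' : Continuous G')
    {M : ℝ} (hM : ∀ X, |G X| ≤ M) (hM' : ∀ X, |G' X| ≤ M)
    (hd : ∀ X, HasLineDerivAt ℝ G (G' X) X (e, 0)) (τ : ℝ) (P : ℝ × ℝ) (t h0 : ℝ) :
    HasDerivAt (fun h : ℝ => Theta κ G τ (P + h • e) t)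
      (Theta κ G' τ (P + h0 • e) t) h0 := by
  unfold Theta
  refine (hasDerivAt_integral_of_dominated_loc_of_deriv_le (μ := (volume : Measure (ℝ × ℝ)))
    (F := fun (h : ℝ) z => κ z * G (P + h • e + √τ • z, t - τ))
    (F' := fun (h : ℝ) z => κ z * G' (P + h • e + √τ • z, t - τ)) (x₀ := h0)
    (s := univ) (bound := fun z => |κ z| * M) univ_mem ?_ ?_ ?_ ?_ ?_ ?_).2
  · refine Eventually.of_forall fun h => ?_
    exact (Theta_integrable hκ hG hM τ (P + h • e) t).aestronglyMeasurable
  · exact (Theta_integrable hκ hG hM τ (P + h0 • e) t)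
  · exact (Theta_integrable hκ hG' hM' τ (P + h0 • e) t).aestronglyMeasurable
  · refine Eventually.of_forall fun z h _ => ?_
    rw [Real.norm_eq_abs, abs_mul]
    exact mul_le_mul_of_nonneg_left (hM' _) (abs_nonneg _)
  · exact hκ.integrable.abs.mul_const M
  · refine Eventually.of_forall fun z h _ => ?_
    have h1 := hd (P + h • e + √τ • z, t - τ)
    rw [HasLineDerivAt] at h1
    have h2 : HasDerivAt (fun h' : ℝ => h' - h) 1 h := by
      simpa using! (hasDerivAt_id h).sub_const h
    have h3 := HasDerivAt.comp (h₂ := fun s : ℝ => G ((P + h • e + √τ • z, t - τ) + s • (e, (0:ℝ))))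
      (h₂' := G' (P + h • e + √τ • z, t - τ)) h (by simpa using! h1) h2
    have h4 := h3.const_mul (κ z)
    have h5 : (fun h' : ℝ => κ z * G (P + h' • e + √τ • z, t - τ)) = fun y => κ z *
        ((fun s : ℝ => G ((P + h • e + √τ • z, t - τ) + s • (e, (0:ℝ)))) ∘ fun h' => h' - h) y := by
      funext h'
      simp only [Function.comp]
      congr 2
      ext <;> simp <;> ring
    rw [h5]
    exact h4.congr_deriv (by ring)

theorem Theta_ibp {κ κ' : ℝ × ℝ → ℝ} {e : ℝ × ℝ} (he : ‖e‖ ≤ 1) (hκ : Ker κ) (hκ' : Ker κ')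
    (hdκ : DKer κ κ' e)
    {G G' : (ℝ × ℝ) × ℝ → ℝ} (hG : Continuous G) (hG' : Continuous G')
    {M : ℝ} (hM : ∀ X, |G X| ≤ M) (hM' : ∀ X, |G' X| ≤ M)
    (hd : ∀ X, HasLineDerivAt ℝ G (G' X) X (e, 0)) {τ : ℝ} (hτ : 0 < τ) (P : ℝ × ℝ) (t : ℝ) :
    Theta κ G' τ P t = -(√τ)⁻¹ * Theta κ' G τ P t := by
  have h1 := Theta_deriv he hκ hκ' hdκ hG hM hτ P t 0
  have h2 := Theta_deriv' hκ hG hG' hM hM' hd τ P t 0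
  simpa using h2.unique h1

def dt (e z : ℝ × ℝ) : ℝ := e.1 * z.1 + e.2 * z.2
def kg (z : ℝ × ℝ) : ℝ := Real.exp (-(dt z z) / 4)
def ke (e z : ℝ × ℝ) : ℝ := -(dt e z / 2) * kg z
def kee (e f z : ℝ × ℝ) : ℝ := (dt e z * dt f z / 4 - dt e f / 2) * kg z

theorem kg_pos (z : ℝ × ℝ) : 0 < kg z := Real.exp_pos _

theorem dt_abs (e z : ℝ × ℝ) : |dt e z| ≤ 2 * ‖e‖ * ‖z‖ := by
  have h1 : |e.1| ≤ ‖e‖ := norm_fst_le e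
  have h2 : |e.2| ≤ ‖e‖ := norm_snd_le e
  have h3 : |z.1| ≤ ‖z‖ := norm_fst_le z
  have h4 : |z.2| ≤ ‖z‖ := norm_snd_le z
  unfold dt
  calc |e.1 * z.1 + e.2 * z.2| ≤ |e.1| * |z.1| + |e.2| * |z.2| := by
        rw [← abs_mul, ← abs_mul]; exact abs_add_le _ _
    _ ≤ ‖e‖ * ‖z‖ + ‖e‖ * ‖z‖ := by gcongr
    _ = _ := by ring

theorem kg_le (z : ℝ × ℝ) : kg z ≤ Real.exp 36 * (1 + ‖z‖) ^ (-(6:ℝ)) := by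
  have hz := norm_nonneg z
  have h1 : ‖z‖ ^ 2 ≤ dt z z := by
    unfold dt
    rw [Prod.norm_def]
    rcases max_cases ‖z.1‖ ‖z.2‖ with ⟨h, _⟩ | ⟨h, _⟩ <;> rw [h, Real.norm_eq_abs, sq_abs] <;>
      nlinarith [sq_nonneg z.1, sq_nonneg z.2]
  have h2 : (1 + ‖z‖) ^ (6:ℝ) ≤ Real.exp (36 + dt z z / 4) := by
    calc (1 + ‖z‖) ^ (6:ℝ) ≤ (Real.exp ‖z‖) ^ (6:ℝ) := by
          apply Real.rpow_le_rpow (by positivity) _ (by norm_num)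
          linarith [Real.add_one_le_exp ‖z‖]
      _ = Real.exp (‖z‖ * 6) := (Real.exp_mul _ _).symm
      _ ≤ _ := by
          apply Real.exp_le_exp.2
          nlinarith [sq_nonneg (‖z‖ - 12)]
  rw [Real.rpow_neg (by positivity), ← div_eq_mul_inv, le_div_iff₀ (by positivity)]
  calc kg z * (1 + ‖z‖) ^ (6:ℝ) ≤ kg z * Real.exp (36 + dt z z / 4) :=
        mul_le_mul_of_nonneg_left h2 (kg_pos z).le
    _ = Real.exp 36 := by
        unfold kg; rw [← Real.exp_add]; congr 1; ring

theorem dt_cont (e : ℝ × ℝ) : Continuous (dt e) := by unfold dt; fun_prop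
theorem kg_cont : Continuous kg := by unfold kg dt; fun_prop

theorem ker_of_poly {Q : ℝ × ℝ → ℝ} (hQ : Continuous Q) {c : ℝ} (hc : 0 ≤ c)
    (h : ∀ z, |Q z| ≤ c * (1 + ‖z‖) ^ (2:ℝ)) : Ker (fun z => Q z * kg z) := by
  refine ⟨hQ.mul kg_cont, c * Real.exp 36, by positivity, fun z => ?_⟩
  have hz := norm_nonneg z
  rw [abs_mul, abs_of_pos (kg_pos z)]
  calc |Q z| * kg z ≤ (c * (1 + ‖z‖) ^ (2:ℝ)) * (Real.exp 36 * (1 + ‖z‖) ^ (-(6:ℝ))) := by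
        gcongr
        · exact (kg_pos z).le
        · exact h z
        · exact kg_le z
    _ = c * Real.exp 36 * ((1 + ‖z‖) ^ (2:ℝ) * (1 + ‖z‖) ^ (-(6:ℝ))) := by ring
    _ = _ := by rw [← Real.rpow_add (by positivity)]; norm_num

theorem ker_kg : Ker kg := by
  have := ker_of_poly (Q := fun _ => 1) (by fun_prop) (c := 1) (by norm_num) (fun z => by
    have := norm_nonneg z
    simp only [abs_one, one_mul, Real.rpow_two]; nlinarith)
  simpa using this

theorem ker_ke (e : ℝ × ℝ) : Ker (ke e) := by
  refine ker_of_poly (Q := fun z => -(dt e z / 2)) ?_ (c := ‖e‖) (norm_nonneg _) (fun z => ?_)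
  · have := dt_cont e; fun_prop
  · have := norm_nonneg z
    have h2 := dt_abs e z
    rw [abs_neg, abs_div, abs_two, Real.rpow_two]
    have he := norm_nonneg e
    nlinarith [mul_nonneg he this, mul_nonneg he (sq_nonneg ‖z‖)]

theorem ker_kee (e f : ℝ × ℝ) : Ker (kee e f) := by
  refine ker_of_poly (Q := fun z => (dt e z * dt f z / 4 - dt e f / 2)) ?_ (c := ‖e‖ * ‖f‖)
    (by positivity) (fun z => ?_)
  · have := dt_cont e; have := dt_cont f; fun_prop
  · have hz := norm_nonneg z
    have h2 := dt_abs e z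
    have h3 := dt_abs f z
    have h4 := dt_abs e f
    rw [Real.rpow_two]
    have he := norm_nonneg e
    have hf := norm_nonneg f
    calc |dt e z * dt f z / 4 - dt e f / 2| ≤ |dt e z * dt f z / 4| + |dt e f / 2| := abs_sub _ _
      _ = |dt e z| * |dt f z| / 4 + |dt e f| / 2 := by
          rw [abs_div, abs_div, abs_mul]; norm_num
      _ ≤ (2 * ‖e‖ * ‖z‖) * (2 * ‖f‖ * ‖z‖) / 4 + (2 * ‖e‖ * ‖f‖) / 2 := by gcongr
      _ ≤ _ := by nlinarith [mul_nonneg he hf, mul_nonneg (mul_nonneg he hf) hz]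

theorem dt_line (e z f : ℝ × ℝ) (s : ℝ) :
    HasDerivAt (fun s : ℝ => dt e (z + s • f)) (dt e f) s := by
  unfold dt
  simp only [Prod.fst_add, Prod.snd_add, Prod.smul_fst, Prod.smul_snd, smul_eq_mul]
  have h1 := (((hasDerivAt_id s).mul_const f.1).const_add z.1).const_mul e.1
  have h2 := (((hasDerivAt_id s).mul_const f.2).const_add z.2).const_mul e.2
  exact (h1.add h2).congr_deriv (by ring)

theorem dker_kg (e : ℝ × ℝ) : DKer kg (ke e) e := by
  intro z s
  have h : HasDerivAt (fun s : ℝ => -(dt (z + s • e) (z + s • e)) / 4)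
      (-(dt e (z + s • e) / 2)) s := by
    have h1 : HasDerivAt (fun s : ℝ => z.1 + s * e.1) e.1 s := by
      simpa using! ((hasDerivAt_id s).mul_const e.1).const_add z.1
    have h2 : HasDerivAt (fun s : ℝ => z.2 + s * e.2) e.2 s := by
      simpa using! ((hasDerivAt_id s).mul_const e.2).const_add z.2
    have := (((h1.mul h1).add (h2.mul h2)).neg).div_const 4
    refine (this.congr_deriv ?_)
    simp only [dt, Prod.fst_add, Prod.snd_add, Prod.smul_fst, Prod.smul_snd, smul_eq_mul]
    ring
  have := h.exp
  refine this.congr_deriv ?_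
  unfold ke kg; ring

theorem dker_ke (e f : ℝ × ℝ) : DKer (ke e) (kee e f) f := by
  intro z s
  have h1 : HasDerivAt (fun s : ℝ => -(dt e (z + s • f) / 2)) (-(dt e f / 2)) s :=
    ((dt_line e z f s).div_const 2).neg
  have h2 := h1.mul (dker_kg f z s)
  refine h2.congr_deriv ?_
  unfold kee ke; ring

theorem kee_int (e f : ℝ × ℝ) (hf : ‖f‖ ≤ 1) : ∫ z, kee e f z = 0 := by
  have h1 := Theta_deriv hf (ker_ke e) (ker_kee e f) (dker_ke e f) (G := fun _ => 1)
    continuous_const (M := 1) (by simp) (τ := 1) one_pos 0 0 0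
  have h2 : HasDerivAt (fun h : ℝ => Theta (ke e) (fun _ => 1) 1 (0 + h • f) 0) 0 0 := by
    unfold Theta
    exact hasDerivAt_const _ _
  have := h2.unique h1
  simpa [Theta] using this

def NN : ℝ := ∫ z, kg z

theorem NN_pos : 0 < NN := by
  unfold NN
  rw [integral_pos_iff_support_of_nonneg (fun z => (kg_pos z).le) ker_kg.integrable]
  have : Function.support kg = univ := by
    ext z; simp [(kg_pos z).ne']
  rw [this]; simp

/-- Duhamel representation. -/
theorem duhamel {U Ux Uy Ut Uxx Uyy : (ℝ × ℝ) × ℝ → ℝ}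
    (hc : Continuous U) (hcx : Continuous Ux) (hcy : Continuous Uy) (hct : Continuous Ut)
    (hcxx : Continuous Uxx) (hcyy : Continuous Uyy) {M : ℝ}
    (hb : ∀ X, |U X| ≤ M) (hbx : ∀ X, |Ux X| ≤ M) (hby : ∀ X, |Uy X| ≤ M) (hbt : ∀ X, |Ut X| ≤ M)
    (hbxx : ∀ X, |Uxx X| ≤ M) (hbyy : ∀ X, |Uyy X| ≤ M)
    (hU : ∀ X, ∃ l : (ℝ × ℝ) × ℝ →L[ℝ] ℝ, HasFDerivAt U l X ∧
      ∀ v, l v = Ux X * v.1.1 + Uy X * v.1.2 + Ut X * v.2)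
    (hdx : ∀ X, HasLineDerivAt ℝ Ux (Uxx X) X (((1:ℝ),(0:ℝ)), (0:ℝ)))
    (hdy : ∀ X, HasLineDerivAt ℝ Uy (Uyy X) X (((0:ℝ),(1:ℝ)), (0:ℝ)))
    {T1 : ℝ} (hT1 : 0 < T1) (P : ℝ × ℝ) (t : ℝ) (h0 : ∀ Q, U (Q, t - T1) = 0) :
    NN * U (P, t) = ∫ τ in Ioc 0 T1, Theta kg (fun X => Ut X - Uxx X - Uyy X) τ P t := by
  set F : (ℝ × ℝ) × ℝ → ℝ := fun X => Ut X - Uxx X - Uyy X with hF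
  have hcF : Continuous F := by fun_prop
  have hbF : ∀ X, |F X| ≤ 3 * M := fun X => by
    have h1 := abs_le.1 (hbt X); have h2 := abs_le.1 (hbxx X); have h3 := abs_le.1 (hbyy X)
    rw [abs_le]; constructor <;> simp only [hF] <;> linarith
  have hM0 : 0 ≤ M := (abs_nonneg _).trans (hb (P, t))
  have hg : ∀ τ ∈ Ioo 0 T1, HasDerivAt (fun τ => Theta kg U τ P t) (-(Theta kg F τ P t)) τ := by
    intro τ hτ
    have hτ0 : 0 < τ := hτ.1
    have hsq : 0 < √τ := Real.sqrt_pos.2 hτ0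
    have e1 : ‖((1:ℝ),(0:ℝ))‖ ≤ 1 := by simp [Prod.norm_def]
    have e2 : ‖((0:ℝ),(1:ℝ))‖ ≤ 1 := by simp [Prod.norm_def]
    have i1 := Theta_ibp e1 ker_kg (ker_ke _) (dker_kg _) hcx hcxx hbx hbxx hdx hτ0 P t
    have i2 := Theta_ibp e2 ker_kg (ker_ke _) (dker_kg _) hcy hcyy hby hbyy hdy hτ0 P t
    set e₁ : ℝ × ℝ := ((1:ℝ),(0:ℝ)) with he₁
    set e₂ : ℝ × ℝ := ((0:ℝ),(1:ℝ)) with he₂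
    have I1 := Theta_integrable (ker_ke e₁) hcx hbx τ P t
    have I2 := Theta_integrable (ker_ke e₂) hcy hby τ P t
    have I3 := Theta_integrable ker_kg hct hbt τ P t
    have I4 := Theta_integrable ker_kg hcxx hbxx τ P t
    have I5 := Theta_integrable ker_kg hcyy hbyy τ P t
    obtain ⟨C1, hC1, hk1⟩ := (ker_ke e₁).dec
    obtain ⟨C2, hC2, hk2⟩ := (ker_ke e₂).dec
    obtain ⟨C3, hC3, hk3⟩ := ker_kg.dec
    have main := hasDerivAt_integral_of_dominated_loc_of_deriv_le (μ := (volume : Measure (ℝ × ℝ)))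
      (F := fun (τ : ℝ) z => kg z * U (P + √τ • z, t - τ))
      (F' := fun (τ : ℝ) z => -(√τ)⁻¹ * (ke e₁ z * Ux (P + √τ • z, t - τ)) +
        -(√τ)⁻¹ * (ke e₂ z * Uy (P + √τ • z, t - τ)) - kg z * Ut (P + √τ • z, t - τ)) (x₀ := τ)
      (s := Ioi (τ/2)) (bound := fun z => ((√(τ/2))⁻¹ * (|ke e₁ z| * M)) +
        (√(τ/2))⁻¹ * (|ke e₂ z| * M) + kg z * M)
      (Ioi_mem_nhds (by linarith)) ?_ ?_ ?_ ?_ ?_ ?_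
    · refine main.2.congr_deriv ?_
      rw [integral_sub, integral_add, integral_const_mul, integral_const_mul]
      · have : Theta kg F τ P t = Theta kg Ut τ P t - Theta kg Uxx τ P t - Theta kg Uyy τ P t := by
          unfold Theta
          have I34 : Integrable (fun z => kg z * Ut (P + √τ • z, t - τ) -
            kg z * Uxx (P + √τ • z, t - τ)) := I3.sub I4
          rw [← integral_sub I3 I4, ← integral_sub I34 I5]
          congr 1; ext z; simp only [hF]; ring
        rw [this, i1, i2]
        unfold Theta; ring
      · exact I1.const_mul _
      · exact I2.const_mul _
      · exact (I1.const_mul _).add (I2.const_mul _)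
      · exact I3
    · exact Eventually.of_forall fun τ => (Theta_integrable ker_kg hc hb τ P t).aestronglyMeasurable
    · exact Theta_integrable ker_kg hc hb τ P t
    · exact (((I1.const_mul _).add (I2.const_mul _)).sub I3).aestronglyMeasurable
    · refine Eventually.of_forall fun z τ' hτ' => ?_
      have hpos : 0 < √(τ/2) := Real.sqrt_pos.2 (by linarith)
      have hle : (√τ')⁻¹ ≤ (√(τ/2))⁻¹ :=
        inv_anti₀ hpos (Real.sqrt_le_sqrt (le_of_lt hτ'))
      have hnn : 0 ≤ (√τ')⁻¹ := by positivity
      refine (norm_sub_le _ _).trans (add_le_add ((norm_add_le _ _).trans (add_le_add ?_ ?_)) ?_)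
      · rw [norm_mul, norm_mul, norm_neg, Real.norm_of_nonneg hnn]
        gcongr
        · rfl
        · exact hbx _
      · rw [norm_mul, norm_mul, norm_neg, Real.norm_of_nonneg hnn]
        gcongr
        · rfl
        · exact hby _
      · rw [norm_mul, Real.norm_of_nonneg (kg_pos z).le]
        gcongr
        · exact (kg_pos z).le
        · exact hbt _
    · exact ((((ker_ke e₁).integrable.abs.mul_const M).const_mul _).add
        (((ker_ke e₂).integrable.abs.mul_const M).const_mul _)).add (ker_kg.integrable.mul_const M)
    · refine Eventually.of_forall fun z τ' hτ' => ?_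
      have hτ'0 : 0 < τ' := lt_trans (by linarith) hτ'
      obtain ⟨l, hl, hlv⟩ := hU (P + √τ' • z, t - τ')
      have hs : HasDerivAt (fun s : ℝ => √s) (1 / (2 * √τ')) τ' := Real.hasDerivAt_sqrt hτ'0.ne'
      have hp1 : HasDerivAt (fun s : ℝ => P + √s • z) ((1 / (2 * √τ')) • z) τ' :=
        (hs.smul_const z).const_add P
      have hp2 : HasDerivAt (fun s : ℝ => t - s) (-1) τ' := by
        simpa using! (hasDerivAt_id τ').const_sub t
      have hp := hp1.prodMk hp2
      have h1 := (hl.comp_hasDerivAt τ' hp).const_mul (kg z)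
      refine h1.congr_deriv ?_
      rw [hlv]
      have hsq' : √τ' ≠ 0 := (Real.sqrt_pos.2 hτ'0).ne'
      simp only [ke, dt, he₁, he₂, Prod.smul_fst, Prod.smul_snd, smul_eq_mul]
      field_simp
      ring
  have hcont : Continuous (fun τ => Theta kg U τ P t) :=
    (Theta_cont ker_kg hc hb).comp (by fun_prop : Continuous fun τ : ℝ => (τ, P, t))
  have hcontF : Continuous (fun τ => Theta kg F τ P t) :=
    (Theta_cont ker_kg hcF hbF).comp (by fun_prop : Continuous fun τ : ℝ => (τ, P, t))
  have ftc := intervalIntegral.integral_eq_sub_of_hasDerivAt_of_le hT1.le hcont.continuousOn hg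
    (hcontF.neg.intervalIntegrable _ _)
  rw [intervalIntegral.integral_neg, intervalIntegral.integral_of_le hT1.le] at ftc
  have a1 : Theta kg U T1 P t = 0 := by
    unfold Theta; simp [h0]
  have a0 : Theta kg U 0 P t = NN * U (P, t) := by
    unfold Theta NN; simp [integral_mul_const]
  rw [a1, a0] at ftc
  linarith

def II (n : ℕ) (κ : ℝ × ℝ → ℝ) (G : (ℝ × ℝ) × ℝ → ℝ) (T1 : ℝ) (X : (ℝ × ℝ) × ℝ) : ℝ :=
  ∫ τ in Ioc 0 T1, ((√τ)⁻¹) ^ n * Theta κ G τ X.1 X.2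

theorem II_meas (n : ℕ) {κ : ℝ × ℝ → ℝ} (hκ : Ker κ) {G : (ℝ × ℝ) × ℝ → ℝ} (hG : Continuous G)
    {M : ℝ} (hM : ∀ X, |G X| ≤ M) (T1 : ℝ) (P : ℝ × ℝ) (t : ℝ) :
    AEStronglyMeasurable (fun τ => ((√τ)⁻¹) ^ n * Theta κ G τ P t) (volume.restrict (Ioc 0 T1)) := by
  have hcont : Continuous (fun τ => Theta κ G τ P t) :=
    (Theta_cont hκ hG hM).comp (by fun_prop : Continuous fun τ : ℝ => (τ, P, t))
  have h1 : Measurable (fun τ : ℝ => ((√τ)⁻¹) ^ n) := by fun_prop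
  exact (h1.mul hcont.measurable).aestronglyMeasurable

theorem II_cont (n : ℕ) {κ : ℝ × ℝ → ℝ} (hκ : Ker κ) {G : (ℝ × ℝ) × ℝ → ℝ} (hG : Continuous G)
    {M : ℝ} (hM : ∀ X, |G X| ≤ M) {T1 : ℝ} {b : ℝ → ℝ} (hb : IntegrableOn b (Ioc 0 T1))
    (hbd : ∀ τ ∈ Ioc 0 T1, ∀ P t, |((√τ)⁻¹) ^ n * Theta κ G τ P t| ≤ b τ) :
    Continuous (II n κ G T1) := by
  unfold II
  refine continuous_of_dominated (bound := b) (fun X => II_meas n hκ hG hM T1 X.1 X.2) ?_ hb ?_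
  · intro X
    exact (ae_restrict_iff' measurableSet_Ioc).2 (Eventually.of_forall fun τ hτ => hbd τ hτ _ _)
  · refine Eventually.of_forall fun τ => ?_
    have : Continuous (fun X : (ℝ × ℝ) × ℝ => Theta κ G τ X.1 X.2) :=
      (Theta_cont hκ hG hM).comp (by fun_prop : Continuous fun X : (ℝ × ℝ) × ℝ => (τ, X.1, X.2))
    fun_prop

theorem II_deriv (n : ℕ) {κ κ' : ℝ × ℝ → ℝ} {e : ℝ × ℝ} (he : ‖e‖ ≤ 1) (hκ : Ker κ) (hκ' : Ker κ')
    (hd : DKer κ κ' e) {G : (ℝ × ℝ) × ℝ → ℝ} (hG : Continuous G)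
    {M : ℝ} (hM : ∀ X, |G X| ≤ M) {T1 : ℝ} {a b : ℝ → ℝ}
    (ha : IntegrableOn a (Ioc 0 T1)) (hb : IntegrableOn b (Ioc 0 T1))
    (had : ∀ τ ∈ Ioc 0 T1, ∀ P t, |((√τ)⁻¹) ^ n * Theta κ G τ P t| ≤ a τ)
    (hbd : ∀ τ ∈ Ioc 0 T1, ∀ P t, |((√τ)⁻¹) ^ (n+1) * Theta κ' G τ P t| ≤ b τ)
    (P : ℝ × ℝ) (t h0 : ℝ) :
    HasDerivAt (fun h : ℝ => II n κ G T1 (P + h • e, t)) (- II (n+1) κ' G T1 (P + h0 • e, t)) h0 := by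
  unfold II
  rw [← integral_neg]
  refine (hasDerivAt_integral_of_dominated_loc_of_deriv_le (μ := volume.restrict (Ioc 0 T1))
    (F := fun (h : ℝ) τ => ((√τ)⁻¹) ^ n * Theta κ G τ (P + h • e) t)
    (F' := fun (h : ℝ) τ => -(((√τ)⁻¹) ^ (n+1) * Theta κ' G τ (P + h • e) t))
    (s := univ) (bound := b) univ_mem ?_ ?_ ?_ ?_ hb ?_).2
  · exact Eventually.of_forall fun h => II_meas n hκ hG hM T1 _ t
  · refine ha.mono' (II_meas n hκ hG hM T1 _ t) ?_
    exact (ae_restrict_iff' measurableSet_Ioc).2 (Eventually.of_forall fun τ hτ => had τ hτ _ _)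
  · exact (II_meas (n+1) hκ' hG hM T1 _ t).neg
  · refine (ae_restrict_iff' measurableSet_Ioc).2 (Eventually.of_forall fun τ hτ h _ => ?_)
    rw [norm_neg]; exact hbd τ hτ _ _
  · refine (ae_restrict_iff' measurableSet_Ioc).2 (Eventually.of_forall fun τ hτ h _ => ?_)
    refine ((Theta_deriv he hκ hκ' hd hG hM hτ.1 P t h).const_mul (((√τ)⁻¹) ^ n)).congr_deriv ?_
    ring

theorem int_rpow (T1 r : ℝ) (hr : -1 < r) (c : ℝ) : IntegrableOn (fun τ : ℝ => c * τ ^ r) (Ioc 0 T1) := by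
  rcases le_total T1 0 with h | h
  · rw [Ioc_eq_empty (by linarith)]; exact integrableOn_empty
  · exact ((intervalIntegrable_iff_integrableOn_Ioc_of_le h).1
      (intervalIntegral.intervalIntegrable_rpow' hr)).const_mul c

theorem sqinv_pow {τ : ℝ} (hτ : 0 < τ) (n : ℕ) : ((√τ)⁻¹) ^ n = τ ^ (-(n:ℝ)/2) := by
  rw [Real.sqrt_eq_rpow, ← Real.rpow_neg hτ.le, ← Real.rpow_natCast, ← Real.rpow_mul hτ.le]
  congr 1; ring

theorem II_bd (n : ℕ) {κ : ℝ × ℝ → ℝ} (hκ : Ker κ) {G : (ℝ × ℝ) × ℝ → ℝ}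
    {M : ℝ} (hM : ∀ X, |G X| ≤ M) {T1 : ℝ} :
    ∀ τ ∈ Ioc 0 T1, ∀ P t, |((√τ)⁻¹) ^ n * Theta κ G τ P t| ≤ ((∫ z, |κ z|) * M) * τ ^ (-(n:ℝ)/2) := by
  intro τ hτ P t
  rw [sqinv_pow hτ.1, abs_mul, abs_of_nonneg (Real.rpow_nonneg hτ.1.le _), mul_comm]
  exact mul_le_mul_of_nonneg_right (Theta_bound hκ hM τ P t) (Real.rpow_nonneg hτ.1.le _)

theorem Ker.int3 {κ : ℝ × ℝ → ℝ} (h : Ker κ) : Integrable (fun z => |κ z| * (1 + ‖z‖)) := by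
  obtain ⟨C, hC, hb⟩ := h.dec
  refine (one_add_norm_integrable3.const_mul C).mono' ?_ (Eventually.of_forall fun z => ?_)
  · have := h.cont
    exact Continuous.aestronglyMeasurable (by fun_prop)
  · have hz := norm_nonneg z
    rw [Real.norm_of_nonneg (by positivity)]
    calc |κ z| * (1 + ‖z‖) ≤ C * (1 + ‖z‖) ^ (-(4:ℝ)) * (1 + ‖z‖) :=
          mul_le_mul_of_nonneg_right (hb z) (by positivity)
      _ = C * ((1 + ‖z‖) ^ (-(4:ℝ)) * (1 + ‖z‖) ^ (1:ℝ)) := by rw [Real.rpow_one]; ring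
      _ = _ := by rw [← Real.rpow_add (by positivity)]; norm_num

def HolS (θ : ℝ) (G : (ℝ × ℝ) × ℝ → ℝ) (H : ℝ) : Prop :=
  ∀ P Q t, |G (P, t) - G (Q, t)| ≤ H * ‖P - Q‖ ^ θ

theorem II_bd_hol {κ : ℝ × ℝ → ℝ} (hκ : Ker κ) (h0 : ∫ z, κ z = 0) {G : (ℝ × ℝ) × ℝ → ℝ}
    (hG : Continuous G)
    {M : ℝ} (hM : ∀ X, |G X| ≤ M) {θ H : ℝ} (hθ : 0 < θ) (hθ1 : θ ≤ 1) (hH0 : 0 ≤ H) (hH : HolS θ G H) {T1 : ℝ} :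
    ∀ τ ∈ Ioc 0 T1, ∀ P t, |((√τ)⁻¹) ^ 2 * Theta κ G τ P t| ≤
      (H * ∫ z, |κ z| * (1 + ‖z‖)) * τ ^ (θ/2 - 1) := by
  intro τ hτ P t
  have hτ0 := hτ.1
  have h1 : Theta κ G τ P t = ∫ z, κ z * (G (P + √τ • z, t - τ) - G (P, t - τ)) := by
    have : ∫ z, κ z * G (P, t - τ) = 0 := by rw [integral_mul_const, h0, zero_mul]
    unfold Theta
    simp_rw [mul_sub]
    rw [integral_sub (Theta_integrable hκ hG hM τ P t) (hκ.integrable.mul_const _), this, sub_zero]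
  have h2 : |Theta κ G τ P t| ≤ (H * τ ^ (θ/2)) * ∫ z, |κ z| * (1 + ‖z‖) := by
    rw [h1, ← integral_const_mul, ← Real.norm_eq_abs]
    refine norm_integral_le_of_norm_le (hκ.int3.const_mul _) (Eventually.of_forall fun z => ?_)
    rw [norm_mul, Real.norm_eq_abs, Real.norm_eq_abs]
    have h3 := hH (P + √τ • z) P (t - τ)
    have h4 : ‖P + √τ • z - P‖ = √τ * ‖z‖ := by
      rw [add_sub_cancel_left, norm_smul, Real.norm_of_nonneg (Real.sqrt_nonneg _)]
    rw [h4, Real.mul_rpow (Real.sqrt_nonneg _) (norm_nonneg _), Real.sqrt_eq_rpow,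
      ← Real.rpow_mul hτ0.le] at h3
    have h5 : ‖z‖ ^ θ ≤ 1 + ‖z‖ := by
      have hz := norm_nonneg z
      calc ‖z‖ ^ θ ≤ (1 + ‖z‖) ^ θ := Real.rpow_le_rpow hz (by linarith) hθ.le
        _ ≤ (1 + ‖z‖) ^ (1:ℝ) := Real.rpow_le_rpow_of_exponent_le (by linarith) hθ1
        _ = _ := Real.rpow_one _
    have h6 : (1/2 * θ : ℝ) = θ/2 := by ring
    rw [h6] at h3
    have h7 : (0:ℝ) ≤ τ ^ (θ/2) := Real.rpow_nonneg hτ0.le _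
    calc |κ z| * |G (P + √τ • z, t - τ) - G (P, t - τ)|
        ≤ |κ z| * (H * (τ ^ (θ/2) * (1 + ‖z‖))) := by
          rw [Real.sqrt_eq_rpow]
          refine mul_le_mul_of_nonneg_left (h3.trans ?_) (abs_nonneg _)
          gcongr
      _ = _ := by ring
  rw [sqinv_pow hτ0, abs_mul, abs_of_nonneg (Real.rpow_nonneg hτ.1.le _)]
  calc τ ^ (-((2:ℕ):ℝ)/2) * |Theta κ G τ P t|
      ≤ τ ^ (-((2:ℕ):ℝ)/2) * ((H * τ ^ (θ/2)) * ∫ z, |κ z| * (1 + ‖z‖)) :=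
        mul_le_mul_of_nonneg_left h2 (Real.rpow_nonneg hτ.1.le _)
    _ = (H * ∫ z, |κ z| * (1 + ‖z‖)) * (τ ^ (-((2:ℕ):ℝ)/2) * τ ^ (θ/2)) := by ring
    _ = _ := by rw [← Real.rpow_add hτ0]; congr 2; push_cast; ring

theorem min_sqrt {D a b : ℝ} (hD : 0 ≤ D) (ha : D ≤ a) (hb : D ≤ b) : D ≤ √a * √b := by
  rw [← Real.sqrt_mul (hD.trans ha)]
  apply Real.le_sqrt_of_sq_le
  nlinarith

theorem II_hol_dir {κ κ' : ℝ × ℝ → ℝ} {f : ℝ × ℝ} (hf : ‖f‖ ≤ 1) (hκ : Ker κ) (hκ' : Ker κ')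
    (hd : DKer κ κ' f) {G : (ℝ × ℝ) × ℝ → ℝ} (hG : Continuous G)
    {M : ℝ} (hM : ∀ X, |G X| ≤ M) (T1 : ℝ) :
    ∃ C, 0 ≤ C ∧ ∀ P t h, |II 1 κ G T1 (P + h • f, t) - II 1 κ G T1 (P, t)| ≤ C * |h| ^ (1/2:ℝ) := by
  have hM0 : 0 ≤ M := (abs_nonneg _).trans (hM 0)
  set A := (∫ z, |κ z|) * M with hA
  set B := (∫ z, |κ' z|) * M with hB
  have hA0 : 0 ≤ A := mul_nonneg (integral_nonneg fun _ => abs_nonneg _) hM0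
  have hB0 : 0 ≤ B := mul_nonneg (integral_nonneg fun _ => abs_nonneg _) hM0
  refine ⟨(∫ τ in Ioc 0 T1, (√(2*A) * √B) * τ ^ (-(3/4):ℝ)), ?_, fun P t h => ?_⟩
  · refine setIntegral_nonneg measurableSet_Ioc fun τ hτ => ?_
    have := Real.rpow_nonneg hτ.1.le (-(3/4))
    positivity
  · have hint : ∀ Q, IntegrableOn (fun τ => ((√τ)⁻¹) ^ 1 * Theta κ G τ Q t) (Ioc 0 T1) := fun Q =>
      (int_rpow T1 (-((1:ℕ):ℝ)/2) (by norm_num) A).mono' (II_meas 1 hκ hG hM T1 Q t)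
        ((ae_restrict_iff' measurableSet_Ioc).2 (Eventually.of_forall fun τ hτ =>
          II_bd 1 hκ hM τ hτ Q t))
    unfold II
    rw [← integral_sub (hint _) (hint _), ← integral_mul_const, ← Real.norm_eq_abs]
    refine norm_integral_le_of_norm_le ((int_rpow T1 (-(3/4)) (by norm_num) _).mul_const _) ?_
    refine (ae_restrict_iff' measurableSet_Ioc).2 (Eventually.of_forall fun τ hτ => ?_)
    have hτ0 := hτ.1
    have hs := Real.sqrt_pos.2 hτ0
    rw [← mul_sub, norm_mul, Real.norm_eq_abs, Real.norm_eq_abs]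
    have b1 : |Theta κ G τ (P + h • f) t - Theta κ G τ P t| ≤ 2 * A := by
      have h1 := abs_le.1 (Theta_bound hκ hM τ (P + h • f) t)
      have h2 := abs_le.1 (Theta_bound hκ hM τ P t)
      rw [abs_le]; constructor <;> linarith
    have b2 : |Theta κ G τ (P + h • f) t - Theta κ G τ P t| ≤ (√τ)⁻¹ * B * |h| := by
      have := (convex_univ (𝕜 := ℝ) (E := ℝ)).norm_image_sub_le_of_norm_hasDerivWithin_le
        (f := fun h : ℝ => Theta κ G τ (P + h • f) t) (C := (√τ)⁻¹ * B) (x := 0) (y := h)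
        (fun x _ => (Theta_deriv hf hκ hκ' hd hG hM hτ0 P t x).hasDerivWithinAt)
        (fun x _ => by
          rw [norm_mul, norm_neg, Real.norm_of_nonneg (inv_nonneg.2 hs.le)]
          exact mul_le_mul_of_nonneg_left (Theta_bound hκ' hM τ _ t) (inv_nonneg.2 hs.le))
        (mem_univ _) (mem_univ _)
      simpa using this
    have b3 := min_sqrt (abs_nonneg _) b1 b2
    rw [sqinv_pow hτ0, abs_of_nonneg (Real.rpow_nonneg hτ0.le _)]
    refine (mul_le_mul_of_nonneg_left b3 (Real.rpow_nonneg hτ0.le _)).trans (le_of_eq ?_)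
    have e1 : (√τ)⁻¹ = τ ^ (-(1/2):ℝ) := by
      rw [Real.sqrt_eq_rpow, ← Real.rpow_neg hτ0.le]
    have e2 : √((√τ)⁻¹ * B * |h|) = τ ^ (-(1/4):ℝ) * √B * |h| ^ (1/2:ℝ) := by
      rw [Real.sqrt_mul (by positivity), Real.sqrt_mul (by positivity), ← Real.sqrt_eq_rpow, e1,
        Real.sqrt_eq_rpow (τ ^ _), ← Real.rpow_mul hτ0.le]
      norm_num
    rw [e2]
    have e3 : τ ^ (-(3/4):ℝ) = τ ^ (-((1:ℕ):ℝ)/2) * τ ^ (-(1/4):ℝ) := by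
      rw [← Real.rpow_add hτ0]; norm_num
    rw [e3]; ring

theorem II_hol (e : ℝ × ℝ) {G : (ℝ × ℝ) × ℝ → ℝ} (hG : Continuous G)
    {M : ℝ} (hM : ∀ X, |G X| ≤ M) (T1 : ℝ) :
    ∃ C, 0 ≤ C ∧ HolS (1/2) (II 1 (ke e) G T1) C := by
  have e1 : ‖((1:ℝ),(0:ℝ))‖ ≤ 1 := by simp [Prod.norm_def]
  have e2 : ‖((0:ℝ),(1:ℝ))‖ ≤ 1 := by simp [Prod.norm_def]
  obtain ⟨C1, hC1, h1⟩ := II_hol_dir e1 (ker_ke e) (ker_kee e _) (dker_ke e _) hG hM T1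
  obtain ⟨C2, hC2, h2⟩ := II_hol_dir e2 (ker_ke e) (ker_kee e _) (dker_ke e _) hG hM T1
  refine ⟨C1 + C2, by positivity, fun P Q t => ?_⟩
  have a1 := h1 Q t (P.1 - Q.1)
  have a2 := h2 (Q + (P.1 - Q.1) • ((1:ℝ),(0:ℝ))) t (P.2 - Q.2)
  have a3 : Q + (P.1 - Q.1) • ((1:ℝ),(0:ℝ)) + (P.2 - Q.2) • ((0:ℝ),(1:ℝ)) = P := by
    ext <;> simp
  rw [a3] at a2
  have n1 : |P.1 - Q.1| ≤ ‖P - Q‖ := norm_fst_le (P - Q)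
  have n2 : |P.2 - Q.2| ≤ ‖P - Q‖ := norm_snd_le (P - Q)
  have m1 := Real.rpow_le_rpow (abs_nonneg _) n1 (by norm_num : (0:ℝ) ≤ 1/2)
  have m2 := Real.rpow_le_rpow (abs_nonneg _) n2 (by norm_num : (0:ℝ) ≤ 1/2)
  have := abs_sub_le (II 1 (ke e) G T1 (P, t)) (II 1 (ke e) G T1 (Q + (P.1 - Q.1) • ((1:ℝ),(0:ℝ)), t))
    (II 1 (ke e) G T1 (Q, t))
  nlinarith [mul_le_mul_of_nonneg_left m1 hC1, mul_le_mul_of_nonneg_left m2 hC2]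

/-- First derivative of the volume potential. -/
theorem pot_d1 (e : ℝ × ℝ) (he : ‖e‖ ≤ 1) {G : (ℝ × ℝ) × ℝ → ℝ} (hG : Continuous G)
    {M : ℝ} (hM : ∀ X, |G X| ≤ M) (T1 : ℝ) (P : ℝ × ℝ) (t h0 : ℝ) :
    HasDerivAt (fun h : ℝ => II 0 kg G T1 (P + h • e, t)) (- II 1 (ke e) G T1 (P + h0 • e, t)) h0 :=
  II_deriv 0 he ker_kg (ker_ke e) (dker_kg e) hG hM
    (int_rpow T1 (-((0:ℕ):ℝ)/2) (by norm_num) _) (int_rpow T1 (-((1:ℕ):ℝ)/2) (by norm_num) _)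
    (II_bd 0 ker_kg hM) (II_bd 1 (ker_ke e) hM) P t h0

/-- Second derivative of the volume potential. -/
theorem pot_d2 (e : ℝ × ℝ) (he : ‖e‖ ≤ 1) {G : (ℝ × ℝ) × ℝ → ℝ} (hG : Continuous G)
    {M : ℝ} (hM : ∀ X, |G X| ≤ M) {θ H : ℝ} (hθ : 0 < θ) (hθ1 : θ ≤ 1) (hH0 : 0 ≤ H)
    (hH : HolS θ G H) (T1 : ℝ) (P : ℝ × ℝ) (t h0 : ℝ) :
    HasDerivAt (fun h : ℝ => II 1 (ke e) G T1 (P + h • e, t))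
      (- II 2 (kee e e) G T1 (P + h0 • e, t)) h0 :=
  II_deriv 1 he (ker_ke e) (ker_kee e e) (dker_ke e e) hG hM
    (int_rpow T1 (-((1:ℕ):ℝ)/2) (by norm_num) _) (int_rpow T1 (θ/2 - 1) (by linarith) _)
    (II_bd 1 (ker_ke e) hM) (II_bd_hol (ker_kee e e) (kee_int e e he) hG hM hθ hθ1 hH0 hH) P t h0

theorem pot_c2 (e : ℝ × ℝ) (he : ‖e‖ ≤ 1) {G : (ℝ × ℝ) × ℝ → ℝ} (hG : Continuous G)
    {M : ℝ} (hM : ∀ X, |G X| ≤ M) {θ H : ℝ} (hθ : 0 < θ) (hθ1 : θ ≤ 1) (hH0 : 0 ≤ H)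
    (hH : HolS θ G H) (T1 : ℝ) :
    Continuous (II 2 (kee e e) G T1) :=
  II_cont 2 (ker_kee e e) hG hM (int_rpow T1 (θ/2 - 1) (by linarith) _)
    (II_bd_hol (ker_kee e e) (kee_int e e he) hG hM hθ hθ1 hH0 hH)

abbrev E3 := (ℝ × ℝ) × ℝ
def ex : E3 := (((1:ℝ),(0:ℝ)), (0:ℝ))
def ey : E3 := (((0:ℝ),(1:ℝ)), (0:ℝ))
def et : E3 := (((0:ℝ),(0:ℝ)), (1:ℝ))

theorem line_move {U : E3 → ℝ} {U' : ℝ} {v X : E3} {c : ℝ}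
    (h : HasLineDerivAt ℝ U U' (X + c • v) v) : HasDerivAt (fun s : ℝ => U (X + s • v)) U' c := by
  have h1 : HasDerivAt (fun s : ℝ => U (X + c • v + s • v)) U' (c - c) := by
    rw [sub_self]; exact h
  have h2 := h1.comp_sub_const c c
  refine h2.congr_of_eventuallyEq (Eventually.of_forall fun s => ?_)
  show U _ = U _
  congr 1
  rw [add_assoc, ← add_smul]; congr 2; ring

theorem lineX {U : E3 → ℝ} {U' : ℝ} {x y t : ℝ} :
    HasLineDerivAt ℝ U U' ((x,y),t) ex ↔ HasDerivAt (fun s => U ((s,y),t)) U' x := by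
  have e : ∀ s : ℝ, (((0:ℝ),y),t) + s • ex = ((s,y),t) := fun s => by simp [ex]
  constructor
  · intro h
    rw [← e x] at h
    have := line_move h
    simpa only [e] using this
  · intro h
    have h1 : HasDerivAt (fun s => U ((s,y),t)) U' (x + 0) := by simpa using h
    have := h1.comp_const_add x 0
    refine this.congr_of_eventuallyEq (Eventually.of_forall fun s => ?_)
    simp [ex]

theorem lineY {U : E3 → ℝ} {U' : ℝ} {x y t : ℝ} :
    HasLineDerivAt ℝ U U' ((x,y),t) ey ↔ HasDerivAt (fun s => U ((x,s),t)) U' y := by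
  have e : ∀ s : ℝ, ((x,(0:ℝ)),t) + s • ey = ((x,s),t) := fun s => by simp [ey]
  constructor
  · intro h
    rw [← e y] at h
    have := line_move h
    simpa only [e] using this
  · intro h
    have h1 : HasDerivAt (fun s => U ((x,s),t)) U' (y + 0) := by simpa using h
    have := h1.comp_const_add y 0
    refine this.congr_of_eventuallyEq (Eventually.of_forall fun s => ?_)
    simp [ey]

theorem lineT {U : E3 → ℝ} {U' : ℝ} {x y t : ℝ} :
    HasLineDerivAt ℝ U U' ((x,y),t) et ↔ HasDerivAt (fun s => U ((x,y),s)) U' t := by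
  have e : ∀ s : ℝ, ((x,y),(0:ℝ)) + s • et = ((x,y),s) := fun s => by simp [et]
  constructor
  · intro h
    rw [← e t] at h
    have := line_move h
    simpa only [e] using this
  · intro h
    have h1 : HasDerivAt (fun s => U ((x,y),s)) U' (t + 0) := by simpa using h
    have := h1.comp_const_add t 0
    refine this.congr_of_eventuallyEq (Eventually.of_forall fun s => ?_)
    simp [et]

theorem fderiv3 {U Ux Uy Ut : E3 → ℝ} (hx : Continuous Ux) (hy : Continuous Uy) (ht : Continuous Ut)
    (dx : ∀ X, HasLineDerivAt ℝ U (Ux X) X ex) (dy : ∀ X, HasLineDerivAt ℝ U (Uy X) X ey)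
    (dtt : ∀ X, HasLineDerivAt ℝ U (Ut X) X et) (X : E3) :
    ∃ l : E3 →L[ℝ] ℝ, HasFDerivAt U l X ∧
      ∀ v, l v = Ux X * v.1.1 + Uy X * v.1.2 + Ut X * v.2 := by
  have step : ∀ (t : ℝ) (P : ℝ × ℝ), HasFDerivAt (fun P : ℝ × ℝ => U (P, t))
      ((ContinuousLinearMap.toSpanSingleton ℝ (Ux (P, t))).coprod
        (ContinuousLinearMap.toSpanSingleton ℝ (Uy (P, t)))) P := by
    intro t P
    have := hasStrictFDerivAt_uncurry_coprod (𝕜 := ℝ) (u := P) (f := fun x y => U ((x,y),t))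
      (f₁ := fun x y => ContinuousLinearMap.toSpanSingleton ℝ (Ux ((x,y),t)))
      (f₂ := fun x y => ContinuousLinearMap.toSpanSingleton ℝ (Uy ((x,y),t)))
      (Eventually.of_forall fun v => (lineX.1 (dx ((v.1,v.2),t))).hasFDerivAt)
      (Eventually.of_forall fun v => (lineY.1 (dy ((v.1,v.2),t))).hasFDerivAt)
      (Continuous.continuousAt ?_) (Continuous.continuousAt ?_)
    · exact this.hasFDerivAt
    · have : Continuous (fun v : ℝ × ℝ => ContinuousLinearMap.toSpanSingletonCLE (𝕜 := ℝ) (Ux ((v.1,v.2),t))) := by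
        fun_prop
      exact this
    · have : Continuous (fun v : ℝ × ℝ => ContinuousLinearMap.toSpanSingletonCLE (𝕜 := ℝ) (Uy ((v.1,v.2),t))) := by
        fun_prop
      exact this
  have := hasStrictFDerivAt_uncurry_coprod (𝕜 := ℝ) (u := X) (f := fun P t => U (P,t))
      (f₁ := fun P t => ((ContinuousLinearMap.toSpanSingleton ℝ (Ux (P, t))).coprod
        (ContinuousLinearMap.toSpanSingleton ℝ (Uy (P, t)))))
      (f₂ := fun P t => ContinuousLinearMap.toSpanSingleton ℝ (Ut (P,t)))
      (Eventually.of_forall fun v => step v.2 v.1)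
      (Eventually.of_forall fun v => (lineT.1 (dtt ((v.1.1,v.1.2),v.2))).hasFDerivAt)
      (Continuous.continuousAt ?_) (Continuous.continuousAt ?_)
  · refine ⟨_, this.hasFDerivAt, fun v => ?_⟩
    show (v.1.1 • Ux X + v.1.2 • Uy X) + v.2 • Ut X = _
    simp only [smul_eq_mul]; ring
  · have h1 : Continuous (fun v : E3 => ContinuousLinearMap.toSpanSingletonCLE (𝕜 := ℝ) (Ux v)) := by
      fun_prop
    have h2 : Continuous (fun v : E3 => ContinuousLinearMap.toSpanSingletonCLE (𝕜 := ℝ) (Uy v)) := by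
      fun_prop
    have h3 : Continuous (fun v : E3 => (ContinuousLinearMap.toSpanSingletonCLE (𝕜 := ℝ) (Ux v)).comp
        (ContinuousLinearMap.fst ℝ ℝ ℝ) + (ContinuousLinearMap.toSpanSingletonCLE (𝕜 := ℝ) (Uy v)).comp
        (ContinuousLinearMap.snd ℝ ℝ ℝ)) := by fun_prop
    refine h3.congr fun v => ?_
    ext <;> simp [Function.HasUncurry.uncurry]
  · have : Continuous (fun v : E3 => ContinuousLinearMap.toSpanSingletonCLE (𝕜 := ℝ) (Ut (v.1,v.2))) := by
        fun_prop
    exact this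

/-- Representation of `U_x`. -/
theorem rep {U Ux Uy Ut Uxx Uyy F G : E3 → ℝ}
    (hc : Continuous U) (hcx : Continuous Ux) (hcy : Continuous Uy) (hct : Continuous Ut)
    (hcxx : Continuous Uxx) (hcyy : Continuous Uyy) {M : ℝ}
    (hb : ∀ X, |U X| ≤ M) (hbx : ∀ X, |Ux X| ≤ M) (hby : ∀ X, |Uy X| ≤ M) (hbt : ∀ X, |Ut X| ≤ M)
    (hbxx : ∀ X, |Uxx X| ≤ M) (hbyy : ∀ X, |Uyy X| ≤ M)
    (dx : ∀ X, HasLineDerivAt ℝ U (Ux X) X ex) (dy : ∀ X, HasLineDerivAt ℝ U (Uy X) X ey)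
    (dtt : ∀ X, HasLineDerivAt ℝ U (Ut X) X et)
    (hdx : ∀ X, HasLineDerivAt ℝ Ux (Uxx X) X ex)
    (hdy : ∀ X, HasLineDerivAt ℝ Uy (Uyy X) X ey)
    (hF : ∀ X, F X = Ut X - Uxx X - Uyy X) (hcF : Continuous F) (hcG : Continuous G)
    (hbF : ∀ X, |F X| ≤ M) (hbG : ∀ X, |G X| ≤ M) (hFG : ∀ X, HasLineDerivAt ℝ F (G X) X ex)
    {T1 : ℝ} (hT1 : 0 < T1) (P : ℝ × ℝ) (t : ℝ) (h0 : ∀ Q, U (Q, t - T1) = 0) :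
    NN * Ux (P, t) = II 0 kg G T1 (P, t) := by
  have hF' : F = fun X => Ut X - Uxx X - Uyy X := funext hF
  have h1 : ∀ Q, NN * U (Q, t) = ∫ τ in Ioc 0 T1, Theta kg F τ Q t := fun Q => by
    rw [hF']
    exact duhamel hc hcx hcy hct hcxx hcyy hb hbx hby hbt hbxx hbyy
      (fderiv3 hcx hcy hct dx dy dtt) hdx hdy hT1 Q t h0
  have d1 : HasDerivAt (fun h : ℝ => NN * U (P + h • ((1:ℝ),(0:ℝ)), t)) (NN * Ux (P, t)) 0 := by
    have := (dx (P, t))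
    have h2 : HasDerivAt (fun h : ℝ => U (P + h • ((1:ℝ),(0:ℝ)), t)) (Ux (P, t)) 0 := by
      refine HasDerivAt.congr_of_eventuallyEq this (Eventually.of_forall fun s => ?_)
      simp [ex]
    exact h2.const_mul _
  have d2 : HasDerivAt (fun h : ℝ => ∫ τ in Ioc 0 T1, Theta kg F τ (P + h • ((1:ℝ),(0:ℝ))) t)
      (∫ τ in Ioc 0 T1, Theta kg G τ (P + (0:ℝ) • ((1:ℝ),(0:ℝ))) t) 0 := by
    have ms : ∀ {H : E3 → ℝ}, Continuous H → (∀ X, |H X| ≤ M) → ∀ Q,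
      AEStronglyMeasurable (fun τ => Theta kg H τ Q t) (volume.restrict (Ioc 0 T1)) := by
      intro H h1 h2 Q
      simpa using II_meas 0 ker_kg h1 h2 T1 Q t
    have ci : Integrable (fun _ : ℝ => (∫ z, |kg z|) * M) (volume.restrict (Ioc 0 T1)) := by
      exact integrableOn_const (by simp)
    refine (hasDerivAt_integral_of_dominated_loc_of_deriv_le (μ := volume.restrict (Ioc 0 T1))
      (F := fun (h : ℝ) τ => Theta kg F τ (P + h • ((1:ℝ),(0:ℝ))) t)
      (F' := fun (h : ℝ) τ => Theta kg G τ (P + h • ((1:ℝ),(0:ℝ))) t)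
      (s := univ) (bound := fun _ => (∫ z, |kg z|) * M) univ_mem ?_ ?_ ?_ ?_ ci ?_).2
    · exact Eventually.of_forall fun h => ms hcF hbF _
    · exact ci.mono' (ms hcF hbF _) (Eventually.of_forall fun τ => Theta_bound ker_kg hbF τ _ t)
    · exact ms hcG hbG _
    · exact Eventually.of_forall fun τ h _ => Theta_bound ker_kg hbG τ _ t
    · exact Eventually.of_forall fun τ h _ => Theta_deriv' ker_kg hcF hcG hbF hbG hFG τ P t h
  have := d1.unique (d2.congr_of_eventuallyEq (Eventually.of_forall fun h => h1 _))
  rw [this]; unfold II; simp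

structure Cut (Ω : Set E3) (α : E3 → ℝ) : Prop where
  smooth : ContDiff ℝ (⊤ : ℕ∞) α
  cs : HasCompactSupport α
  sub : tsupport α ⊆ Ω

def DD (v : E3) (α : E3 → ℝ) : E3 → ℝ := fun X => fderiv ℝ α X v

theorem DD_supp (v : E3) (α : E3 → ℝ) : Function.support (DD v α) ⊆ tsupport α := by
  intro X hX
  apply support_fderiv_subset (𝕜 := ℝ)
  intro h
  apply hX
  simp [DD, h]

theorem Cut.dd {Ω : Set E3} {α : E3 → ℝ} (h : Cut Ω α) (v : E3) : Cut Ω (DD v α) := by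
  refine ⟨?_, h.cs.mono' (DD_supp v α), ?_⟩
  · have h1 : ContDiff ℝ (⊤ : ℕ∞) (fderiv ℝ α) := h.smooth.fderiv_right (by simp)
    exact h1.clm_apply contDiff_const
  · exact (closure_minimal (DD_supp v α) (isClosed_tsupport _)).trans h.sub

theorem Cut.add {Ω : Set E3} {α α' : E3 → ℝ} (h : Cut Ω α) (h' : Cut Ω α') :
    Cut Ω (fun X => α X + α' X) := by
  refine ⟨h.smooth.add h'.smooth, h.cs.add h'.cs, ?_⟩
  exact (tsupport_add α α').trans (union_subset h.sub h'.sub)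

theorem Cut.cmul {Ω : Set E3} {α : E3 → ℝ} (h : Cut Ω α) (c : ℝ) :
    Cut Ω (fun X => c * α X) := by
  refine ⟨contDiff_const.mul h.smooth, h.cs.mul_left (f := fun _ => c), ?_⟩
  exact (tsupport_mul_subset_right (f := fun _ => c) (g := α)).trans h.sub

theorem Cut.cont {Ω : Set E3} (hΩ : IsOpen Ω) {α φ : E3 → ℝ} (h : Cut Ω α) (hφ : ContinuousOn φ Ω) :
    Continuous (fun X => α X * φ X) := by
  refine continuous_of_tsupport fun X hX => ?_
  have hX' : X ∈ Ω := h.sub (tsupport_mul_subset_left hX)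
  exact (h.smooth.continuous.continuousAt).mul (hφ.continuousAt (hΩ.mem_nhds hX'))

theorem Cut.bdd {Ω : Set E3} (hΩ : IsOpen Ω) {α φ : E3 → ℝ} (h : Cut Ω α) (hφ : ContinuousOn φ Ω) :
    ∃ M, ∀ X, |α X * φ X| ≤ M :=
  (h.cs.mul_right (f' := φ)).exists_bound_of_continuous (h.cont hΩ hφ)

theorem Cut.line {Ω : Set E3} {α φ φ' : E3 → ℝ} (h : Cut Ω α) {v : E3}
    (hφ : ∀ X ∈ Ω, HasLineDerivAt ℝ φ (φ' X) X v) (X : E3) :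
    HasLineDerivAt ℝ (fun X => α X * φ X) (DD v α X * φ X + α X * φ' X) X v := by
  by_cases hX : X ∈ tsupport α
  · have h1 : HasLineDerivAt ℝ α (DD v α X) X v :=
      ((h.smooth.differentiable (by simp)) X).hasFDerivAt.hasLineDerivAt v
    have h2 := HasDerivAt.mul h1 (hφ X (h.sub hX))
    refine HasDerivAt.congr_deriv h2 ?_
    simp
  · have h0 : α =ᶠ[nhds X] 0 := notMem_tsupport_iff_eventuallyEq.1 hX
    have h1 : DD v α X = 0 := by
      by_contra hne
      exact hX (DD_supp v α hne)
    have h2 : α X = 0 := h0.self_of_nhds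
    rw [h1, h2]; simp only [zero_mul, add_zero]
    have hz : HasLineDerivAt ℝ (fun _ : E3 => (0:ℝ)) 0 X v := hasDerivAt_const _ _
    refine hz.congr_of_eventuallyEq ?_
    filter_upwards [h0] with Y hY
    simp [hY]

theorem Cut.line2 {Ω : Set E3} {α φ φ' : E3 → ℝ} {v : E3} (h : Cut Ω α)
    (hφ : ∀ X ∈ Ω, HasLineDerivAt ℝ φ (φ' X) X v) {X : E3} {c : ℝ}
    (hc : c = DD v α X * φ X + α X * φ' X) :
    HasLineDerivAt ℝ (fun X => α X * φ X) c X v := hc ▸ h.line hφ X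

/-- Solution data on an open set. -/
structure Dat (Ω : Set E3) (w wx wy wt wxx wxy wyy f g : E3 → ℝ) : Prop where
  op : IsOpen Ω
  cw : ContinuousOn w Ω
  cx : ContinuousOn wx Ω
  cy : ContinuousOn wy Ω
  ct : ContinuousOn wt Ω
  cxx : ContinuousOn wxx Ω
  cxy : ContinuousOn wxy Ω
  cyy : ContinuousOn wyy Ω
  cf : ContinuousOn f Ω
  cg : ContinuousOn g Ω
  dx : ∀ X ∈ Ω, HasLineDerivAt ℝ w (wx X) X ex
  dy : ∀ X ∈ Ω, HasLineDerivAt ℝ w (wy X) X ey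
  dtt : ∀ X ∈ Ω, HasLineDerivAt ℝ w (wt X) X et
  dxx : ∀ X ∈ Ω, HasLineDerivAt ℝ wx (wxx X) X ex
  dxy : ∀ X ∈ Ω, HasLineDerivAt ℝ wx (wxy X) X ey
  dyx : ∀ X ∈ Ω, HasLineDerivAt ℝ wy (wxy X) X ex
  dyy : ∀ X ∈ Ω, HasLineDerivAt ℝ wy (wyy X) X ey
  dfx : ∀ X ∈ Ω, HasLineDerivAt ℝ f (g X) X ex
  pde : ∀ X ∈ Ω, wt X - wxx X - wyy X = f X

def al (χ : E3 → ℝ) : E3 → ℝ := fun X => (DD et χ X + (-1) * DD ex (DD ex χ) X) + (-1) * DD ey (DD ey χ) X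

def Gc (χ w wx wy wxx wxy f g : E3 → ℝ) : E3 → ℝ := fun X =>
  ((DD ex (al χ) X * w X + al χ X * wx X)
    + (DD ex (fun X => (-2) * DD ex χ X) X * wx X + (-2) * DD ex χ X * wxx X))
    + ((DD ex (fun X => (-2) * DD ey χ X) X * wy X + (-2) * DD ey χ X * wxy X)
    + (DD ex χ X * f X + χ X * g X))

theorem Cut.al {Ω : Set E3} {χ : E3 → ℝ} (h : Cut Ω χ) : Cut Ω (al χ) :=
  ((h.dd et).add (((h.dd ex).dd ex).cmul (-1))).add (((h.dd ey).dd ey).cmul (-1))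

theorem bdd_add {a b : E3 → ℝ} (ha : ∃ M, ∀ X, |a X| ≤ M) (hb : ∃ M, ∀ X, |b X| ≤ M) :
    ∃ M, ∀ X, |a X + b X| ≤ M := by
  obtain ⟨M, hM⟩ := ha
  obtain ⟨N, hN⟩ := hb
  exact ⟨M + N, fun X => (abs_add_le _ _).trans (add_le_add (hM X) (hN X))⟩

theorem line_add {a b : E3 → ℝ} {a' b' : ℝ} {X v : E3} (ha : HasLineDerivAt ℝ a a' X v)
    (hb : HasLineDerivAt ℝ b b' X v) : HasLineDerivAt ℝ (fun X => a X + b X) (a' + b') X v :=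
  HasDerivAt.add ha hb

theorem Gc_cont {Ω : Set E3} {w wx wy wt wxx wxy wyy f g χ : E3 → ℝ}
    (D : Dat Ω w wx wy wt wxx wxy wyy f g) (h : Cut Ω χ) :
    Continuous (Gc χ w wx wy wxx wxy f g) := by
  unfold Gc
  have := ((h.al.dd ex).cont D.op D.cw)
  have := (h.al.cont D.op D.cx)
  have := ((((h.dd ex).cmul (-2)).dd ex).cont D.op D.cx)
  have := (((h.dd ex).cmul (-2)).cont D.op D.cxx)
  have := ((((h.dd ey).cmul (-2)).dd ex).cont D.op D.cy)
  have := (((h.dd ey).cmul (-2)).cont D.op D.cxy)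
  have := ((h.dd ex).cont D.op D.cf)
  have := (h.cont D.op D.cg)
  fun_prop

theorem Gc_bdd {Ω : Set E3} {w wx wy wt wxx wxy wyy f g χ : E3 → ℝ}
    (D : Dat Ω w wx wy wt wxx wxy wyy f g) (h : Cut Ω χ) :
    ∃ M, ∀ X, |Gc χ w wx wy wxx wxy f g X| ≤ M := by
  unfold Gc
  exact bdd_add (bdd_add (bdd_add ((h.al.dd ex).bdd D.op D.cw) (h.al.bdd D.op D.cx))
    (bdd_add ((((h.dd ex).cmul (-2)).dd ex).bdd D.op D.cx) (((h.dd ex).cmul (-2)).bdd D.op D.cxx)))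
    (bdd_add (bdd_add ((((h.dd ey).cmul (-2)).dd ex).bdd D.op D.cy) (((h.dd ey).cmul (-2)).bdd D.op D.cxy))
      (bdd_add ((h.dd ex).bdd D.op D.cf) (h.bdd D.op D.cg)))

theorem bdd_all {ι : Type} [Finite ι] {a : ι → E3 → ℝ} (h : ∀ i, ∃ M, ∀ X, |a i X| ≤ M) :
    ∃ M, ∀ i X, |a i X| ≤ M := by
  choose M hM using h
  obtain ⟨N, hN⟩ := (Set.finite_range M).bddAbove
  exact ⟨N, fun i X => (hM i X).trans (hN ⟨i, rfl⟩)⟩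

theorem rep_cut {Ω : Set E3} {w wx wy wt wxx wxy wyy f g χ : E3 → ℝ}
    (D : Dat Ω w wx wy wt wxx wxy wyy f g) (h : Cut Ω χ) {T1 : ℝ} (hT1 : 0 < T1)
    (P : ℝ × ℝ) (t : ℝ) (h0 : ∀ Q, χ (Q, t - T1) = 0) :
    NN * (DD ex χ (P, t) * w (P, t) + χ (P, t) * wx (P, t)) =
      II 0 kg (Gc χ w wx wy wxx wxy f g) T1 (P, t) := by
  set U : E3 → ℝ := fun X => χ X * w X with hU
  set Ux : E3 → ℝ := fun X => DD ex χ X * w X + χ X * wx X with hUx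
  set Uy : E3 → ℝ := fun X => DD ey χ X * w X + χ X * wy X with hUy
  set Ut : E3 → ℝ := fun X => DD et χ X * w X + χ X * wt X with hUt
  set Uxx : E3 → ℝ := fun X => (DD ex (DD ex χ) X * w X + DD ex χ X * wx X) +
    (DD ex χ X * wx X + χ X * wxx X) with hUxx
  set Uyy : E3 → ℝ := fun X => (DD ey (DD ey χ) X * w X + DD ey χ X * wy X) +
    (DD ey χ X * wy X + χ X * wyy X) with hUyy
  set F : E3 → ℝ := fun X => (al χ X * w X + (-2) * DD ex χ X * wx X) +
    ((-2) * DD ey χ X * wy X + χ X * f X) with hF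
  have o := D.op
  have c1 : Continuous U := h.cont o D.cw
  have c2 : Continuous Ux := ((h.dd ex).cont o D.cw).add (h.cont o D.cx)
  have c3 : Continuous Uy := ((h.dd ey).cont o D.cw).add (h.cont o D.cy)
  have c4 : Continuous Ut := ((h.dd et).cont o D.cw).add (h.cont o D.ct)
  have c5 : Continuous Uxx := ((((h.dd ex).dd ex).cont o D.cw).add ((h.dd ex).cont o D.cx)).add
    (((h.dd ex).cont o D.cx).add (h.cont o D.cxx))
  have c6 : Continuous Uyy := ((((h.dd ey).dd ey).cont o D.cw).add ((h.dd ey).cont o D.cy)).add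
    (((h.dd ey).cont o D.cy).add (h.cont o D.cyy))
  have c7 : Continuous F := ((h.al.cont o D.cw).add (((h.dd ex).cmul (-2)).cont o D.cx)).add
    ((((h.dd ey).cmul (-2)).cont o D.cy).add (h.cont o D.cf))
  have b1 : ∃ M, ∀ X, |U X| ≤ M := h.bdd o D.cw
  have b2 : ∃ M, ∀ X, |Ux X| ≤ M := bdd_add ((h.dd ex).bdd o D.cw) (h.bdd o D.cx)
  have b3 : ∃ M, ∀ X, |Uy X| ≤ M := bdd_add ((h.dd ey).bdd o D.cw) (h.bdd o D.cy)
  have b4 : ∃ M, ∀ X, |Ut X| ≤ M := bdd_add ((h.dd et).bdd o D.cw) (h.bdd o D.ct)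
  have b5 : ∃ M, ∀ X, |Uxx X| ≤ M := bdd_add (bdd_add (((h.dd ex).dd ex).bdd o D.cw)
    ((h.dd ex).bdd o D.cx)) (bdd_add ((h.dd ex).bdd o D.cx) (h.bdd o D.cxx))
  have b6 : ∃ M, ∀ X, |Uyy X| ≤ M := bdd_add (bdd_add (((h.dd ey).dd ey).bdd o D.cw)
    ((h.dd ey).bdd o D.cy)) (bdd_add ((h.dd ey).bdd o D.cy) (h.bdd o D.cyy))
  have b7 : ∃ M, ∀ X, |F X| ≤ M := bdd_add (bdd_add (h.al.bdd o D.cw)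
    (((h.dd ex).cmul (-2)).bdd o D.cx)) (bdd_add (((h.dd ey).cmul (-2)).bdd o D.cy) (h.bdd o D.cf))
  have b8 := Gc_bdd D h
  obtain ⟨M, hM⟩ := bdd_all (a := ![U, Ux, Uy, Ut, Uxx, Uyy, F, Gc χ w wx wy wxx wxy f g])
    (fun i => by fin_cases i <;> assumption)
  refine rep (U := U) (Ux := Ux) (Uy := Uy) (Ut := Ut) (Uxx := Uxx) (Uyy := Uyy) (F := F) c1 c2 c3 c4 c5 c6
    (M := M) (hM 0) (hM 1) (hM 2) (hM 3) (hM 4) (hM 5) (h.line D.dx) (h.line D.dy) (h.line D.dtt)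
    (fun X => line_add ((h.dd ex).line D.dx X) (h.line D.dxx X))
    (fun X => line_add ((h.dd ey).line D.dy X) (h.line D.dyy X)) ?_ c7 (Gc_cont D h)
    (hM 6) (hM 7) ?_ hT1 P t ?_
  · intro X
    by_cases hX : X ∈ Ω
    · simp only [hF, hUt, hUxx, hUyy, _root_.al, ← D.pde X hX]; ring
    · have hz : ∀ {α : E3 → ℝ}, Cut Ω α → α X = 0 := fun {α} hα => by
        by_contra hne
        exact hX (hα.sub (subset_tsupport _ hne))
      simp only [hF, hUt, hUxx, hUyy, hz h, hz h.al, hz (h.dd ex), hz (h.dd ey), hz (h.dd et),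
        hz ((h.dd ex).dd ex), hz ((h.dd ey).dd ey)]
      ring
  · intro X
    exact line_add (line_add (h.al.line D.dx X) (((h.dd ex).cmul (-2)).line D.dxx X))
      (line_add (((h.dd ey).cmul (-2)).line D.dyx X) (h.line D.dfx X))
  · intro Q
    simp [hU, h0]

def HolOn (θ : ℝ) (K : Set E3) (φ : E3 → ℝ) : Prop :=
  ∃ H, 0 ≤ H ∧ ∀ P Q t, (P, t) ∈ K → (Q, t) ∈ K → |φ (P, t) - φ (Q, t)| ≤ H * ‖P - Q‖ ^ θ

theorem HolOn.mono {θ : ℝ} {K K' : Set E3} {φ : E3 → ℝ} (h : HolOn θ K φ) (hK : K' ⊆ K) : HolOn θ K' φ := by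
  obtain ⟨H, h0, h1⟩ := h
  exact ⟨H, h0, fun P Q t hP hQ => h1 P Q t (hK hP) (hK hQ)⟩

theorem ball_dist {X0 : E3} {r : ℝ} {P Q : ℝ × ℝ} {t : ℝ} (hP : (P, t) ∈ Metric.closedBall X0 r)
    (hQ : (Q, t) ∈ Metric.closedBall X0 r) : ‖P - Q‖ ≤ 2 * r := by
  have h1 : dist (P, t) (Q, t) ≤ 2 * r := by
    have := dist_triangle_right (P, t) (Q, t) X0
    have a := Metric.mem_closedBall.1 hP
    have b := Metric.mem_closedBall.1 hQ
    linarith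
  rw [Prod.dist_eq] at h1
  rw [← dist_eq_norm]
  exact (le_max_left _ _).trans h1

theorem HolOn.weaken {θ θ' : ℝ} (hθ : 0 < θ) (hθ' : θ ≤ θ') {X0 : E3} {r : ℝ} (hr : r ≤ 1/2) {φ : E3 → ℝ}
    (h : HolOn θ' (Metric.closedBall X0 r) φ) : HolOn θ (Metric.closedBall X0 r) φ := by
  obtain ⟨H, h0, h1⟩ := h
  refine ⟨H, h0, fun P Q t hP hQ => (h1 P Q t hP hQ).trans (mul_le_mul_of_nonneg_left ?_ h0)⟩
  have := ball_dist hP hQ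
  exact Real.rpow_le_rpow_of_exponent_ge' (norm_nonneg _) (by linarith) hθ.le hθ'

theorem HolOn.add {θ : ℝ} {K : Set E3} {φ ψ : E3 → ℝ} (h : HolOn θ K φ) (h' : HolOn θ K ψ) :
    HolOn θ K (fun X => φ X + ψ X) := by
  obtain ⟨H, h0, h1⟩ := h
  obtain ⟨H', h0', h1'⟩ := h'
  refine ⟨H + H', by positivity, fun P Q t hP hQ => ?_⟩
  have := abs_add_le (φ (P, t) - φ (Q, t)) (ψ (P, t) - ψ (Q, t))
  have e : φ (P, t) + ψ (P, t) - (φ (Q, t) + ψ (Q, t)) = (φ (P, t) - φ (Q, t)) + (ψ (P, t) - ψ (Q, t)) := by ring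
  rw [e, add_mul]
  linarith [h1 P Q t hP hQ, h1' P Q t hP hQ]

theorem HolOn.cmul {θ : ℝ} {K : Set E3} {φ : E3 → ℝ} (h : HolOn θ K φ) (c : ℝ) :
    HolOn θ K (fun X => c * φ X) := by
  obtain ⟨H, h0, h1⟩ := h
  refine ⟨|c| * H, by positivity, fun P Q t hP hQ => ?_⟩
  rw [← mul_sub, abs_mul, mul_assoc]
  exact mul_le_mul_of_nonneg_left (h1 P Q t hP hQ) (abs_nonneg _)

theorem HolOn.mul {θ : ℝ} {K : Set E3} (hK : IsCompact K) {φ ψ : E3 → ℝ} (h : HolOn θ K φ) (h' : HolOn θ K ψ)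
    (c : ContinuousOn φ K) (c' : ContinuousOn ψ K) :
    HolOn θ K (fun X => φ X * ψ X) := by
  obtain ⟨H, h0, h1⟩ := h
  obtain ⟨H', h0', h1'⟩ := h'
  obtain ⟨M, hM⟩ := hK.exists_bound_of_continuousOn c
  obtain ⟨N, hN⟩ := hK.exists_bound_of_continuousOn c'
  refine ⟨|M| * H' + |N| * H, by positivity, fun P Q t hP hQ => ?_⟩
  have e : φ (P, t) * ψ (P, t) - φ (Q, t) * ψ (Q, t) = φ (P, t) * (ψ (P, t) - ψ (Q, t)) +
    ψ (Q, t) * (φ (P, t) - φ (Q, t)) := by ring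
  rw [e]
  have a1 : |φ (P, t) * (ψ (P, t) - ψ (Q, t))| ≤ |M| * (H' * ‖P - Q‖ ^ θ) := by
    rw [abs_mul]
    exact mul_le_mul ((hM _ hP).trans (le_abs_self _)) (h1' P Q t hP hQ) (abs_nonneg _) (abs_nonneg _)
  have a2 : |ψ (Q, t) * (φ (P, t) - φ (Q, t))| ≤ |N| * (H * ‖P - Q‖ ^ θ) := by
    rw [abs_mul]
    exact mul_le_mul ((hN _ hQ).trans (le_abs_self _)) (h1 P Q t hP hQ) (abs_nonneg _) (abs_nonneg _)
  have := abs_add_le (φ (P, t) * (ψ (P, t) - ψ (Q, t))) (ψ (Q, t) * (φ (P, t) - φ (Q, t)))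
  nlinarith

theorem HolOn.lip {X0 : E3} {r : ℝ} {φ φx φy : E3 → ℝ}
    (cx : ContinuousOn φx (Metric.closedBall X0 r)) (cy : ContinuousOn φy (Metric.closedBall X0 r))
    (dx : ∀ X ∈ Metric.closedBall X0 r, HasLineDerivAt ℝ φ (φx X) X ex)
    (dy : ∀ X ∈ Metric.closedBall X0 r, HasLineDerivAt ℝ φ (φy X) X ey) :
    HolOn 1 (Metric.closedBall X0 r) φ := by
  have hK : IsCompact (Metric.closedBall X0 r) := isCompact_closedBall X0 r
  obtain ⟨M, hM⟩ := hK.exists_bound_of_continuousOn cx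
  obtain ⟨N, hN⟩ := hK.exists_bound_of_continuousOn cy
  refine ⟨|M| + |N|, by positivity, fun P Q t hP hQ => ?_⟩
  have mem : ∀ a b s : ℝ, ((a, b), s) ∈ Metric.closedBall X0 r ↔
      (|a - X0.1.1| ≤ r ∧ |b - X0.1.2| ≤ r) ∧ |s - X0.2| ≤ r := by
    intro a b s
    rw [Metric.mem_closedBall, Prod.dist_eq, Prod.dist_eq, max_le_iff, max_le_iff]
    simp [Real.dist_eq]
  obtain ⟨⟨p1, p2⟩, p3⟩ := (mem P.1 P.2 t).1 hP
  obtain ⟨⟨q1, q2⟩, q3⟩ := (mem Q.1 Q.2 t).1 hQ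
  have cvx : ∀ c : ℝ, Convex ℝ {a : ℝ | |a - c| ≤ r} := fun c => by
    have : {a : ℝ | |a - c| ≤ r} = Icc (c - r) (c + r) := by
      ext a; simp only [mem_setOf_eq, mem_Icc, abs_le]; constructor <;> rintro ⟨h1, h2⟩ <;> constructor <;> linarith
    rw [this]; exact convex_Icc _ _
  have a1 := (cvx X0.1.1).norm_image_sub_le_of_norm_hasDerivWithin_le
    (f := fun a => φ ((a, P.2), t)) (f' := fun a => φx ((a, P.2), t)) (C := |M|) (x := Q.1) (y := P.1)
    (fun a ha => (lineX.1 (dx _ ((mem a P.2 t).2 ⟨⟨ha, p2⟩, p3⟩))).hasDerivWithinAt)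
    (fun a ha => (hM _ ((mem a P.2 t).2 ⟨⟨ha, p2⟩, p3⟩)).trans (le_abs_self _)) q1 p1
  have a2 := (cvx X0.1.2).norm_image_sub_le_of_norm_hasDerivWithin_le
    (f := fun a => φ ((Q.1, a), t)) (f' := fun a => φy ((Q.1, a), t)) (C := |N|) (x := Q.2) (y := P.2)
    (fun a ha => (lineY.1 (dy _ ((mem Q.1 a t).2 ⟨⟨q1, ha⟩, p3⟩))).hasDerivWithinAt)
    (fun a ha => (hN _ ((mem Q.1 a t).2 ⟨⟨q1, ha⟩, p3⟩)).trans (le_abs_self _)) q2 p2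
  have n1 : ‖P.1 - Q.1‖ ≤ ‖P - Q‖ := norm_fst_le (P - Q)
  have n2 : ‖P.2 - Q.2‖ ≤ ‖P - Q‖ := norm_snd_le (P - Q)
  have tri := abs_sub_le (φ (P, t)) (φ ((Q.1, P.2), t)) (φ (Q, t))
  rw [Real.rpow_one]
  have b1 := mul_le_mul_of_nonneg_left n1 (abs_nonneg M)
  have b2 := mul_le_mul_of_nonneg_left n2 (abs_nonneg N)
  simp only [Real.norm_eq_abs] at a1 a2
  have a1' : |φ (P, t) - φ ((Q.1, P.2), t)| ≤ |M| * |P.1 - Q.1| := a1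
  have a2' : |φ ((Q.1, P.2), t) - φ (Q, t)| ≤ |N| * |P.2 - Q.2| := a2
  simp only [Real.norm_eq_abs] at b1 b2
  linarith

theorem Cut.hol {θ : ℝ} (hθ : 0 < θ) (hθ1 : θ ≤ 1) {Ω K : Set E3} (hK : IsCompact K) {α φ : E3 → ℝ}
    (h : Cut Ω α) (hΩ : Ω ⊆ K) (c : ContinuousOn φ K) (hφ : HolOn θ K φ) :
    ∃ H, 0 ≤ H ∧ HolS θ (fun X => α X * φ X) H := by
  obtain ⟨H, h0, h1⟩ := hφ
  obtain ⟨N, hN⟩ := hK.exists_bound_of_continuousOn c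
  obtain ⟨B, hB⟩ := h.cs.exists_bound_of_continuous h.smooth.continuous
  obtain ⟨C, hC⟩ := ContDiff.lipschitzWith_of_hasCompactSupport (𝕂 := ℝ) h.cs h.smooth (by simp)
  have hB0 : 0 ≤ B := (norm_nonneg _).trans (hB 0)
  have aH : ∀ P Q t, |α (P, t) - α (Q, t)| ≤ (2 * B + C) * ‖P - Q‖ ^ θ := by
    intro P Q t
    have hC0 : (0:ℝ) ≤ C := C.2
    rcases le_total ‖P - Q‖ 1 with hd | hd
    · have l1 : |α (P, t) - α (Q, t)| ≤ C * ‖P - Q‖ := by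
        have := hC.dist_le_mul (P, t) (Q, t)
        rw [Real.dist_eq] at this
        simpa [Prod.dist_eq, dist_eq_norm] using this
      have l2 : ‖P - Q‖ ≤ ‖P - Q‖ ^ θ := by
        have := Real.rpow_le_rpow_of_exponent_ge' (norm_nonneg (P - Q)) hd hθ.le hθ1
        rwa [Real.rpow_one] at this
      have l3 := Real.rpow_nonneg (norm_nonneg (P - Q)) θ
      nlinarith [mul_le_mul_of_nonneg_left l2 hC0, mul_nonneg hB0 l3]
    · have l1 : |α (P, t) - α (Q, t)| ≤ 2 * B := by
        have := norm_sub_le (α (P, t)) (α (Q, t))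
        rw [Real.norm_eq_abs] at this
        linarith [hB (P, t), hB (Q, t)]
      have l2 : 1 ≤ ‖P - Q‖ ^ θ := Real.one_le_rpow hd hθ.le
      nlinarith
  have z : ∀ X, X ∉ K → α X = 0 := fun X hX => by
    by_contra hne
    exact hX (hΩ (h.sub (subset_tsupport _ hne)))
  have hC0 : (0:ℝ) ≤ C := C.2
  refine ⟨B * H + |N| * (2 * B + C), by positivity, fun P Q t => ?_⟩
  have l3 := Real.rpow_nonneg (norm_nonneg (P - Q)) θ
  have hs := aH P Q t
  have nn1 : 0 ≤ B * H * ‖P - Q‖ ^ θ := by positivity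
  by_cases hP : (P, t) ∈ K
  · by_cases hQ : (Q, t) ∈ K
    · have e : α (P, t) * φ (P, t) - α (Q, t) * φ (Q, t) = α (P, t) * (φ (P, t) - φ (Q, t)) +
        φ (Q, t) * (α (P, t) - α (Q, t)) := by ring
      show |α (P, t) * φ (P, t) - α (Q, t) * φ (Q, t)| ≤ _
      rw [e]
      have a1 : |α (P, t) * (φ (P, t) - φ (Q, t))| ≤ B * (H * ‖P - Q‖ ^ θ) := by
        rw [abs_mul]
        exact mul_le_mul (hB _) (h1 P Q t hP hQ) (abs_nonneg _) hB0
      have a2 : |φ (Q, t) * (α (P, t) - α (Q, t))| ≤ |N| * ((2 * B + C) * ‖P - Q‖ ^ θ) := by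
        rw [abs_mul]
        exact mul_le_mul ((hN _ hQ).trans (le_abs_self _)) hs (abs_nonneg _) (abs_nonneg _)
      have := abs_add_le (α (P, t) * (φ (P, t) - φ (Q, t))) (φ (Q, t) * (α (P, t) - α (Q, t)))
      nlinarith
    · have hq := z _ hQ
      show |α (P, t) * φ (P, t) - α (Q, t) * φ (Q, t)| ≤ _
      rw [hq] at hs ⊢
      rw [zero_mul, sub_zero, abs_mul, mul_comm]
      rw [sub_zero] at hs
      have := mul_le_mul ((hN _ hP).trans (le_abs_self _)) hs (abs_nonneg _) (abs_nonneg _)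
      rw [Real.norm_eq_abs] at this
      nlinarith
  · have hq := z _ hP
    show |α (P, t) * φ (P, t) - α (Q, t) * φ (Q, t)| ≤ _
    rw [hq] at hs ⊢
    rw [zero_mul, zero_sub, abs_neg, abs_mul, mul_comm]
    rw [zero_sub, abs_neg] at hs
    by_cases hQ : (Q, t) ∈ K
    · have := mul_le_mul ((hN _ hQ).trans (le_abs_self _)) hs (abs_nonneg _) (abs_nonneg _)
      rw [Real.norm_eq_abs] at this
      nlinarith
    · rw [z _ hQ]; simp; positivity

theorem HolS.add {θ : ℝ} {φ ψ : E3 → ℝ} (h : ∃ H, 0 ≤ H ∧ HolS θ φ H) (h' : ∃ H, 0 ≤ H ∧ HolS θ ψ H) :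
    ∃ H, 0 ≤ H ∧ HolS θ (fun X => φ X + ψ X) H := by
  obtain ⟨H, h0, h1⟩ := h
  obtain ⟨H', h0', h1'⟩ := h'
  refine ⟨H + H', by positivity, fun P Q t => ?_⟩
  have := abs_add_le (φ (P, t) - φ (Q, t)) (ψ (P, t) - ψ (Q, t))
  have e : φ (P, t) + ψ (P, t) - (φ (Q, t) + ψ (Q, t)) = (φ (P, t) - φ (Q, t)) + (ψ (P, t) - ψ (Q, t)) := by ring
  show |φ (P, t) + ψ (P, t) - (φ (Q, t) + ψ (Q, t))| ≤ _
  rw [e, add_mul]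
  linarith [h1 P Q t, h1' P Q t]

/-- Local representation. -/
theorem loc_rep {Ω : Set E3} {w wx wy wt wxx wxy wyy f g : E3 → ℝ}
    (D : Dat Ω w wx wy wt wxx wxy wyy f g) {X0 : E3} {R : ℝ} (hR : 0 < R)
    (hb : Metric.closedBall X0 R ⊆ Ω) :
    ∃ χ, ∃ r > 0, r ≤ R ∧ Cut (Metric.ball X0 R) χ ∧ ∃ T1, ∀ X ∈ Metric.ball X0 r,
      NN * wx X = II 0 kg (Gc χ w wx wy wxx wxy f g) T1 X := by
  let b : ContDiffBump X0 := ⟨R/4, R/2, by linarith, by linarith⟩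
  have hcut : Cut (Metric.ball X0 R) (fun X => b X) := by
    refine ⟨b.contDiff, b.hasCompactSupport, ?_⟩
    rw [b.tsupport_eq]
    exact Metric.closedBall_subset_ball (by show R/2 < R; linarith)
  have hcut' : Cut Ω (fun X => b X) :=
    ⟨hcut.smooth, hcut.cs, hcut.sub.trans (Metric.ball_subset_closedBall.trans hb)⟩
  refine ⟨fun X => b X, R/4, by linarith, by linarith, hcut, R, fun X hX => ?_⟩
  have h1 : (fun X => b X) =ᶠ[nhds X] fun _ => 1 := by
    filter_upwards [Metric.isOpen_ball.mem_nhds hX] with Y hY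
    exact b.one_of_mem_closedBall (Metric.ball_subset_closedBall hY)
  have h2 : DD ex (fun X => b X) X = 0 := by
    unfold DD
    rw [h1.fderiv_eq]; simp
  have h3 : b X = 1 := h1.self_of_nhds
  have := rep_cut D hcut' hR X.1 X.2 (fun Q => by
    by_contra hne
    have hm : (Q, X.2 - R) ∈ Metric.closedBall X0 (R/2) := by
      have := subset_tsupport _ (Function.mem_support.2 hne)
      rwa [b.tsupport_eq] at this
    have a1 := Metric.mem_closedBall.1 hm
    have a2 := Metric.mem_ball.1 hX
    rw [Prod.dist_eq] at a1 a2
    have a3 := (le_max_right _ _).trans a1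
    have a4 := (le_max_right _ _).trans_lt a2
    rw [Real.dist_eq] at a3 a4
    have := abs_lt.1 a4
    have := abs_le.1 a3
    simp only at *
    linarith)
  simp only [Prod.mk.eta, h2, h3, zero_mul, zero_add, one_mul] at this
  exact this

theorem e1n : ‖((1:ℝ),(0:ℝ))‖ ≤ 1 := by simp [Prod.norm_def]
theorem e2n : ‖((0:ℝ),(1:ℝ))‖ ≤ 1 := by simp [Prod.norm_def]

theorem to_line {V : E3 → ℝ} {V' : E3 → ℝ} {e : ℝ × ℝ}
    (h : ∀ P t h0, HasDerivAt (fun h : ℝ => V (P + h • e, t)) (V' (P + h0 • e, t)) h0) (X : E3) :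
    HasLineDerivAt ℝ V (V' X) X (e, 0) := by
  have := h X.1 X.2 0
  rw [zero_smul, add_zero] at this
  refine HasDerivAt.congr_of_eventuallyEq this (Eventually.of_forall fun s => ?_)
  show V _ = V _
  congr 1
  ext <;> simp

theorem line_congr {V W : E3 → ℝ} {B : Set E3} (hB : IsOpen B) (h : ∀ X ∈ B, V X = W X) {X : E3} (hX : X ∈ B)
    {c : ℝ} {v : E3} (hW : HasLineDerivAt ℝ W c X v) : HasLineDerivAt ℝ V c X v := by
  refine hW.congr_of_eventuallyEq ?_
  filter_upwards [hB.mem_nhds hX] with Y hY using h Y hY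

theorem loc_d {Ω : Set E3} {w wx wy wt wxx wxy wyy f g G : E3 → ℝ}
    (D : Dat Ω w wx wy wt wxx wxy wyy f g) {X0 : E3} {r : ℝ} (hb : Metric.ball X0 r ⊆ Ω)
    (hG : Continuous G) {M : ℝ} (hM : ∀ X, |G X| ≤ M) {T1 : ℝ}
    (h : ∀ X ∈ Metric.ball X0 r, NN * wx X = II 0 kg G T1 X) :
    (∀ X ∈ Metric.ball X0 r, wxx X = -NN⁻¹ * II 1 (ke ((1:ℝ),(0:ℝ))) G T1 X) ∧
    (∀ X ∈ Metric.ball X0 r, wxy X = -NN⁻¹ * II 1 (ke ((0:ℝ),(1:ℝ))) G T1 X) := by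
  have hN := NN_pos.ne'
  have h' : ∀ X ∈ Metric.ball X0 r, wx X = NN⁻¹ * II 0 kg G T1 X := fun X hX => by
    rw [← h X hX]; field_simp
  constructor
  · intro X hX
    have a := to_line (V' := fun X => - II 1 (ke ((1:ℝ),(0:ℝ))) G T1 X) (pot_d1 _ e1n hG hM T1) X
    have a' : HasLineDerivAt ℝ (fun X => NN⁻¹ * II 0 kg G T1 X) _ X ex := HasDerivAt.const_mul NN⁻¹ a
    rw [HasDerivAt.unique (D.dxx X (hb hX)) (line_congr Metric.isOpen_ball h' hX a')]; ring
  · intro X hX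
    have a := to_line (V' := fun X => - II 1 (ke ((0:ℝ),(1:ℝ))) G T1 X) (pot_d1 _ e2n hG hM T1) X
    have a' : HasLineDerivAt ℝ (fun X => NN⁻¹ * II 0 kg G T1 X) _ X ey := HasDerivAt.const_mul NN⁻¹ a
    rw [HasDerivAt.unique (D.dxy X (hb hX)) (line_congr Metric.isOpen_ball h' hX a')]; ring

theorem HolS.on {θ : ℝ} {V φ : E3 → ℝ} {C c : ℝ} (h0 : 0 ≤ C) (h : HolS θ V C) {B : Set E3}
    (hv : ∀ X ∈ B, φ X = c * V X) : HolOn θ B φ := by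
  refine ⟨|c| * C, by positivity, fun P Q t hP hQ => ?_⟩
  rw [hv _ hP, hv _ hQ, ← mul_sub, abs_mul, mul_assoc]
  exact mul_le_mul_of_nonneg_left (h P Q t) (abs_nonneg _)

theorem step1 {Ω : Set E3} {w wx wy wt wxx wxy wyy f g : E3 → ℝ}
    (D : Dat Ω w wx wy wt wxx wxy wyy f g) {X0 : E3} (hX0 : X0 ∈ Ω) :
    ∃ r > 0, r ≤ 1/2 ∧ Metric.closedBall X0 r ⊆ Ω ∧ HolOn (1/2) (Metric.closedBall X0 r) wxx ∧
      HolOn (1/2) (Metric.closedBall X0 r) wxy := by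
  obtain ⟨R, hR, hb⟩ := Metric.nhds_basis_closedBall.mem_iff.1 (D.op.mem_nhds hX0)
  obtain ⟨χ, r, hr, hrR, hχ, T1, h⟩ := loc_rep D hR hb
  have hχ' : Cut Ω χ := ⟨hχ.smooth, hχ.cs, hχ.sub.trans (Metric.ball_subset_closedBall.trans hb)⟩
  have hG := Gc_cont D hχ'
  obtain ⟨M, hM⟩ := Gc_bdd D hχ'
  have hbr : Metric.ball X0 r ⊆ Ω :=
    (Metric.ball_subset_closedBall.trans (Metric.closedBall_subset_closedBall hrR)).trans hb
  obtain ⟨h1, h2⟩ := loc_d D hbr hG hM h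
  obtain ⟨C1, c1, H1⟩ := II_hol ((1:ℝ),(0:ℝ)) hG hM T1
  obtain ⟨C2, c2, H2⟩ := II_hol ((0:ℝ),(1:ℝ)) hG hM T1
  have hs : Metric.closedBall X0 (min (r/2) (1/2)) ⊆ Metric.ball X0 r :=
    Metric.closedBall_subset_ball (lt_of_le_of_lt (min_le_left _ _) (by linarith))
  exact ⟨min (r/2) (1/2), by positivity, min_le_right _ _, hs.trans hbr,
    (H1.on c1 h1).mono hs, (H2.on c2 h2).mono hs⟩

theorem step2 {Ω : Set E3} {w wx wy wt wxx wxy wyy f g : E3 → ℝ}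
    (D : Dat Ω w wx wy wt wxx wxy wyy f g) {X0 : E3} {R : ℝ} (hR : 0 < R) (hR1 : R ≤ 1/2)
    (hb : Metric.closedBall X0 R ⊆ Ω) {θ : ℝ} (hθ : 0 < θ) (hθ1 : θ ≤ 1/2)
    (hxx : HolOn (1/2) (Metric.closedBall X0 R) wxx) (hxy : HolOn (1/2) (Metric.closedBall X0 R) wxy)
    (hf : HolOn θ (Metric.closedBall X0 R) f) (hg : HolOn θ (Metric.closedBall X0 R) g) :
    ∃ r > 0, Metric.ball X0 r ⊆ Ω ∧ ∃ vxx vyy : E3 → ℝ, Continuous vxx ∧ Continuous vyy ∧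
      (∀ X ∈ Metric.ball X0 r, HasLineDerivAt ℝ wxx (vxx X) X ex) ∧
      (∀ X ∈ Metric.ball X0 r, HasLineDerivAt ℝ wxy (vyy X) X ey) := by
  obtain ⟨χ, r, hr, hrR, hχ, T1, h⟩ := loc_rep D hR hb
  have hχ' : Cut Ω χ := ⟨hχ.smooth, hχ.cs, hχ.sub.trans (Metric.ball_subset_closedBall.trans hb)⟩
  have hG := Gc_cont D hχ'
  obtain ⟨M, hM⟩ := Gc_bdd D hχ'
  have hbr : Metric.ball X0 r ⊆ Ω :=
    (Metric.ball_subset_closedBall.trans (Metric.closedBall_subset_closedBall hrR)).trans hb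
  obtain ⟨h1, h2⟩ := loc_d D hbr hG hM h
  have hK : IsCompact (Metric.closedBall X0 R) := isCompact_closedBall X0 R
  have hBK : Metric.ball X0 R ⊆ Metric.closedBall X0 R := Metric.ball_subset_closedBall
  have t1 : θ ≤ 1 := by linarith
  have Hw : HolOn θ (Metric.closedBall X0 R) w := (HolOn.lip (D.cx.mono hb) (D.cy.mono hb)
    (fun X hX => D.dx X (hb hX)) (fun X hX => D.dy X (hb hX))).weaken hθ t1 hR1
  have Hwx : HolOn θ (Metric.closedBall X0 R) wx := (HolOn.lip (D.cxx.mono hb) (D.cxy.mono hb)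
    (fun X hX => D.dxx X (hb hX)) (fun X hX => D.dxy X (hb hX))).weaken hθ t1 hR1
  have Hwy : HolOn θ (Metric.closedBall X0 R) wy := (HolOn.lip (D.cxy.mono hb) (D.cyy.mono hb)
    (fun X hX => D.dyx X (hb hX)) (fun X hX => D.dyy X (hb hX))).weaken hθ t1 hR1
  have hxx' := hxx.weaken hθ hθ1 hR1
  have hxy' := hxy.weaken hθ hθ1 hR1
  have HG : ∃ H, 0 ≤ H ∧ HolS θ (Gc χ w wx wy wxx wxy f g) H := by
    unfold Gc
    exact HolS.add (HolS.add (HolS.add ((hχ.al.dd ex).hol hθ t1 hK hBK (D.cw.mono hb) Hw)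
        (hχ.al.hol hθ t1 hK hBK (D.cx.mono hb) Hwx))
      (HolS.add ((((hχ.dd ex).cmul (-2)).dd ex).hol hθ t1 hK hBK (D.cx.mono hb) Hwx)
        (((hχ.dd ex).cmul (-2)).hol hθ t1 hK hBK (D.cxx.mono hb) hxx')))
      (HolS.add (HolS.add ((((hχ.dd ey).cmul (-2)).dd ex).hol hθ t1 hK hBK (D.cy.mono hb) Hwy)
        (((hχ.dd ey).cmul (-2)).hol hθ t1 hK hBK (D.cxy.mono hb) hxy'))
      (HolS.add ((hχ.dd ex).hol hθ t1 hK hBK (D.cf.mono hb) hf)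
        (hχ.hol hθ t1 hK hBK (D.cg.mono hb) hg)))
  obtain ⟨H, H0, HH⟩ := HG
  refine ⟨r, hr, hbr, _, _, (continuous_const (y := -NN⁻¹)).mul (pot_c2 ((1:ℝ),(0:ℝ)) e1n hG hM hθ t1 H0 HH T1).neg,
    (continuous_const (y := -NN⁻¹)).mul (pot_c2 ((0:ℝ),(1:ℝ)) e2n hG hM hθ t1 H0 HH T1).neg, ?_, ?_⟩
  · intro X hX
    have a := to_line (V' := fun X => - II 2 (kee ((1:ℝ),(0:ℝ)) ((1:ℝ),(0:ℝ))) (Gc χ w wx wy wxx wxy f g) T1 X)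
      (pot_d2 _ e1n hG hM hθ t1 H0 HH T1) X
    exact line_congr Metric.isOpen_ball h1 hX (HasDerivAt.const_mul (-NN⁻¹) a)
  · intro X hX
    have a := to_line (V' := fun X => - II 2 (kee ((0:ℝ),(1:ℝ)) ((0:ℝ),(1:ℝ))) (Gc χ w wx wy wxx wxy f g) T1 X)
      (pot_d2 _ e2n hG hM hθ t1 H0 HH T1) X
    exact line_congr Metric.isOpen_ball h2 hX (HasDerivAt.const_mul (-NN⁻¹) a)

/-- Swap of mixed partials. -/
theorem swap {F Fx Fy Fxy : ℝ → ℝ → ℝ} {x0 y0 : ℝ}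
    (h : ∀ᶠ z : ℝ × ℝ in nhds (x0, y0), HasDerivAt (fun s => F s z.2) (Fx z.1 z.2) z.1 ∧
      HasDerivAt (fun s => F z.1 s) (Fy z.1 z.2) z.2 ∧
      HasDerivAt (fun s => Fx z.1 s) (Fxy z.1 z.2) z.2)
    (hc : ContinuousAt (fun z : ℝ × ℝ => Fxy z.1 z.2) (x0, y0)) :
    HasDerivAt (fun s => Fy s y0) (Fxy x0 y0) x0 := by
  rw [hasDerivAt_iff_isLittleO, Asymptotics.isLittleO_iff]
  intro ε hε
  have hc' : ∀ᶠ z : ℝ × ℝ in nhds (x0, y0), |Fxy z.1 z.2 - Fxy x0 y0| ≤ ε := by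
    have := Metric.tendsto_nhds.1 hc ε hε
    filter_upwards [this] with z hz
    exact le_of_lt hz
  obtain ⟨δ, hδ, hb⟩ := Metric.eventually_nhds_iff.1 (h.and hc')
  have hb' : ∀ a ∈ Metric.ball x0 δ, ∀ b ∈ Metric.ball y0 δ, (HasDerivAt (fun s => F s b) (Fx a b) a ∧
      HasDerivAt (fun s => F a s) (Fy a b) b ∧
      HasDerivAt (fun s => Fx a s) (Fxy a b) b) ∧ |Fxy a b - Fxy x0 y0| ≤ ε := by
    intro a ha b hbb
    refine hb (y := (a, b)) ?_
    rw [Prod.dist_eq]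
    exact max_lt ha hbb
  set c := Fxy x0 y0 with hcdef
  have hx0 : x0 ∈ Metric.ball x0 δ := Metric.mem_ball_self hδ
  have hy0 : y0 ∈ Metric.ball y0 δ := Metric.mem_ball_self hδ
  filter_upwards [Metric.ball_mem_nhds x0 hδ] with x hx
  have est : ∀ y ∈ Metric.ball y0 δ, |((F x y - F x0 y) - c * (x - x0) * y) -
      ((F x y0 - F x0 y0) - c * (x - x0) * y0)| ≤ ε * |x - x0| * |y - y0| := by
    intro y hy
    have i1 : ∀ s ∈ Metric.ball x0 δ, |Fx s y - Fx s y0 - c * (y - y0)| ≤ ε * |y - y0| := by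
      intro s hs
      have := (convex_ball y0 δ).norm_image_sub_le_of_norm_hasDerivWithin_le
        (f := fun b => Fx s b - c * b) (f' := fun b => Fxy s b - c) (C := ε) (x := y0) (y := y)
        (fun b hbb => by
          have h1 := (hb' s hs b hbb).1.2.2
          have h2 : HasDerivAt (fun b : ℝ => c * b) c b := by simpa using! (hasDerivAt_id b).const_mul c
          exact (h1.sub h2).hasDerivWithinAt)
        (fun b hbb => (hb' s hs b hbb).2) hy0 hy
      simp only [Real.norm_eq_abs] at this
      refine le_trans (le_of_eq ?_) this
      congr 1; ring
    have := (convex_ball x0 δ).norm_image_sub_le_of_norm_hasDerivWithin_le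
        (f := fun s => (F s y - F s y0) - c * (y - y0) * s)
        (f' := fun s => Fx s y - Fx s y0 - c * (y - y0)) (C := ε * |y - y0|) (x := x0) (y := x)
        (fun s hs => by
          have h1 := (hb' s hs y hy).1.1
          have h1' := (hb' s hs y0 hy0).1.1
          have h2 : HasDerivAt (fun s : ℝ => c * (y - y0) * s) (c * (y - y0)) s := by
            simpa using! (hasDerivAt_id s).const_mul (c * (y - y0))
          exact ((h1.sub h1').sub h2).hasDerivWithinAt)
        (fun s hs => i1 s hs) hx0 hx
    simp only [Real.norm_eq_abs] at this
    refine le_trans (le_of_eq ?_) (this.trans (le_of_eq ?_))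
    · congr 1; ring
    · ring
  have hE : HasDerivAt (fun y => (F x y - F x0 y) - c * (x - x0) * y)
      ((Fy x y0 - Fy x0 y0) - c * (x - x0)) y0 := by
    have h2 : HasDerivAt (fun s : ℝ => c * (x - x0) * s) (c * (x - x0)) y0 := by
      simpa using! (hasDerivAt_id y0).const_mul (c * (x - x0))
    exact ((hb' x hx y0 hy0).1.2.1.sub (hb' x0 hx0 y0 hy0).1.2.1).sub h2
  have := hE.le_of_lip' (C := ε * |x - x0|) (by positivity) (by
    filter_upwards [Metric.ball_mem_nhds y0 hδ] with y hy
    exact est y hy)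
  rw [Real.norm_eq_abs] at this ⊢
  rw [Real.norm_eq_abs, smul_eq_mul, mul_comm (x - x0)]
  exact this

def Om (L T : ℝ) : Set E3 := {X | |X.1.1| < L ∧ (0 < X.1.2 ∧ X.1.2 < L) ∧ (0 < X.2 ∧ X.2 < T)}

theorem Om_open (L T : ℝ) : IsOpen (Om L T) := by
  unfold Om
  have h1 : IsOpen {X : E3 | |X.1.1| < L} := isOpen_lt (by fun_prop) (by fun_prop)
  have h2 : IsOpen {X : E3 | 0 < X.1.2} := isOpen_lt (by fun_prop) (by fun_prop)
  have h3 : IsOpen {X : E3 | X.1.2 < L} := isOpen_lt (by fun_prop) (by fun_prop)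
  have h4 : IsOpen {X : E3 | 0 < X.2} := isOpen_lt (by fun_prop) (by fun_prop)
  have h5 : IsOpen {X : E3 | X.2 < T} := isOpen_lt (by fun_prop) (by fun_prop)
  exact h1.inter ((h2.inter h3).inter (h4.inter h5))

def li (φ : ℝ → ℝ → ℝ → ℝ) : E3 → ℝ := fun X => φ X.1.1 X.1.2 X.2

theorem li_cont {φ : ℝ → ℝ → ℝ → ℝ} {X : E3}
    (h : ContinuousAt (fun q : ℝ × ℝ × ℝ => φ q.1 q.2.1 q.2.2) (X.1.1, X.1.2, X.2)) :
    ContinuousAt (li φ) X :=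
  ContinuousAt.comp (f := fun X : E3 => (X.1.1, X.1.2, X.2)) (x := X) h (by fun_prop)

def ff (p : ℝ) (u : ℝ → ℝ → ℝ → ℝ) (x y t : ℝ) : ℝ := gradNorm u x y t ^ p
def gg (p : ℝ) (u : ℝ → ℝ → ℝ → ℝ) (x y t : ℝ) : ℝ := p * gradNorm u x y t ^ (p - 2) *
  (pdx u x y t * pdxx u x y t + pdy u x y t * pdxy u x y t)

theorem gradpow (u : ℝ → ℝ → ℝ → ℝ) (x y t r : ℝ) :
    gradNorm u x y t ^ r = (pdx u x y t ^ 2 + pdy u x y t ^ 2) ^ (r / 2) := by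
  unfold gradNorm
  rw [Real.sqrt_eq_rpow, ← Real.rpow_mul (by positivity)]
  congr 1; ring

section
variable {p L T : ℝ} {u : ℝ → ℝ → ℝ → ℝ}

theorem Om_mem {x y t : ℝ} : ((x, y), t) ∈ Om L T ↔ |x| < L ∧ (0 < y ∧ y < L) ∧ (0 < t ∧ t < T) := Iff.rfl

theorem sol_C21 (hs : ClassicalSolution p L T u) {x y t : ℝ} (h : ((x, y), t) ∈ Om L T) : C21At u x y t :=
  hs.smooth h.1.le ⟨h.2.1.1.le, h.2.1.2.le⟩ h.2.2

theorem d_f (hp : 2 < p) {a b : ℝ → ℝ} {a' b' s : ℝ} (ha : HasDerivAt a a' s) (hb : HasDerivAt b b' s) :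
    HasDerivAt (fun s => (a s ^ 2 + b s ^ 2) ^ (p/2))
      (p * (a s ^ 2 + b s ^ 2) ^ ((p-2)/2) * (a s * a' + b s * b')) s := by
  have h1 : HasDerivAt (fun s => a s ^ 2 + b s ^ 2) (2 * a s * a' + 2 * b s * b') s := by
    have := (ha.pow 2).add (hb.pow 2)
    refine this.congr_deriv ?_
    norm_num
  have := h1.rpow_const (p := p/2) (Or.inr (by linarith))
  refine this.congr_deriv ?_
  have e : p/2 - 1 = (p-2)/2 := by ring
  rw [e]; ring

theorem mkDat (hp : 2 < p) (hs : ClassicalSolution p L T u) :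
    Dat (Om L T) (li u) (li (pdx u)) (li (pdy u)) (li (pdt u)) (li (pdxx u)) (li (pdxy u)) (li (pdyy u))
      (li (ff p u)) (li (gg p u)) := by
  have C : ∀ X ∈ Om L T, C21At u X.1.1 X.1.2 X.2 := fun X hX => sol_C21 hs hX
  have cx : ContinuousOn (li (pdx u)) (Om L T) := fun X hX =>
    (li_cont (C X hX).2.2.2.2.2.2.2.1).continuousWithinAt
  have cy : ContinuousOn (li (pdy u)) (Om L T) := fun X hX =>
    (li_cont (C X hX).2.2.2.2.2.2.2.2.1).continuousWithinAt
  have cxx : ContinuousOn (li (pdxx u)) (Om L T) := fun X hX =>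
    (li_cont (C X hX).2.2.2.2.2.2.2.2.2.2.1).continuousWithinAt
  have cyy : ContinuousOn (li (pdyy u)) (Om L T) := fun X hX =>
    (li_cont (C X hX).2.2.2.2.2.2.2.2.2.2.2.1).continuousWithinAt
  have cxy : ContinuousOn (li (pdxy u)) (Om L T) := fun X hX =>
    (li_cont (C X hX).2.2.2.2.2.2.2.2.2.2.2.2).continuousWithinAt
  have cn : ContinuousOn (li (gradNorm u)) (Om L T) := by
    unfold li gradNorm
    exact ((cx.pow 2).add (cy.pow 2)).sqrt
  have dyx : ∀ X ∈ Om L T, HasLineDerivAt ℝ (li (pdy u)) (li (pdxy u) X) X ex := by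
    rintro ⟨⟨x, y⟩, t⟩ hX
    refine lineX.2 ?_
    refine swap (F := fun a b => u a b t) (Fx := fun a b => pdx u a b t) (Fy := fun a b => pdy u a b t)
      (Fxy := fun a b => pdxy u a b t) ?_ ?_
    · have : ∀ᶠ z : ℝ × ℝ in nhds (x, y), (z, t) ∈ Om L T :=
        (Continuous.tendsto (by fun_prop : Continuous fun z : ℝ × ℝ => (z, t)) (x, y)).eventually
          ((Om_open L T).mem_nhds hX)
      filter_upwards [this] with z hz
      have c := C _ hz
      exact ⟨c.1.hasDerivAt, c.2.1.hasDerivAt, c.2.2.2.2.2.1.hasDerivAt⟩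
    · have := li_cont (C _ hX).2.2.2.2.2.2.2.2.2.2.2.2
      exact ContinuousAt.comp (f := fun z : ℝ × ℝ => (z, t)) (x := (x, y)) this (by fun_prop)
  refine ⟨Om_open L T, fun X hX => (li_cont (C X hX).2.2.2.2.2.2.1).continuousWithinAt, cx, cy,
    fun X hX => (li_cont (C X hX).2.2.2.2.2.2.2.2.2.1).continuousWithinAt, cxx, cxy, cyy, ?_, ?_,
    ?_, ?_, ?_, ?_, ?_, dyx, ?_, ?_, ?_⟩
  · exact cn.rpow_const fun X _ => Or.inr (by linarith)
  · have h1 : ContinuousOn (fun X => li (gradNorm u) X ^ (p-2)) (Om L T) :=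
      cn.rpow_const fun X _ => Or.inr (by linarith)
    exact (continuousOn_const.mul h1).mul ((cx.mul cxx).add (cy.mul cxy))
  · rintro ⟨⟨x, y⟩, t⟩ hX
    exact lineX.2 (C _ hX).1.hasDerivAt
  · rintro ⟨⟨x, y⟩, t⟩ hX
    exact lineY.2 (C _ hX).2.1.hasDerivAt
  · rintro ⟨⟨x, y⟩, t⟩ hX
    exact lineT.2 (C _ hX).2.2.1.hasDerivAt
  · rintro ⟨⟨x, y⟩, t⟩ hX
    exact lineX.2 (C _ hX).2.2.2.1.hasDerivAt
  · rintro ⟨⟨x, y⟩, t⟩ hX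
    exact lineY.2 (C _ hX).2.2.2.2.2.1.hasDerivAt
  · rintro ⟨⟨x, y⟩, t⟩ hX
    exact lineY.2 (C _ hX).2.2.2.2.1.hasDerivAt
  · rintro ⟨⟨x, y⟩, t⟩ hX
    refine lineX.2 ?_
    have h1 := (C _ hX).2.2.2.1.hasDerivAt
    have h2 := lineX.1 (dyx _ hX)
    have := d_f hp h1 h2
    simp only [li, ff, gg, gradpow]
    exact this
  · rintro ⟨⟨x, y⟩, t⟩ hX
    have := hs.pde hX.1 hX.2.1 hX.2.2
    simp only [li, ff]
    rw [← this]; ring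

theorem sqrt_lip (a b c d : ℝ) : |√(a^2+b^2) - √(c^2+d^2)| ≤ |a - c| + |b - d| := by
  have key : ∀ a b c d : ℝ, √(a^2+b^2) ≤ √(c^2+d^2) + (|a - c| + |b - d|) := by
    intro a b c d
    apply Real.sqrt_le_iff.2
    constructor
    · positivity
    · have h1 : |c| ≤ √(c^2+d^2) := Real.abs_le_sqrt (by nlinarith [sq_nonneg d])
      have h2 : |d| ≤ √(c^2+d^2) := Real.abs_le_sqrt (by nlinarith [sq_nonneg c])
      have h3 := Real.sq_sqrt (by positivity : 0 ≤ c^2+d^2)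
      have h4 : c * (a - c) ≤ √(c^2+d^2) * |a - c| :=
        (le_abs_self _).trans (by rw [abs_mul]; exact mul_le_mul_of_nonneg_right h1 (abs_nonneg _))
      have h5 : d * (b - d) ≤ √(c^2+d^2) * |b - d| :=
        (le_abs_self _).trans (by rw [abs_mul]; exact mul_le_mul_of_nonneg_right h2 (abs_nonneg _))
      nlinarith [sq_abs (a - c), sq_abs (b - d), mul_nonneg (abs_nonneg (a-c)) (abs_nonneg (b-d))]
  rw [abs_le]
  constructor
  · have := key c d a b
    rw [abs_sub_comm c a, abs_sub_comm d b] at this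
    linarith
  · linarith [key a b c d]

theorem rpow_hol {a b s : ℝ} (ha : 0 ≤ a) (hb : 0 ≤ b) (hs : 0 < s) (hs1 : s ≤ 1) :
    |a ^ s - b ^ s| ≤ |a - b| ^ s := by
  have key : ∀ a b : ℝ, 0 ≤ b → b ≤ a → a ^ s - b ^ s ≤ (a - b) ^ s := by
    intro a b hb hab
    have := Real.rpow_add_le_add_rpow (sub_nonneg.2 hab) hb hs.le hs1
    rw [sub_add_cancel] at this
    linarith
  rcases le_total b a with h | h
  · rw [abs_of_nonneg (sub_nonneg.2 (Real.rpow_le_rpow hb h hs.le)), abs_of_nonneg (sub_nonneg.2 h)]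
    exact key a b hb h
  · rw [abs_sub_comm, abs_sub_comm a, abs_of_nonneg (sub_nonneg.2 (Real.rpow_le_rpow ha h hs.le)),
      abs_of_nonneg (sub_nonneg.2 h)]
    exact key b a ha h

set_option maxHeartbeats 1000000 in
theorem reg (hp : 2 < p) (hp3 : p ≤ 3) (hs : ClassicalSolution p L T u) {x y t : ℝ}
    (hX : ((x, y), t) ∈ Om L T) :
    ∃ vxx vyy, HasDerivAt (fun s => pdxx u s y t) vxx x ∧ HasDerivAt (fun s => pdxy u x s t) vyy y ∧
      HasDerivAt (fun s => pdx u x y s) (vxx + vyy + gg p u x y t) t := by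
  have D := mkDat hp hs
  obtain ⟨R, hR, hR1, hb, hxx, hxy⟩ := step1 D hX
  set K := Metric.closedBall ((x, y), t) R with hKdef
  have hK : IsCompact K := isCompact_closedBall _ _
  set θ := min (1/2) (p - 2) with hθdef
  have hθ : 0 < θ := lt_min (by norm_num) (by linarith)
  have hθ1 : θ ≤ 1/2 := min_le_left _ _
  have hθ2 : θ ≤ p - 2 := min_le_right _ _
  have Lx : HolOn 1 K (li (pdx u)) := HolOn.lip (D.cxx.mono hb) (D.cxy.mono hb)
    (fun X hX => D.dxx X (hb hX)) (fun X hX => D.dxy X (hb hX))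
  have Ly : HolOn 1 K (li (pdy u)) := HolOn.lip (D.cxy.mono hb) (D.cyy.mono hb)
    (fun X hX => D.dyx X (hb hX)) (fun X hX => D.dyy X (hb hX))
  have Hx := Lx.weaken hθ (by linarith) hR1
  have Hy := Ly.weaken hθ (by linarith) hR1
  have Hn : HolOn (p-2) K (fun X => li (gradNorm u) X ^ (p-2)) := by
    obtain ⟨H, h0, h1⟩ := Lx
    obtain ⟨H', h0', h1'⟩ := Ly
    refine ⟨(H + H') ^ (p-2), by positivity, fun P Q t hP hQ => ?_⟩
    have a := sqrt_lip (li (pdx u) (P,t)) (li (pdy u) (P,t)) (li (pdx u) (Q,t)) (li (pdy u) (Q,t))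
    have a1 := h1 P Q t hP hQ
    have a2 := h1' P Q t hP hQ
    rw [Real.rpow_one] at a1 a2
    rw [← Real.mul_rpow (by positivity) (norm_nonneg _)]
    refine (rpow_hol (Real.sqrt_nonneg _) (Real.sqrt_nonneg _) (by linarith) (by linarith)).trans ?_
    refine Real.rpow_le_rpow (abs_nonneg _) ?_ (by linarith)
    refine a.trans ?_
    linarith
  have Hn' := Hn.weaken hθ hθ2 hR1
  have cn : ContinuousOn (li (gradNorm u)) (Om L T) := by
    unfold li gradNorm
    exact ((D.cx.pow 2).add (D.cy.pow 2)).sqrt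
  have cn2 : ContinuousOn (fun X => li (gradNorm u) X ^ (p-2)) K :=
    (cn.rpow_const fun X _ => Or.inr (by linarith)).mono hb
  have kx := D.cx.mono hb
  have ky := D.cy.mono hb
  have kxx := D.cxx.mono hb
  have kxy := D.cxy.mono hb
  have hg : HolOn θ K (li (gg p u)) := by
    have := HolOn.mul hK (Hn'.cmul p) (HolOn.add (HolOn.mul hK Hx (hxx.weaken hθ hθ1 hR1) kx kxx)
      (HolOn.mul hK Hy (hxy.weaken hθ hθ1 hR1) ky kxy)) (continuousOn_const.mul cn2)
      ((kx.mul kxx).add (ky.mul kxy))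
    exact this
  have hf : HolOn θ K (li (ff p u)) := by
    have := HolOn.mul hK Hn' (HolOn.add (HolOn.mul hK Hx Hx kx kx) (HolOn.mul hK Hy Hy ky ky)) cn2
      ((kx.mul kx).add (ky.mul ky))
    have e : li (ff p u) = fun X => li (gradNorm u) X ^ (p-2) *
        (li (pdx u) X * li (pdx u) X + li (pdy u) X * li (pdy u) X) := by
      funext X
      simp only [li, ff, gradpow]
      set S := pdx u X.1.1 X.1.2 X.2 ^ 2 + pdy u X.1.1 X.1.2 X.2 ^ 2 with hS
      have hS0 : 0 ≤ S := by positivity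
      have : p / 2 = (p-2)/2 + 1 := by ring
      rw [this, Real.rpow_add_one' hS0 (by linarith)]
      rw [hS]; ring
    rw [e]; exact this
  obtain ⟨r, hr, hbr, vxx, vyy, cvx, cvy, dvx, dvy⟩ := step2 D hR hR1 hb hθ hθ1 hxx hxy hf hg
  have hX0 : ((x, y), t) ∈ Metric.ball ((x, y), t) r := Metric.mem_ball_self hr
  refine ⟨vxx ((x, y), t), vyy ((x, y), t), lineX.1 (dvx _ hX0), lineY.1 (dvy _ hX0), ?_⟩
  have dyyx : ∀ X ∈ Metric.ball ((x, y), t) r, HasLineDerivAt ℝ (li (pdyy u)) (vyy X) X ex := by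
    rintro ⟨⟨x', y'⟩, t'⟩ hX'
    refine lineX.2 ?_
    refine swap (F := fun a b => pdy u a b t') (Fx := fun a b => pdxy u a b t')
      (Fy := fun a b => pdyy u a b t') (Fxy := fun a b => vyy ((a, b), t')) ?_ (by fun_prop)
    have : ∀ᶠ z : ℝ × ℝ in nhds (x', y'), (z, t') ∈ Metric.ball ((x, y), t) r :=
        (Continuous.tendsto (by fun_prop : Continuous fun z : ℝ × ℝ => (z, t')) (x', y')).eventually
          (Metric.isOpen_ball.mem_nhds hX')
    filter_upwards [this] with z hz
    exact ⟨lineX.1 (D.dyx _ (hbr hz)), lineY.1 (D.dyy _ (hbr hz)), lineY.1 (dvy _ hz)⟩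
  refine swap (F := fun a b => u b y a) (Fx := fun a b => pdt u b y a)
      (Fy := fun a b => pdx u b y a) (Fxy := fun a b => vxx ((b, y), a) + vyy ((b, y), a) + gg p u b y a)
      (x0 := t) (y0 := x) ?_ ?_
  · have : ∀ᶠ z : ℝ × ℝ in nhds (t, x), ((z.2, y), z.1) ∈ Metric.ball ((x, y), t) r :=
        (Continuous.tendsto (by fun_prop : Continuous fun z : ℝ × ℝ => ((z.2, y), z.1)) (t, x)).eventually
          (Metric.isOpen_ball.mem_nhds hX0)
    filter_upwards [this] with z hz
    refine ⟨lineT.1 (D.dtt _ (hbr hz)), lineX.1 (D.dx _ (hbr hz)), ?_⟩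
    refine (lineX (U := li (pdt u)) (x := z.2) (t := z.1) (y := y)).1 (line_congr (W := fun X => (li (pdxx u) X + li (pdyy u) X) + li (ff p u) X)
      Metric.isOpen_ball (fun X hX => ?_) hz ?_)
    · have := D.pde X (hbr hX); linarith
    · exact line_add (line_add (dvx _ hz) (dyyx _ hz)) (D.dfx _ (hbr hz))
  · have h1 : ContinuousAt (li (gg p u)) ((x, y), t) := D.cg.continuousAt (D.op.mem_nhds hX)
    have h2 : ContinuousAt (fun z : ℝ × ℝ => gg p u z.2 y z.1) (t, x) :=
      ContinuousAt.comp (f := fun z : ℝ × ℝ => ((z.2, y), z.1)) (x := (t, x)) h1 (by fun_prop)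
    have h3 : Continuous (fun z : ℝ × ℝ => vxx ((z.2, y), z.1) + vyy ((z.2, y), z.1)) := by fun_prop
    exact h3.continuousAt.add h2
end

theorem left_max {f : ℝ → ℝ} {f' x a : ℝ} (ha : a < x) (h : ∀ s ∈ Icc a x, f s ≤ f x)
    (hf : HasDerivAt f f' x) : 0 ≤ f' := by
  have h1 := hf.hasDerivWithinAt (s := Iio x)
  rw [hasDerivWithinAt_iff_tendsto_slope' (by simp)] at h1
  refine ge_of_tendsto h1 ?_
  filter_upwards [Ioo_mem_nhdsLT ha] with s hs
  rw [slope_def_field]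
  exact div_nonneg_of_nonpos (by linarith [h s ⟨hs.1.le, hs.2.le⟩]) (by linarith [hs.2])

theorem right_max {f : ℝ → ℝ} {f' x b : ℝ} (ha : x < b) (h : ∀ s ∈ Icc x b, f s ≤ f x)
    (hf : HasDerivAt f f' x) : f' ≤ 0 := by
  have h1 := hf.hasDerivWithinAt (s := Ioi x)
  rw [hasDerivWithinAt_iff_tendsto_slope' (by simp)] at h1
  refine le_of_tendsto h1 ?_
  filter_upwards [Ioo_mem_nhdsGT ha] with s hs
  rw [slope_def_field]
  exact div_nonpos_of_nonpos_of_nonneg (by linarith [h s ⟨hs.1.le, hs.2.le⟩]) (by linarith [hs.1])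

theorem max_snd {f f' : ℝ → ℝ} {x f'' : ℝ} (h : IsLocalMax f x)
    (h1 : ∀ᶠ s in nhds x, HasDerivAt f (f' s) s) (h2 : HasDerivAt f' f'' x) :
    f' x = 0 ∧ f'' ≤ 0 := by
  have e0 : f' x = 0 := h.hasDerivAt_eq_zero h1.self_of_nhds
  refine ⟨e0, ?_⟩
  by_contra hc
  push Not at hc
  have e1 : deriv f =ᶠ[nhds x] f' := h1.mono fun s hs => hs.deriv
  have e2 : deriv (deriv f) x = f'' := by rw [e1.deriv_eq, h2.deriv]
  have hm := isLocalMin_of_deriv_deriv_pos (f := f) (x₀ := x) (by rw [e2]; exact hc)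
    (by rw [h1.self_of_nhds.deriv, e0]) h1.self_of_nhds.continuousAt
  have hcst : f =ᶠ[nhds x] fun _ => f x := by
    filter_upwards [h, hm] with s a b using le_antisymm a b
  have : f' =ᶠ[nhds x] fun _ => 0 := by
    have h3 := hcst.deriv
    filter_upwards [e1, h3] with s a b
    rw [← a, b]; simp
  have h4 := this.deriv_eq
  rw [h2.deriv] at h4
  simp at h4; linarith

theorem pow_super {a b c s : ℝ} (hs : 1 ≤ s) (ha : 0 ≤ a) (hb : 0 ≤ b) (hbc : b ≤ c) :
    c ^ s - b ^ s ≤ (a + c) ^ s - (a + b) ^ s := by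
  have hc := convexOn_rpow hs
  rcases eq_or_lt_of_le (show 0 ≤ a + c - b by linarith) with h | h
  · have h1 : a = 0 := by linarith
    have h2 : b = c := by linarith
    subst h1 h2; simp
  · have hθ : 0 ≤ (c - b) / (a + c - b) := div_nonneg (by linarith) h.le
    have hθ' : 0 ≤ a / (a + c - b) := div_nonneg ha h.le
    have hsum : (c - b) / (a + c - b) + a / (a + c - b) = 1 := by field_simp; ring
    have h1 := hc.2 (x := b) (y := a + c) hb (by simp; linarith) hθ' hθ (by linarith)
    have h2 := hc.2 (x := b) (y := a + c) hb (by simp; linarith) hθ hθ' (by linarith)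
    simp only [smul_eq_mul] at h1 h2
    have e1 : a / (a + c - b) * b + (c - b) / (a + c - b) * (a + c) = c := by field_simp; ring
    have e2 : (c - b) / (a + c - b) * b + a / (a + c - b) * (a + c) = a + b := by field_simp; ring
    rw [e1] at h1; rw [e2] at h2
    have : a / (a + c - b) = 1 - (c - b) / (a + c - b) := by linarith
    rw [this] at h1 h2
    nlinarith

def psX (p C y : ℝ) : ℝ := (1/(p-1)/y) ^ (p/(p-1)) + C
def psi (p C y : ℝ) : ℝ := psX p C y ^ (1/p)
def psi' (p C y : ℝ) : ℝ := -(1/(p-1)/y) * (psX p C y - C) * psX p C y ^ (1/p-1)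

theorem psX_pos (hp : 2 < p) (hC : 0 ≤ C) {y : ℝ} (hy : 0 < y) : C < psX p C y := by
  unfold psX
  have : 0 < p - 1 := by linarith
  have : 0 < (1/(p-1)/y) ^ (p/(p-1)) := by positivity
  linarith

theorem psi_deriv (hp : 2 < p) (hC : 0 ≤ C) {y : ℝ} (hy : 0 < y) :
    HasDerivAt (psi p C) (psi' p C y) y := by
  have hp1 : 0 < p - 1 := by linarith
  have hX := psX_pos hp hC hy
  have h0 : HasDerivAt (fun y : ℝ => 1/(p-1)/y) (-(1/(p-1)/y^2)) y := by
    refine ((hasDerivAt_inv hy.ne').const_mul (1/(p-1))).congr_deriv ?_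
    field_simp
  have h1 : HasDerivAt (psX p C) (-(1/(p-1)/y^2) * (p/(p-1)) * (1/(p-1)/y) ^ (p/(p-1) - 1)) y :=
    (h0.rpow_const (Or.inl (by positivity))).add_const C
  have h2 := h1.rpow_const (p := 1/p) (Or.inl (by linarith))
  refine h2.congr_deriv ?_
  unfold psi'
  have e : psX p C y - C = (1/(p-1)/y) ^ (p/(p-1) - 1) * (1/(p-1)/y) := by
    unfold psX
    rw [← Real.rpow_add_one (by positivity)]; ring_nf
  rw [e]
  field_simp

theorem psi_anti (hp : 2 < p) (hC : 0 ≤ C) {y z : ℝ} (hy : 0 < y) (hyz : y ≤ z) :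
    psX p C z ≤ psX p C y := by
  have hp1 : 0 < p - 1 := by linarith
  have hz : 0 < z := by linarith
  unfold psX
  gcongr

theorem psi_E (hp : 2 < p) (hC : 0 < C) {y : ℝ} (hy : 0 < y) :
    psi' p C y + psi p C y ^ p = C * (((1 - C / psX p C y) ^ (2-1/p) - 1 ^ (2-1/p)) / ((1 - C / psX p C y) - 1)) := by
  have hp1 : 0 < p - 1 := by linarith
  have hX := psX_pos hp hC.le hy
  have hX0 : 0 < psX p C y := by linarith
  have hd : 0 < psX p C y - C := by linarith
  have e1 : psi p C y ^ p = psX p C y := by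
    unfold psi; rw [← Real.rpow_mul hX0.le]; simp [show p ≠ 0 by linarith]
  have e2 : 1/(p-1)/y = (psX p C y - C) ^ (1 - 1/p) := by
    unfold psX
    rw [add_sub_cancel_right, ← Real.rpow_mul (by positivity)]
    have : p/(p-1) * (1 - 1/p) = 1 := by field_simp
    rw [this, Real.rpow_one]
  have e3 : 1 - C / psX p C y = (psX p C y - C) / psX p C y := by field_simp
  have e4 : (1 - C / psX p C y) ^ (2-1/p) = (psX p C y - C) ^ (1-1/p) * (psX p C y - C) * psX p C y ^ (1/p - 1) / psX p C y := by
    rw [e3, Real.div_rpow hd.le hX0.le, show 2 - 1/p = (1 - 1/p) + 1 by ring, Real.rpow_add_one hd.ne',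
      Real.rpow_add_one hX0.ne', show 1/p - 1 = -(1-1/p) by ring, Real.rpow_neg hX0.le]
    field_simp
  rw [e4, e1]
  unfold psi'
  rw [e2, Real.one_rpow, show 1 - C / psX p C y - 1 = -(C / psX p C y) by ring]
  generalize (psX p C y - C) ^ (1 - 1/p) = a
  generalize psX p C y ^ (1/p - 1) = b
  have hC0 := hC.ne'
  field_simp
  ring

theorem psi_E_anti (hp : 2 < p) (hC : 0 < C) {y z : ℝ} (hy : 0 < y) (hyz : y ≤ z) :
    psi' p C z + psi p C z ^ p ≤ psi' p C y + psi p C y ^ p := by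
  have hz : 0 < z := by linarith
  have hX := psX_pos hp hC.le hy
  have hZ := psX_pos hp hC.le hz
  rw [psi_E hp hC hy, psi_E hp hC hz]
  refine mul_le_mul_of_nonneg_left ?_ hC.le
  have h1p : 1/p ≤ 1 := by rw [div_le_one] <;> linarith
  have m : ∀ w, C < w → 1 - C / w ∈ Ici (0:ℝ) := fun w hw => by
    have : C / w ≤ 1 := by rw [div_le_one] <;> linarith
    simp only [mem_Ici]; linarith
  have n : ∀ w, C < w → 1 - C / w ≠ 1 := fun w hw => by
    have : 0 < C / w := div_pos hC (by linarith)
    linarith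
  refine (convexOn_rpow (p := 2 - 1/p) (by linarith)).secant_mono (a := 1) (by simp) (m _ hZ) (m _ hX) (n _ hZ) (n _ hX) ?_
  have : C / psX p C y ≤ C / psX p C z := div_le_div_of_nonneg_left hC.le (by linarith) (psi_anti hp hC.le hy hyz)
  linarith

theorem psi_prim (hp : 2 < p) (hC : 0 ≤ C) {ε : ℝ} (hε : 0 < ε) :
    ∃ Ψ : ℝ → ℝ, ∀ y, ε ≤ y → HasDerivAt Ψ (psi p C y) y := by
  have hc : Continuous (fun s => psi p C (max s ε)) := by
    rw [continuous_iff_continuousAt]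
    intro s
    have h : ContinuousAt (psi p C) (max s ε) :=
      (psi_deriv hp hC (lt_of_lt_of_le hε (le_max_right s ε))).continuousAt
    exact ContinuousAt.comp (f := fun s => max s ε) (x := s) h (by fun_prop)
  refine ⟨fun y => ∫ s in (0:ℝ)..y, psi p C (max s ε), fun y hy => ?_⟩
  have := (hc.integral_hasStrictDerivAt 0 y).hasDerivAt
  rwa [max_eq_left hy] at this

theorem dbl (hp : 2 < p) (hs : ClassicalSolution p L T u) {r t0 t1 ε C lam : ℝ}
    (hε : 0 < ε) (hrL : r < L) (ht0 : 0 < t0) (ht1 : t1 < T)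
    (hC : 0 < C) (hlam : 0 < lam) {Ψ : ℝ → ℝ} (hΨ : ∀ y, ε ≤ y → HasDerivAt Ψ (psi p C y) y)
    (side : ∀ x y t, |x| ≤ r → y ∈ Icc ε r → t ∈ Icc t0 t1 → (|x| = r ∨ y = r ∨ t = t0) →
      pdy u x y t < psi p C y)
    (eps : ∀ x t, |x| ≤ r → t ∈ Icc t0 t1 → pdy u x ε t < psi p C ε) :
    ∀ x y1 y2 t, |x| ≤ r → ε ≤ y2 → y2 ≤ y1 → y1 ≤ r → t ∈ Icc t0 t1 →
      u x y1 t - u x y2 t ≤ Ψ y1 - Ψ y2 + lam * (t - t0) := by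
  have om : ∀ x y t, |x| ≤ r → ε ≤ y → y ≤ r → t ∈ Icc t0 t1 → ((x, y), t) ∈ Om L T := by
    intro x y t hx h1 h2 ht
    exact ⟨by simp; linarith, ⟨by simp; linarith, by simp; linarith⟩, by simp; linarith [ht.1], by simp; linarith [ht.2]⟩
  set K : Set (ℝ × ℝ × ℝ × ℝ) := {z | |z.1| ≤ r ∧ ε ≤ z.2.2.1 ∧ z.2.2.1 ≤ z.2.1 ∧ z.2.1 ≤ r ∧ t0 ≤ z.2.2.2 ∧ z.2.2.2 ≤ t1} with hK
  have hKc : IsCompact K := by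
    have hb : IsCompact (Icc (-r) r ×ˢ (Icc ε r ×ˢ (Icc ε r ×ˢ Icc t0 t1))) :=
      isCompact_Icc.prod (isCompact_Icc.prod (isCompact_Icc.prod isCompact_Icc))
    refine hb.of_isClosed_subset ?_ ?_
    · have c1 : IsClosed {z : ℝ × ℝ × ℝ × ℝ | |z.1| ≤ r} := isClosed_le (by fun_prop) (by fun_prop)
      have c2 : IsClosed {z : ℝ × ℝ × ℝ × ℝ | ε ≤ z.2.2.1} := isClosed_le (by fun_prop) (by fun_prop)
      have c3 : IsClosed {z : ℝ × ℝ × ℝ × ℝ | z.2.2.1 ≤ z.2.1} := isClosed_le (by fun_prop) (by fun_prop)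
      have c4 : IsClosed {z : ℝ × ℝ × ℝ × ℝ | z.2.1 ≤ r} := isClosed_le (by fun_prop) (by fun_prop)
      have c5 : IsClosed {z : ℝ × ℝ × ℝ × ℝ | t0 ≤ z.2.2.2} := isClosed_le (by fun_prop) (by fun_prop)
      have c6 : IsClosed {z : ℝ × ℝ × ℝ × ℝ | z.2.2.2 ≤ t1} := isClosed_le (by fun_prop) (by fun_prop)
      exact c1.inter (c2.inter (c3.inter (c4.inter (c5.inter c6))))
    · rintro ⟨x, y1, y2, t⟩ ⟨h1, h2, h3, h4, h5, h6⟩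
      simp only at h1 h2 h3 h4 h5 h6
      exact ⟨abs_le.1 h1, ⟨by simp; linarith, by simp; linarith⟩, ⟨by simp; linarith, by simp; linarith⟩, h5, h6⟩
  set Φ : ℝ × ℝ × ℝ × ℝ → ℝ := fun z => u z.1 z.2.1 z.2.2.2 - u z.1 z.2.2.1 z.2.2.2
    - (Ψ z.2.1 - Ψ z.2.2.1) - lam * (z.2.2.2 - t0) with hΦ
  have hcont : ContinuousOn Φ K := by
    rintro ⟨x, y1, y2, t⟩ ⟨h1, h2, h3, h4, h5, h6⟩
    simp only at h1 h2 h3 h4 h5 h6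
    refine ContinuousAt.continuousWithinAt ?_
    have c1 := (sol_C21 hs (om x y1 t h1 (by linarith) h4 ⟨h5, h6⟩)).2.2.2.2.2.2.1
    have c2 := (sol_C21 hs (om x y2 t h1 h2 (by linarith) ⟨h5, h6⟩)).2.2.2.2.2.2.1
    have d1 : ContinuousAt (fun z : ℝ × ℝ × ℝ × ℝ => u z.1 z.2.1 z.2.2.2) (x, y1, y2, t) :=
      ContinuousAt.comp (f := fun z : ℝ × ℝ × ℝ × ℝ => (z.1, z.2.1, z.2.2.2)) (x := (x, y1, y2, t)) c1 (by fun_prop)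
    have d2 : ContinuousAt (fun z : ℝ × ℝ × ℝ × ℝ => u z.1 z.2.2.1 z.2.2.2) (x, y1, y2, t) :=
      ContinuousAt.comp (f := fun z : ℝ × ℝ × ℝ × ℝ => (z.1, z.2.2.1, z.2.2.2)) (x := (x, y1, y2, t)) c2 (by fun_prop)
    have d3 : ContinuousAt (fun z : ℝ × ℝ × ℝ × ℝ => Ψ z.2.1) (x, y1, y2, t) :=
      ContinuousAt.comp (f := fun z : ℝ × ℝ × ℝ × ℝ => z.2.1) (x := (x, y1, y2, t)) (hΨ y1 (by linarith)).continuousAt (by fun_prop)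
    have d4 : ContinuousAt (fun z : ℝ × ℝ × ℝ × ℝ => Ψ z.2.2.1) (x, y1, y2, t) :=
      ContinuousAt.comp (f := fun z : ℝ × ℝ × ℝ × ℝ => z.2.2.1) (x := (x, y1, y2, t)) (hΨ y2 (by linarith)).continuousAt (by fun_prop)
    exact ((d1.sub d2).sub (d3.sub d4)).sub (by fun_prop)
  intro x y1 y2 t hx hy2 hy hy1 ht
  have hne : K.Nonempty := ⟨(x, y1, y2, t), hx, hy2, hy, hy1, ht.1, ht.2⟩
  obtain ⟨⟨X, Y, Z, S⟩, hz, hmax⟩ := hKc.exists_isMaxOn hne hcont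
  suffices hle : Φ (X, Y, Z, S) ≤ 0 by
    have := (hmax (show (x, y1, y2, t) ∈ K from ⟨hx, hy2, hy, hy1, ht.1, ht.2⟩)).trans hle
    simp only [hΦ] at this; linarith
  clear hne x y1 y2 t hx hy2 hy hy1 ht
  by_contra hpos
  push Not at hpos
  obtain ⟨hX, hZ, hZY, hY, hS0, hS1⟩ := hz
  simp only at hX hZ hZY hY hS0 hS1
  have mx : ∀ x y z s, |x| ≤ r → ε ≤ z → z ≤ y → y ≤ r → t0 ≤ s → s ≤ t1 → Φ (x,y,z,s) ≤ Φ (X,Y,Z,S) :=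
    fun x y z s h1 h2 h3 h4 h5 h6 => hmax (show (x, y, z, s) ∈ K from ⟨h1, h2, h3, h4, h5, h6⟩)
  -- derivative in y
  have dy : ∀ y, ε ≤ y → y ≤ r → HasDerivAt (fun s => u X s S - Ψ s) (pdy u X y S - psi p C y) y :=
    fun y h1 h2 => (sol_C21 hs (om X y S hX h1 h2 ⟨hS0, hS1⟩)).2.1.hasDerivAt.sub (hΨ y h1)
  have hlt : Z < Y := by
    rcases hZY.lt_or_eq with h | h
    · exact h
    · exfalso
      have : 0 ≤ lam * (S - t0) := mul_nonneg hlam.le (by linarith)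
      simp only [hΦ, h] at hpos; linarith
  have inner : |X| ≠ r ∧ S ≠ t0 := by
    by_contra hcon
    have hcon : |X| = r ∨ S = t0 := by tauto
    have : AntitoneOn (fun s => u X s S - Ψ s) (Icc Z Y) := by
      refine antitoneOn_of_deriv_nonpos (convex_Icc _ _) ?_ ?_ ?_
      · intro y hy
        exact (dy y (by linarith [hy.1]) (by linarith [hy.2])).continuousAt.continuousWithinAt
      · intro y hy
        rw [interior_Icc] at hy
        exact (dy y (by linarith [hy.1]) (by linarith [hy.2])).differentiableAt.differentiableWithinAt
      · intro y hy
        rw [interior_Icc] at hy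
        rw [(dy y (by linarith [hy.1]) (by linarith [hy.2])).deriv]
        have := side X y S hX ⟨by linarith [hy.1], by linarith [hy.2]⟩ ⟨hS0, hS1⟩ (by tauto)
        linarith
    have h2 := this (left_mem_Icc.2 hZY) (right_mem_Icc.2 hZY) hZY
    have : 0 ≤ lam * (S - t0) := mul_nonneg hlam.le (by linarith)
    simp only [hΦ] at hpos h2; linarith
  have hXr : |X| < r := lt_of_le_of_ne hX inner.1
  have hSt : t0 < S := lt_of_le_of_ne hS0 (Ne.symm inner.2)
  have hYr : Y < r := by
    refine lt_of_le_of_ne hY fun h => ?_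
    have h1 : 0 ≤ pdy u X Y S - psi p C Y := by
      refine left_max (f := fun s => u X s S - Ψ s) hlt ?_ (dy Y (by linarith) hY)
      intro s hs
      have := mx X s Z S hX hZ hs.1 (by linarith [hs.2]) hS0 hS1
      simp only [hΦ] at this ⊢; linarith
    have := side X Y S hX ⟨by linarith, hY⟩ ⟨hS0, hS1⟩ (by tauto)
    linarith
  have hZe : ε < Z := by
    refine lt_of_le_of_ne hZ fun h => ?_
    have h1 : -(pdy u X Z S - psi p C Z) ≤ 0 := by
      refine right_max (f := fun s => -(u X s S - Ψ s)) hlt ?_ (dy Z hZ (by linarith)).neg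
      intro s hs
      have := mx X Y s S hX (by linarith [hs.1]) hs.2 hY hS0 hS1
      simp only [hΦ] at this ⊢; linarith
    have := eps X S hX ⟨hS0, hS1⟩
    rw [h] at this
    linarith
  have cY := sol_C21 hs (om X Y S hX (by linarith) hY ⟨hS0, hS1⟩)
  have cZ := sol_C21 hs (om X Z S hX hZ (by linarith) ⟨hS0, hS1⟩)
  have gy : ∀ y, ε ≤ y → y ≤ r → HasDerivAt (fun s => pdy u X s S - psi p C s) (pdyy u X y S - psi' p C y) y :=
    fun y h1 h2 => (sol_C21 hs (om X y S hX h1 h2 ⟨hS0, hS1⟩)).2.2.2.2.1.hasDerivAt.sub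
      (psi_deriv hp hC.le (by linarith))
  have A1 := max_snd (f := fun s => u X s S - Ψ s) (f' := fun s => pdy u X s S - psi p C s) (x := Y)
    (by
      filter_upwards [Ioo_mem_nhds hlt hYr] with s hs
      have := mx X s Z S hX hZ hs.1.le hs.2.le hS0 hS1
      simp only [hΦ] at this ⊢; linarith)
    (by
      filter_upwards [Ioo_mem_nhds hlt hYr] with s hs
      exact dy s (by linarith [hs.1]) hs.2.le) (gy Y (by linarith) hY)
  have A2 := max_snd (f := fun s => -(u X s S - Ψ s)) (f' := fun s => -(pdy u X s S - psi p C s)) (x := Z)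
    (by
      filter_upwards [Ioo_mem_nhds hZe hlt] with s hs
      have := mx X Y s S hX hs.1.le hs.2.le hY hS0 hS1
      simp only [hΦ] at this ⊢; linarith)
    (by
      filter_upwards [Ioo_mem_nhds hZe hlt] with s hs
      exact (dy s (by linarith [hs.1]) (by linarith [hs.2])).neg) (gy Z (by linarith) (by linarith)).neg
  have hXn : ∀ᶠ s in nhds X, |s| < r := (isOpen_lt continuous_abs continuous_const).mem_nhds hXr
  have A3 := max_snd (f := fun s => u s Y S - u s Z S) (f' := fun s => pdx u s Y S - pdx u s Z S) (x := X)
    (by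
      filter_upwards [hXn] with s hs
      have := mx s Y Z S hs.le hZ hZY hY hS0 hS1
      simp only [hΦ] at this ⊢; linarith)
    (by
      filter_upwards [hXn] with s h
      exact (sol_C21 hs (om s Y S h.le (by linarith) hY ⟨hS0, hS1⟩)).1.hasDerivAt.sub
        (sol_C21 hs (om s Z S h.le hZ (by linarith) ⟨hS0, hS1⟩)).1.hasDerivAt)
    (cY.2.2.2.1.hasDerivAt.sub cZ.2.2.2.1.hasDerivAt)
  have A4 : 0 ≤ pdt u X Y S - pdt u X Z S - lam * 1 := by
    refine left_max (f := fun s => u X Y s - u X Z s - lam * (s - t0)) hSt ?_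
      ((cY.2.2.1.hasDerivAt.sub cZ.2.2.1.hasDerivAt).sub (((hasDerivAt_id S).sub_const t0).const_mul lam))
    intro s hs
    have := mx X Y Z s hX hZ hZY hY hs.1 (by linarith [hs.2])
    simp only [hΦ] at this ⊢; linarith
  have P1 := hs.pde (x := X) (y := Y) (t := S) (by linarith) ⟨by linarith, by linarith⟩ ⟨by linarith, by linarith⟩
  have P2 := hs.pde (x := X) (y := Z) (t := S) (by linarith) ⟨by linarith, by linarith⟩ ⟨by linarith, by linarith⟩
  rw [gradpow] at P1 P2
  have hψ : psi p C Y ≤ psi p C Z := by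
    unfold psi
    have hX := psX_pos hp hC.le (y := Y) (by linarith)
    exact Real.rpow_le_rpow (by linarith) (psi_anti hp hC.le (by linarith) hZY) (by positivity)
  have hψ0 : 0 ≤ psi p C Y := Real.rpow_nonneg (by linarith [psX_pos hp hC.le (y := Y) (by linarith)]) _
  have e1 : pdy u X Y S = psi p C Y := by linarith [A1.1]
  have e2 : pdy u X Z S = psi p C Z := by linarith [A2.1]
  have e3 : pdx u X Z S = pdx u X Y S := by linarith [A3.1]
  rw [e1] at P1; rw [e2, e3] at P2
  have hE := psi_E_anti hp hC (y := Z) (z := Y) (by linarith) hZY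
  have sq : ∀ a : ℝ, 0 ≤ a → (a ^ 2) ^ (p / 2) = a ^ p := fun a ha => by
    rw [← Real.rpow_natCast, ← Real.rpow_mul ha]; congr 1; push_cast; ring
  have hsup := pow_super (a := pdx u X Y S ^ 2) (b := psi p C Y ^ 2) (c := psi p C Z ^ 2) (s := p / 2)
    (by linarith) (by positivity) (by positivity) (by gcongr)
  rw [sq _ hψ0, sq _ (hψ0.trans hψ)] at hsup
  have A32 : pdxx u X Y S - pdxx u X Z S ≤ 0 := A3.2
  linarith [A1.2, A2.2]

theorem psi_inf (hp : 2 < p) (hC : 0 ≤ C) : Tendsto (psi p C) (nhdsWithin 0 (Ioi 0)) atTop := by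
  have hp1 : 0 < p - 1 := by linarith
  have h1 : Tendsto (fun y : ℝ => 1/(p-1)/y) (nhdsWithin 0 (Ioi 0)) atTop := by
    simp only [div_eq_mul_inv]
    exact tendsto_inv_nhdsGT_zero.const_mul_atTop (by positivity)
  have h2 := tendsto_atTop_add_const_right _ C ((tendsto_rpow_atTop (show 0 < p/(p-1) by positivity)).comp h1)
  exact (tendsto_rpow_atTop (show 0 < 1/p by positivity)).comp h2

theorem pdy_le (x y t : ℝ) : pdy u x y t ≤ gradNorm u x y t := by
  unfold gradNorm
  refine (le_abs_self _).trans ?_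
  rw [← Real.sqrt_sq_eq_abs]
  exact Real.sqrt_le_sqrt (by nlinarith [sq_nonneg (pdx u x y t)])

theorem grad_bd (hp : 2 < p) (hL : 0 < L) (hT : 0 < T) (hs : ClassicalSolution p L T u)
    (hg : IsolatedGBU L T u) :
    ∃ C > 0, ∀ x y t, |x| ≤ L/2 → y ∈ Ioo 0 (L/2) → t ∈ Ico (T/2) T → pdy u x y t ≤ psi p C y := by
  obtain ⟨M1, hM1⟩ := hg.bounded (({-(L/2), L/2} ×ˢ Icc 0 (L/2)) ∪ (Icc (-(L/2)) (L/2) ×ˢ {L/2}))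
    (((Set.toFinite _).isCompact.prod isCompact_Icc).union (isCompact_Icc.prod isCompact_singleton)) (by
      rintro ⟨x, y⟩ (⟨h1, h2⟩ | ⟨h1, h2⟩)
      · simp only [mem_insert_iff, mem_singleton_iff, mem_Icc] at h1 h2
        refine ⟨⟨?_, by simp; constructor <;> linarith⟩, ?_⟩
        · rcases h1 with h | h <;> rw [h] <;> constructor <;> linarith
        · simp only [mem_singleton_iff, Prod.mk.injEq, not_and]
          intro h; rcases h1 with h1 | h1 <;> linarith
      · simp only [mem_singleton_iff, mem_Icc] at h1 h2
        refine ⟨⟨by simp; constructor <;> linarith, by simp; constructor <;> linarith⟩, ?_⟩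
        simp only [mem_singleton_iff, Prod.mk.injEq, not_and]
        intro _; linarith)
  have hbox : ∀ t1 < T, ∃ M, ∀ x y t, |x| ≤ L/2 → y ∈ Icc 0 (L/2) → t ∈ Icc (T/2) t1 → pdy u x y t ≤ M := by
    intro t1 ht1
    have hK : IsCompact (Icc (-(L/2)) (L/2) ×ˢ (Icc 0 (L/2) ×ˢ Icc (T/2) t1)) :=
      isCompact_Icc.prod (isCompact_Icc.prod isCompact_Icc)
    have hc : ContinuousOn (fun q : ℝ × ℝ × ℝ => pdy u q.1 q.2.1 q.2.2) (Icc (-(L/2)) (L/2) ×ˢ (Icc 0 (L/2) ×ˢ Icc (T/2) t1)) := by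
      rintro ⟨x, y, t⟩ ⟨h1, h2, h3⟩
      simp only [mem_Icc] at h1 h2 h3
      have := hs.smooth (x := x) (y := y) (t := t) (abs_le.2 ⟨by linarith, by linarith⟩) ⟨h2.1, by linarith⟩ ⟨by linarith, by linarith⟩
      exact this.2.2.2.2.2.2.2.2.1.continuousWithinAt
    obtain ⟨M, hM⟩ := hK.bddAbove_image hc
    exact ⟨M, fun x y t h1 h2 h3 => hM ⟨(x, y, t), ⟨abs_le.1 h1, h2, h3⟩, rfl⟩⟩
  obtain ⟨M2, hM2⟩ := hbox (T/2) (by linarith)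
  set M := max (max M1 M2) 0 + 1 with hM
  have hM0 : 0 < M := by have := le_max_right (max M1 M2) 0; linarith
  have h1M : M1 < M := by have := (le_max_left M1 M2).trans (le_max_left (max M1 M2) 0); linarith
  have h2M : M2 < M := by have := (le_max_right M1 M2).trans (le_max_left (max M1 M2) 0); linarith
  have hC : 0 < M ^ p := by positivity
  refine ⟨M ^ p, hC, ?_⟩
  intro x y t hx hy ht
  have hψM : ∀ z, 0 < z → M ≤ psi p (M^p) z := by
    intro z hz
    have h1 := psX_pos hp hC.le hz
    have : (M ^ p) ^ (1/p) ≤ psi p (M^p) z := Real.rpow_le_rpow hC.le h1.le (by positivity)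
    rwa [← Real.rpow_mul hM0.le, mul_one_div_cancel (by linarith), Real.rpow_one] at this
  obtain ⟨M3, hM3⟩ := hbox t ht.2
  obtain ⟨ε, hε1, hε2⟩ := (((psi_inf hp hC.le).eventually (eventually_gt_atTop M3)).and (Ioo_mem_nhdsGT hy.1)).exists
  obtain ⟨Ψ, hΨ⟩ := psi_prim hp hC.le hε2.1
  have side : ∀ x y t', |x| ≤ L/2 → y ∈ Icc ε (L/2) → t' ∈ Icc (T/2) t → (|x| = L/2 ∨ y = L/2 ∨ t' = T/2) →
      pdy u x y t' < psi p (M^p) y := by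
    intro x y t' h1 h2 h3 h4
    have hψ := hψM y (by linarith [h2.1, hε2.1])
    have ht' : t' ∈ Ioo 0 T := ⟨by linarith [h3.1], by linarith [h3.2, ht.2]⟩
    have hy0 : 0 ≤ y := by linarith [h2.1, hε2.1]
    rcases h4 with h | h | h
    · have := hM1 (x, y) (Or.inl ⟨by
        rcases abs_choice x with h' | h' <;> rw [h'] at h
        · simp [h]
        · simp only [mem_insert_iff, mem_singleton_iff]; left; linarith, hy0, h2.2⟩) t' ht'
      linarith [pdy_le (u := u) x y t']
    · have := hM1 (x, y) (Or.inr ⟨abs_le.1 h1, h⟩) t' ht'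
      linarith [pdy_le (u := u) x y t']
    · have := hM2 x y t' h1 ⟨hy0, h2.2⟩ (by rw [h]; simp)
      linarith
  have hd : ∀ lam > 0, ∀ s ∈ Icc y (L/2), u x s t - u x y t ≤ Ψ s - Ψ y + lam * (t - T/2) := by
    intro lam hlam s hs'
    exact dbl hp hs hε2.1 (r := L/2) (t0 := T/2) (t1 := t) (by linarith) (by linarith) ht.2 hC hlam hΨ side
      (fun x t' h1 h2 => (hM3 x ε t' h1 ⟨hε2.1.le, by linarith [hε2.2, hy.2]⟩ h2).trans_lt hε1)
      x s y t hx hε2.2.le hs'.1 hs'.2 ⟨ht.1, le_rfl⟩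
  have hf : HasDerivAt (fun s => u x s t - Ψ s) (pdy u x y t - psi p (M^p) y) y :=
    (hs.smooth (x := x) (y := y) (t := t) (by linarith) ⟨hy.1.le, by linarith [hy.2]⟩
      ⟨by linarith [ht.1], ht.2⟩).2.1.hasDerivAt.sub (hΨ y hε2.2.le)
  have := right_max hy.2 (fun s hs' => ?_) hf
  · linarith
  · have h0 : u x s t - u x y t ≤ Ψ s - Ψ y := by
      refine le_of_forall_pos_le_add fun e he => ?_
      have hpos : 0 ≤ t - T/2 := by linarith [ht.1]
      have h1 := hd (e / (t - T/2 + 1)) (by positivity) s hs'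
      have h2 : e / (t - T/2 + 1) * (t - T/2) ≤ e := by
        rw [div_mul_eq_mul_div, div_le_iff₀ (by linarith)]; nlinarith
      linarith
    linarith

def Af (p K y : ℝ) : ℝ := (1/(p-1)) ^ (1/(p-1)) * y ^ (-(1/(p-1))) * (1 + K * y ^ (1 + 1/(p-1)))

theorem psi_le_Af (hp : 2 < p) (hC : 0 ≤ C) {y : ℝ} (hy : 0 < y) :
    psi p C y ≤ Af p (C * (p-1) ^ (p/(p-1))) y := by
  have hp1 : 0 < p - 1 := by linarith
  have e1 : (1:ℝ) + 1/(p-1) = p/(p-1) := by field_simp; ring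
  have hX : psX p C y = (1/(p-1)/y) ^ (p/(p-1)) * (1 + C * (p-1)^(p/(p-1)) * y ^ (p/(p-1))) := by
    unfold psX
    have : (1/(p-1)/y) ^ (p/(p-1)) * ((p-1)^(p/(p-1)) * y ^ (p/(p-1))) = 1 := by
      rw [← Real.mul_rpow hp1.le hy.le, ← Real.mul_rpow (by positivity) (by positivity)]
      rw [show 1/(p-1)/y * ((p-1)*y) = 1 by field_simp, Real.one_rpow]
    linear_combination -C * this
  unfold psi Af
  rw [hX, Real.mul_rpow (by positivity) (by positivity), e1, ← Real.rpow_mul (by positivity)]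
  have e2 : p/(p-1) * (1/p) = 1/(p-1) := by field_simp
  rw [e2, Real.div_rpow (by positivity) hy.le, Real.rpow_neg hy.le, div_eq_mul_inv]
  refine mul_le_mul_of_nonneg_left ?_ (by positivity)
  have h1 : (1:ℝ) ≤ 1 + C * (p-1)^(p/(p-1)) * y ^ (p/(p-1)) := by
    have : 0 ≤ C * (p-1)^(p/(p-1)) * y ^ (p/(p-1)) := by positivity
    linarith
  calc _ ≤ (1 + C * (p-1)^(p/(p-1)) * y ^ (p/(p-1))) ^ (1:ℝ) :=
        Real.rpow_le_rpow_of_exponent_le h1 (by rw [div_le_one] <;> linarith)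
    _ = _ := Real.rpow_one _

theorem A_bd (hp : 2 < p) (hL : 0 < L) (hT : 0 < T) (hs : ClassicalSolution p L T u)
    (hg : IsolatedGBU L T u) :
    ∃ K ≥ 0, ∀ x y t, |x| ≤ L/2 → y ∈ Ioo 0 (L/2) → t ∈ Ico (T/2) T →
      pdy u x y t ≤ Af p K y ∧ u x y t ≤ Af p K y * y / (1 - 1/(p-1)) := by
  obtain ⟨C, hC, h⟩ := grad_bd hp hL hT hs hg
  have hp1 : 0 < p - 1 := by linarith
  set K := C * (p-1) ^ (p/(p-1)) with hK
  have hK0 : 0 ≤ K := by positivity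
  refine ⟨K, hK0, fun x y t hx hy ht => ?_⟩
  have hA : ∀ z ∈ Ioo 0 (L/2), pdy u x z t ≤ Af p K z := fun z hz =>
    (h x z t hx hz ht).trans (psi_le_Af hp hC.le hz.1)
  refine ⟨hA y hy, ?_⟩
  set b := 1/(p-1) with hb
  have hb1 : b < 1 := by rw [hb, div_lt_one] <;> linarith
  have hb0 : 0 < b := by positivity
  have hG : ∀ z, 0 < z → HasDerivAt (fun z : ℝ => b ^ b * (z ^ (1-b) / (1-b) + K * z ^ 2 / 2)) (Af p K z) z := by
    intro z hz
    have h1 := (Real.hasDerivAt_rpow_const (x := z) (p := 1-b) (Or.inl hz.ne')).div_const (1-b)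
    have h2 := ((hasDerivAt_pow 2 z).const_mul K).div_const 2
    refine ((h1.add h2).const_mul (b^b)).congr_deriv ?_
    unfold Af
    rw [← hb]
    have e : z ^ (-b) * z ^ (1+b) = z := by rw [← Real.rpow_add hz]; simp
    rw [show 1 - b - 1 = -b by ring]
    have : (1 - b) ≠ 0 := by linarith
    field_simp
    push_cast
    linear_combination -2 * K * e
  have hd : ∀ z ∈ Icc 0 y, HasDerivAt (fun s => u x s t) (pdy u x z t) z := fun z hz =>
    (hs.smooth (x := x) (y := z) (t := t) (by linarith) ⟨hz.1, by linarith [hz.2, hy.2]⟩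
      ⟨by linarith [ht.1], ht.2⟩).2.1.hasDerivAt
  have anti : AntitoneOn (fun z => u x z t - b ^ b * (z ^ (1-b) / (1-b) + K * z ^ 2 / 2)) (Icc 0 y) := by
    refine antitoneOn_of_deriv_nonpos (convex_Icc _ _) ?_ ?_ ?_
    · refine ContinuousOn.sub (fun z hz => (hd z hz).continuousAt.continuousWithinAt) ?_
      have : Continuous fun z : ℝ => z ^ (1-b) := Real.continuous_rpow_const (by linarith)
      fun_prop
    · intro z hz
      rw [interior_Icc] at hz
      exact ((hd z ⟨hz.1.le, hz.2.le⟩).sub (hG z hz.1)).differentiableAt.differentiableWithinAt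
    · intro z hz
      rw [interior_Icc] at hz
      have := ((hd z ⟨hz.1.le, hz.2.le⟩).sub (hG z hz.1)).deriv
      simp only [Pi.sub_def] at this
      rw [this]
      linarith [hA z ⟨hz.1, by linarith [hz.2, hy.2]⟩]
  have h0 := anti (left_mem_Icc.2 hy.1.le) (right_mem_Icc.2 hy.1.le) hy.1.le
  simp only [hs.bc (x := x) (t := t) (by linarith) ⟨by linarith [ht.1], ht.2⟩,
    Real.zero_rpow (show 1 - b ≠ 0 by linarith)] at h0
  norm_num at h0
  refine h0.trans ?_
  unfold Af
  rw [← hb, le_div_iff₀ (by linarith)]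
  have e : y ^ (-b) * y ^ (1+b) = y := by rw [← Real.rpow_add hy.1]; simp
  have e' : y ^ (1-b) = y ^ (-b) * y := by rw [← Real.rpow_add_one hy.1.ne']; congr 1; ring
  rw [e']
  have hbb : 0 < b ^ b := by positivity
  have h1b : 1 - b ≠ 0 := by linarith
  have : b ^ b * y ^ (-b) * (1 + K * y ^ (1+b)) * y - b ^ b * (y ^ (-b) * y / (1-b) + K * y^2/2) * (1-b)
      = b ^ b * (K * y^2 * (1 - (1-b)/2)) := by
    field_simp
    linear_combination 2 * K * y * e
  have : 0 ≤ b ^ b * (K * y^2 * (1 - (1-b)/2)) := by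
    refine mul_nonneg hbb.le (mul_nonneg (by positivity) (by linarith))
  linarith

theorem mul_zero_deriv {f g : ℝ → ℝ} {x g' : ℝ} (hf : ContinuousAt f x) (hg : HasDerivAt g g' x)
    (h0 : g x = 0) : HasDerivAt (fun s => f s * g s) (f x * g') x := by
  rw [hasDerivAt_iff_tendsto_slope] at hg ⊢
  have h1 : Tendsto f (nhdsWithin x {x}ᶜ) (nhds (f x)) := hf.tendsto.mono_left nhdsWithin_le_nhds
  refine (h1.mul hg).congr' ?_
  filter_upwards with s
  simp only [slope_def_field, h0]
  ring

/-- derivative of `f^q` when `q > 1`, and of its derivative, for `f ≥ 0` -/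
theorem snd_pow {f f' : ℝ → ℝ} {x f'' q : ℝ} (hq : 1 < q) (hf : HasDerivAt f (f' x) x)
    (hf' : HasDerivAt f' f'' x) (h0 : f x = 0 → f' x = 0) :
    HasDerivAt (fun s => f s ^ (q-1) * f' s) ((q-1) * f x ^ (q-2) * f' x ^ 2 + f x ^ (q-1) * f'') x := by
  by_cases h : f x = 0
  · have hc : ContinuousAt (fun s => f s ^ (q-1)) x := hf.continuousAt.rpow_const (Or.inr (by linarith))
    refine (mul_zero_deriv hc hf' (h0 h)).congr_deriv ?_
    rw [h0 h]; ring
  · refine ((hf.rpow_const (p := q-1) (Or.inl h)).mul hf').congr_deriv ?_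
    rw [show q - 1 - 1 = q - 2 by ring]; ring

def dd0 (g y : ℝ) : ℝ := y ^ (-g) * (1 + y)
def dd1 (g y : ℝ) : ℝ := -g * y ^ (-g-1) * (1 + y) + y ^ (-g)
def dd2 (g y : ℝ) : ℝ := g * (g+1) * y ^ (-g-2) * (1 + y) - 2 * g * y ^ (-g-1)

theorem dd0_deriv {g y : ℝ} (hy : 0 < y) : HasDerivAt (dd0 g) (dd1 g y) y := by
  have h1 := Real.hasDerivAt_rpow_const (x := y) (p := -g) (Or.inl hy.ne')
  refine (h1.mul ((hasDerivAt_id y).const_add 1)).congr_deriv ?_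
  unfold dd1; simp

theorem dd1_deriv {g y : ℝ} (hy : 0 < y) : HasDerivAt (dd1 g) (dd2 g y) y := by
  have h1 := Real.hasDerivAt_rpow_const (x := y) (p := -g) (Or.inl hy.ne')
  have h2 := Real.hasDerivAt_rpow_const (x := y) (p := -g-1) (Or.inl hy.ne')
  refine (((h2.const_mul (-g)).mul ((hasDerivAt_id y).const_add 1)).add h1).congr_deriv ?_
  unfold dd2; simp only [id]; rw [show -g-1-1 = -g-2 by ring]; ring

theorem PJ_id (hp : 2 < p) (hp3 : p ≤ 3) (hq : 1 < q) (hs : ClassicalSolution p L T u) {x y t : ℝ}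
    (hX : ((x, y), t) ∈ Om L T) {g : ℝ} (hg : g = q * (1 - 1/(p-1))) :
    (u x y t = 0 → gradNorm u x y t = 0) ∧
    PJ p q k u x y t = k * x * (
      dd0 g y * (q * u x y t ^ (q-1)) * gradNorm u x y t ^ p * (1 - p)
      - dd0 g y * (q * (q-1) * u x y t ^ (q-2)) * gradNorm u x y t ^ 2
      - dd2 g y * u x y t ^ q - 2 * dd1 g y * (q * u x y t ^ (q-1)) * pdy u x y t
      - p * gradNorm u x y t ^ (p-2) * dd1 g y * u x y t ^ q * pdy u x y t
      + 2 * k * dd0 g y ^ 2 * u x y t ^ q * (q * u x y t ^ (q-1))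
      + p * gradNorm u x y t ^ (p-2) * k * dd0 g y ^ 2 * (u x y t ^ q) ^ 2) := by
  have hop := Om_open L T
  have cc : ∀ {x y t : ℝ}, ((x, y), t) ∈ Om L T → C21At u x y t := fun h => sol_C21 hs h
  have hxn : ∀ᶠ s in nhds x, ((s, y), t) ∈ Om L T :=
    (Continuous.tendsto (by fun_prop : Continuous fun s : ℝ => ((s, y), t)) x).eventually (hop.mem_nhds hX)
  have hyn : ∀ᶠ s in nhds y, ((x, s), t) ∈ Om L T :=
    (Continuous.tendsto (by fun_prop : Continuous fun s : ℝ => ((x, s), t)) y).eventually (hop.mem_nhds hX)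
  have nn : ∀ {x y t : ℝ}, ((x, y), t) ∈ Om L T → 0 ≤ u x y t := fun h =>
    hs.nonneg h.1.le ⟨h.2.1.1.le, h.2.1.2.le⟩ h.2.2
  have zx : u x y t = 0 → pdx u x y t = 0 := fun h0 => by
    refine IsLocalMin.deriv_eq_zero (f := fun s => u s y t) ?_
    filter_upwards [hxn] with s hs'
    rw [h0]; exact nn hs'
  have zy : u x y t = 0 → pdy u x y t = 0 := fun h0 => by
    refine IsLocalMin.deriv_eq_zero (f := fun s => u x s t) ?_
    filter_upwards [hyn] with s hs'
    rw [h0]; exact nn hs'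
  refine ⟨fun h => by unfold gradNorm; rw [zx h, zy h]; simp, ?_⟩
  have hJ : Jfun p q k u = fun x y t => pdx u x y t + k * x * dd0 g y * u x y t ^ q := by
    funext x y t; unfold Jfun dd0; rw [← hg]; ring
  obtain ⟨vxx, vyy, h1, h2, h3⟩ := reg hp hp3 hs hX
  have hpw : ∀ {f : ℝ → ℝ} {f' s : ℝ}, HasDerivAt f f' s → HasDerivAt (fun s => f s ^ q) (q * f s ^ (q-1) * f') s := by
    intro f f' s hf
    exact (hf.rpow_const (p := q) (Or.inr hq.le)).congr_deriv (by ring)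
  have Jt : pdt (Jfun p q k u) x y t = vxx + vyy + gg p u x y t + k * x * dd0 g y * (q * u x y t ^ (q-1) * pdt u x y t) := by
    rw [hJ]
    exact (h3.add ((hpw (cc hX).2.2.1.hasDerivAt).const_mul (k * x * dd0 g y))).deriv
  have Jx : ∀ s, ((s, y), t) ∈ Om L T → pdx (Jfun p q k u) s y t = pdxx u s y t + (k * dd0 g y * u s y t ^ q
      + k * s * dd0 g y * (q * u s y t ^ (q-1) * pdx u s y t)) := by
    intro s hs'
    rw [hJ]
    have e : HasDerivAt (fun s : ℝ => k * s * dd0 g y) (k * dd0 g y) s :=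
      (((hasDerivAt_id s).const_mul k).mul_const (dd0 g y)).congr_deriv (by ring)
    exact ((cc hs').2.2.2.1.hasDerivAt.add (e.mul (hpw (cc hs').1.hasDerivAt))).deriv
  have Jy : ∀ s, ((x, s), t) ∈ Om L T → pdy (Jfun p q k u) x s t = pdxy u x s t + (k * x * dd1 g s * u x s t ^ q
      + k * x * dd0 g s * (q * u x s t ^ (q-1) * pdy u x s t)) := by
    intro s hs'
    rw [hJ]
    have e : HasDerivAt (fun s : ℝ => k * x * dd0 g s) (k * x * dd1 g s) s :=
      (dd0_deriv hs'.2.1.1).const_mul (k * x)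
    exact ((cc hs').2.2.2.2.2.1.hasDerivAt.add (e.mul (hpw (cc hs').2.1.hasDerivAt))).deriv
  have wx := snd_pow (f := fun s => u s y t) (f' := fun s => pdx u s y t) (x := x) hq (cc hX).1.hasDerivAt
    (cc hX).2.2.2.1.hasDerivAt zx
  have wy := snd_pow (f := fun s => u x s t) (f' := fun s => pdy u x s t) (x := y) hq (cc hX).2.1.hasDerivAt
    (cc hX).2.2.2.2.1.hasDerivAt zy
  have Jxx : pdxx (Jfun p q k u) x y t = vxx + (k * dd0 g y * (q * u x y t ^ (q-1) * pdx u x y t)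
      + (k * dd0 g y * q * (u x y t ^ (q-1) * pdx u x y t) + k * x * dd0 g y * q *
        ((q-1) * u x y t ^ (q-2) * pdx u x y t ^ 2 + u x y t ^ (q-1) * pdxx u x y t))) := by
    have e : (fun s => pdx (Jfun p q k u) s y t) =ᶠ[nhds x] fun s => pdxx u s y t + (k * dd0 g y * u s y t ^ q
      + k * s * dd0 g y * q * (u s y t ^ (q-1) * pdx u s y t)) := by
      filter_upwards [hxn] with s hs'
      rw [Jx s hs']; ring
    unfold pdxx
    rw [e.deriv_eq]
    have e : HasDerivAt (fun s : ℝ => k * s * dd0 g y * q) (k * dd0 g y * q) x :=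
      ((((hasDerivAt_id x).const_mul k).mul_const (dd0 g y)).mul_const q).congr_deriv (by ring)
    exact (h1.add (((hpw (cc hX).1.hasDerivAt).const_mul (k * dd0 g y)).add (e.mul wx))).deriv
  have Jyy : pdyy (Jfun p q k u) x y t = vyy + ((k * x * dd2 g y * u x y t ^ q
      + k * x * dd1 g y * (q * u x y t ^ (q-1) * pdy u x y t))
      + (k * x * dd1 g y * q * (u x y t ^ (q-1) * pdy u x y t) + k * x * dd0 g y * q *
        ((q-1) * u x y t ^ (q-2) * pdy u x y t ^ 2 + u x y t ^ (q-1) * pdyy u x y t))) := by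
    have e : (fun s => pdy (Jfun p q k u) x s t) =ᶠ[nhds y] fun s => pdxy u x s t + (k * x * dd1 g s * u x s t ^ q
      + k * x * dd0 g s * q * (u x s t ^ (q-1) * pdy u x s t)) := by
      filter_upwards [hyn] with s hs'
      rw [Jy s hs']; ring
    unfold pdyy
    rw [e.deriv_eq]
    have e1 : HasDerivAt (fun s : ℝ => k * x * dd0 g s * q) (k * x * dd1 g y * q) y :=
      ((dd0_deriv hX.2.1.1).const_mul (k * x)).mul_const q
    have e2 : HasDerivAt (fun s : ℝ => k * x * dd1 g s) (k * x * dd2 g y) y :=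
      (dd1_deriv hX.2.1.1).const_mul (k * x)
    exact (h2.add ((e2.mul (hpw (cc hX).2.1.hasDerivAt)).add (e1.mul wy))).deriv
  have P := hs.pde hX.1 hX.2.1 hX.2.2
  simp only at P
  have hw2 : gradNorm u x y t ^ 2 = pdx u x y t ^ 2 + pdy u x y t ^ 2 := by
    unfold gradNorm; exact Real.sq_sqrt (by positivity)
  have hwp : gradNorm u x y t ^ p = gradNorm u x y t ^ (p-2) * (pdx u x y t ^ 2 + pdy u x y t ^ 2) := by
    have h0 : 0 ≤ gradNorm u x y t := Real.sqrt_nonneg _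
    rw [← hw2, ← Real.rpow_natCast, ← Real.rpow_add_of_nonneg h0 (by linarith) (by norm_num)]
    congr 1; push_cast; ring
  have hut : pdt u x y t = pdxx u x y t + pdyy u x y t + gradNorm u x y t ^ (p-2) * (pdx u x y t ^ 2 + pdy u x y t ^ 2) := by
    linarith
  have hgg : gg p u x y t = p * gradNorm u x y t ^ (p-2) * (pdx u x y t * pdxx u x y t + pdy u x y t * pdxy u x y t) := rfl
  unfold PJ
  rw [Jt, Jxx, Jyy, Jx x hX, Jy y hX, hgg, hut, hJ, hwp, hw2, ← hg]
  rw [show y ^ (-g) * (1 + y) = dd0 g y from rfl]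
  simp only
  ring

def RR (b q κ τ μ η : ℝ) : ℝ := q*(1-b)*(τ-1)^2 - (1-b)*τ^2 + 1 - μ*(1+b-τ) + η*(2*(τ-1)+κ*μ)

theorem alg (b q κ : ℝ) (hb : 1/2 ≤ b) (hb1 : b < 1) (hq : 1 < q) (hqb : 1 < q*b) (hκ : 0 < κ) :
    ∃ e > 0, e < 1 ∧ ∀ η δ τ μ : ℝ, 0 < η → η < e → 0 ≤ δ → δ ≤ e * η → 0 ≤ τ → 0 ≤ μ → μ ≤ 1 + δ →
      μ ≤ (1+δ)*τ → δ ≤ RR b q κ τ μ η := by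
  have hc : 0 < (q*b-1)/(q-1) := div_pos (by linarith) (by linarith)
  obtain ⟨e, he0, he⟩ : ∃ e > 0, e ≤ 1/2 ∧ e ≤ (q*b-1)/(q-1)/3 ∧ e ≤ (1-b)/8 ∧ e ≤ κ/3 :=
    ⟨min (min (1/2) ((q*b-1)/(q-1)/3)) (min ((1-b)/8) (κ/3)), by
      refine lt_min (lt_min (by norm_num) (by linarith)) (lt_min (by linarith) (by linarith)),
      (min_le_left _ _).trans (min_le_left _ _), (min_le_left _ _).trans (min_le_right _ _),
      (min_le_right _ _).trans (min_le_left _ _), (min_le_right _ _).trans (min_le_right _ _)⟩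
  obtain ⟨he1, he2, he3, he4⟩ := he
  refine ⟨e, he0, by linarith, ?_⟩
  intro η δ τ μ hη hηe hδ hδe hτ hμ hμ1 hμ2
  have hδη : δ ≤ η := by nlinarith
  have hδκ : 3 * δ ≤ κ * η := by nlinarith
  have R0 : δ ≤ RR b q κ τ 0 η := by
    unfold RR
    have hq1 : 0 < q - 1 := by linarith
    have hb2 : 0 < 1 - b := by linarith
    have key : (q-1)*(1-b)*τ^2 - 2*q*(1-b)*τ + q*(1-b) + 1 = (1-b)/(q-1) * ((q-1)*τ - q)^2 + (q*b-1)/(q-1) := by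
      field_simp; ring
    have : 0 ≤ (1-b)/(q-1) * ((q-1)*τ - q)^2 := by positivity
    nlinarith [mul_nonneg hη.le hτ]
  -- affine reduction
  have aff : ∀ m, 0 < m → μ ≤ m → δ ≤ RR b q κ τ m η → δ ≤ RR b q κ τ μ η := by
    intro m hm hμm hR
    have e1 : RR b q κ τ μ η = (1 - μ/m) * RR b q κ τ 0 η + μ/m * RR b q κ τ m η := by
      unfold RR; field_simp; ring
    have h1 : 0 ≤ μ/m := by positivity
    have h2 : μ/m ≤ 1 := by rw [div_le_one hm]; exact hμm
    rw [e1]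
    nlinarith
  rcases le_total τ 1 with h | h
  · rcases hτ.eq_or_lt with h0 | h0
    · have : μ = 0 := by rw [← h0] at hμ2; linarith
      rw [this]; exact R0
    · refine aff ((1+δ)*τ) (by positivity) hμ2 ?_
      have e1 : RR b q κ τ ((1+δ)*τ) η = q*(1-b)*(τ-1)^2 + (1-τ)*(1-b*τ) - 2*η*(1-τ) + κ*η*τ + κ*η*(δ*τ)
          - δ*(τ*(1+b-τ)) := by unfold RR; ring
      rw [e1]
      have h1 : 0 ≤ q*(1-b)*(τ-1)^2 := mul_nonneg (mul_nonneg (by linarith) (by linarith)) (sq_nonneg _)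
      have h2 : (1-τ)*(1-b) ≤ (1-τ)*(1-b*τ) := mul_le_mul_of_nonneg_left (by nlinarith) (by linarith)
      have h3 : 0 ≤ κ*η*(δ*τ) := by positivity
      have h4 : τ*(1+b-τ) ≤ 2 := by nlinarith
      have h5 : δ*(τ*(1+b-τ)) ≤ δ*2 := mul_le_mul_of_nonneg_left h4 hδ
      have h6 : 3*δ*τ ≤ κ*η*τ := mul_le_mul_of_nonneg_right hδκ hτ
      have h7 : (1-τ)*(3*δ) ≤ (1-τ)*((1-b) - 2*η) := mul_le_mul_of_nonneg_left (by linarith) (by linarith)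
      nlinarith
  · refine aff (1+δ) (by positivity) hμ1 ?_
    have e1 : RR b q κ τ (1+δ) η = (q-1)*(1-b)*(τ-1)^2 + (2*b-1)*(τ-1) + 2*η*(τ-1) + κ*η + κ*η*δ - δ*b + δ*(τ-1) := by
      unfold RR; ring
    rw [e1]
    have h1 : 0 ≤ (q-1)*(1-b)*(τ-1)^2 := mul_nonneg (mul_nonneg (by linarith) (by linarith)) (sq_nonneg _)
    have h2 : 0 ≤ (2*b-1)*(τ-1) := mul_nonneg (by linarith) (by linarith)
    have h3 : 0 ≤ 2*η*(τ-1) := mul_nonneg (by linarith) (by linarith)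
    have h4 : 0 ≤ δ*(τ-1) := mul_nonneg (by linarith) (by linarith)
    have h5 : 0 ≤ κ*η*δ := by positivity
    nlinarith

/-- normalized quantity -/
def GN (b q γ η h r1 r2 ρ α μ τ err : ℝ) : ℝ :=
  r1*μ*τ + (q-1)*(1-b)*ρ^2*τ^2 + γ + 1 - 2*η - (1-h)*α*(2*γ*τ + (1+b)*r2*μ) - err

theorem GN_nonneg {b q γ η h r1 r2 ρ α μ τ err E1 E2 δ κ e : ℝ} (hb1 : b < 1) (hb0 : 0 < b) (hq : 1 < q)
    (hγ : γ = q*(1-b)) (hh : h*γ = η) (hκ : κ*γ = 1+b) (hh0 : 0 ≤ h) (hh1 : h ≤ 1)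
    (H : ∀ η δ τ μ : ℝ, 0 < η → η < e → 0 ≤ δ → δ ≤ e * η → 0 ≤ τ → 0 ≤ μ → μ ≤ 1 + δ →
      μ ≤ (1+δ)*τ → δ ≤ RR b q κ τ μ η)
    (hη : 0 < η) (hηe : η < e) (hδ : 0 ≤ δ) (hδe : δ ≤ e*η) (hδb : δ ≤ 1 - b)
    (hμ1 : 1 ≤ μ) (hμ : μ ≤ 1+δ) (hτ : 1 ≤ τ) (hρ : 0 ≤ ρ) (hr2 : 0 ≤ r2) (hαρ : α ≤ ρ) (hα1 : α ≤ 1)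
    (herr : err ≤ E1 + E2*r2) (hE1 : 0 ≤ E1) (hE2 : 0 ≤ E2) (hE : E1 + E2 ≤ δ)
    (hr1 : r1 = ρ^2*r2) (c1 : ρ ≤ 1 → r2 ≤ 1 ∧ ρ*r2 ≤ ρ) (c2 : 1 ≤ ρ → 1 ≤ r2 ∧ 2*(r2-1) ≤ r1 - 1) :
    0 ≤ GN b q γ η h r1 r2 ρ α μ τ err := by
  have hγ0 : 0 < γ := by rw [hγ]; exact mul_pos (by linarith) (by linarith)
  have hbr : 0 ≤ 2*γ*τ + (1+b)*r2*μ := by positivity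
  have h1h : 0 ≤ 1 - h := by linarith
  rcases le_total ρ 1 with hc | hc
  · obtain ⟨k1, k2⟩ := c1 hc
    have hr := H η δ (ρ*τ) (ρ*r2*μ) hη hηe hδ hδe (by positivity) (by positivity) (by nlinarith) (by
      have h1 : ρ*r2*μ ≤ ρ*μ := mul_le_mul_of_nonneg_right k2 (by linarith)
      have h2 : ρ*μ ≤ ρ*(1+δ) := mul_le_mul_of_nonneg_left hμ hρ
      have h3 : ρ*(1+δ)*1 ≤ ρ*(1+δ)*τ := mul_le_mul_of_nonneg_left hτ (by positivity)
      nlinarith)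
    have hα : (1-h)*α*(2*γ*τ + (1+b)*r2*μ) ≤ (1-h)*ρ*(2*γ*τ + (1+b)*r2*μ) :=
      mul_le_mul_of_nonneg_right (mul_le_mul_of_nonneg_left hαρ h1h) hbr
    have he : err ≤ δ := by nlinarith
    have id : RR b q κ (ρ*τ) (ρ*r2*μ) η = r1*μ*τ + (q-1)*(1-b)*ρ^2*τ^2 + γ + 1 - 2*η - (1-h)*ρ*(2*γ*τ + (1+b)*r2*μ) := by
      unfold RR
      rw [hr1, ← hh, ← hκ, hγ]; ring
    unfold GN
    linarith
  · obtain ⟨k1, k2⟩ := c2 hc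
    have hr := H η δ τ μ hη hηe hδ hδe (by positivity) (by positivity) hμ (by nlinarith)
    have hα : (1-h)*α*(2*γ*τ + (1+b)*r2*μ) ≤ (1-h)*1*(2*γ*τ + (1+b)*r2*μ) :=
      mul_le_mul_of_nonneg_right (mul_le_mul_of_nonneg_left hα1 h1h) hbr
    have id : RR b q κ τ μ η = μ*τ + (q-1)*(1-b)*τ^2 + γ + 1 - 2*η - (1-h)*(2*γ*τ + (1+b)*μ) := by
      unfold RR
      rw [← hh, ← hκ, hγ]; ring
    have s1 : 0 ≤ (q-1)*(1-b)*τ^2*(ρ^2-1) := by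
      refine mul_nonneg (mul_nonneg (mul_nonneg (by linarith) (by linarith)) (sq_nonneg _)) (by nlinarith)
    have s2 : (r1-1)*μ*1 ≤ (r1-1)*μ*τ := mul_le_mul_of_nonneg_left hτ (mul_nonneg (by linarith) (by linarith))
    have s3 : 2*(r2-1)*μ ≤ (r1-1)*μ := mul_le_mul_of_nonneg_right k2 (by linarith)
    have s4 : (1-h)*((1+b)*μ*(r2-1)) ≤ 1*((1+b)*μ*(r2-1)) :=
      mul_le_mul_of_nonneg_right (by linarith) (mul_nonneg (by positivity) (by linarith))
    have s5 : E2*(r2-1) ≤ (1-b)*(r2-1) := mul_le_mul_of_nonneg_right (by linarith) (by linarith)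
    have s6 : (1-b)*(r2-1)*1 ≤ (1-b)*(r2-1)*μ := mul_le_mul_of_nonneg_left hμ1 (mul_nonneg (by linarith) (by linarith))
    unfold GN
    nlinarith

theorem Af_pow (hp : 2 < p) (hK : 0 ≤ K) {y : ℝ} (hy : 0 < y) :
    y * Af p K y ^ (p-1) = 1/(p-1) * (1 + K * y ^ (1 + 1/(p-1))) ^ (p-1) := by
  have hp1 : 0 < p - 1 := by linarith
  unfold Af
  rw [Real.mul_rpow (by positivity) (by positivity), Real.mul_rpow (by positivity) (by positivity),
    ← Real.rpow_mul (by positivity), ← Real.rpow_mul hy.le, show 1/(p-1)*(p-1) = 1 by field_simp,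
    show -(1/(p-1))*(p-1) = -1 by field_simp, Real.rpow_one, Real.rpow_neg_one]
  field_simp

set_option maxHeartbeats 2000000 in
theorem ineq (hp : 2 < p) (hp3 : p ≤ 3) (hq : p - 1 < q) (hK : 0 ≤ K) {γ : ℝ}
    (hγ : γ = q * (1 - 1/(p-1))) :
    ∃ y1 > 0, ∀ y k w v a : ℝ, 0 < y → y < y1 → 0 < k → k < 1 → 0 ≤ w → 0 < v → a ≤ w → a ≤ Af p K y →
      v ≤ Af p K y * y / (1 - 1/(p-1)) →
      0 ≤ (p-1)*q*w^p*y*(y/v) + q*(q-1)*w^2*(y/v)^2 + γ*(γ+1) - 2*γ*(y/(1+y))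
        - (γ - y/(1+y))*a*(2*q*(y/v) + p*y*w^(p-2))
        - y^2*k*(2*q*dd0 γ y*v^(q-1) + p*w^(p-2)*dd0 γ y*v^q) := by
  have hp1 : 0 < p - 1 := by linarith
  obtain ⟨b, hb⟩ : ∃ b, b = 1/(p-1) := ⟨_, rfl⟩
  have hbp : b * (p-1) = 1 := by rw [hb]; field_simp
  have hb0 : 0 < b := by rw [hb]; positivity
  have hb1 : b < 1 := by rw [hb, div_lt_one] <;> linarith
  have hb2 : 1/2 ≤ b := by nlinarith
  have hq1 : 1 < q := by linarith
  have hqb : 1 < q*b := by nlinarith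
  have hγ' : γ = q*(1-b) := by rw [hγ, hb]
  have hγ0 : 0 < γ := by rw [hγ']; exact mul_pos (by linarith) (by linarith)
  have h1b : 0 < 1 - b := by linarith
  obtain ⟨e, he0, he1, H⟩ := alg b q ((1+b)/γ) hb2 hb1 hq1 hqb (by positivity)
  obtain ⟨D, hD⟩ : ∃ D, D = b^b := ⟨_, rfl⟩
  have hD0 : 0 < D := by rw [hD]; positivity
  obtain ⟨V, hV⟩ : ∃ V, V = 2*D/(1-b) := ⟨_, rfl⟩
  have hV0 : 0 < V := by rw [hV]; positivity
  obtain ⟨C1, hC1⟩ : ∃ C, C = 4*q*V^(q-1)/γ := ⟨_, rfl⟩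
  obtain ⟨C2, hC2⟩ : ∃ C, C = 2*p*V^q*(2*D)^(p-2)/γ := ⟨_, rfl⟩
  have hC10 : 0 ≤ C1 := by rw [hC1]; positivity
  have hC20 : 0 ≤ C2 := by rw [hC2]; positivity
  obtain ⟨C, hC⟩ : ∃ C, C = 3*K + C1 + C2 := ⟨_, rfl⟩
  have hC0 : 0 ≤ C := by rw [hC]; positivity
  have ev : ∀ᶠ y in nhdsWithin (0:ℝ) (Ioi 0), y < 1 ∧ y < e ∧ y < γ ∧ K*y < 1 ∧ C*y < 1-b ∧ C*y^b < e/2 := by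
    have l1 : Tendsto (fun y : ℝ => y) (nhdsWithin 0 (Ioi 0)) (nhds 0) := tendsto_id.mono_left nhdsWithin_le_nhds
    have lm : ∀ c : ℝ, Tendsto (fun y : ℝ => c*y) (nhdsWithin 0 (Ioi 0)) (nhds 0) := fun c => by
      simpa using l1.const_mul c
    have lb : Tendsto (fun y : ℝ => C*y^b) (nhdsWithin 0 (Ioi 0)) (nhds 0) := by
      have := (l1.rpow_const (p := b) (Or.inr hb0.le)).const_mul C
      simpa [Real.zero_rpow hb0.ne'] using this
    filter_upwards [l1.eventually_lt_const one_pos, l1.eventually_lt_const he0, l1.eventually_lt_const hγ0,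
      (lm K).eventually_lt_const one_pos, (lm C).eventually_lt_const h1b, lb.eventually_lt_const (half_pos he0)]
      with y a1 a2 a3 a4 a5 a6 using ⟨a1, a2, a3, a4, a5, a6⟩
  obtain ⟨y1, hy1, hsub⟩ := (mem_nhdsGT_iff_exists_Ioo_subset).1 ev
  refine ⟨y1, hy1, ?_⟩
  intro y k w v a hy hyy hk hk1 hw hv haw haA hvA
  obtain ⟨u1, u2, u3, u4, u5, u6⟩ := hsub ⟨hy, hyy⟩
  rw [← hb] at hvA
  obtain ⟨Y, hY⟩ : ∃ Y, Y = y^(1+b) := ⟨_, rfl⟩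
  have hY0 : 0 < Y := by rw [hY]; positivity
  have hYy : Y = y * y^b := by rw [hY, Real.rpow_add hy, Real.rpow_one]
  have hyb : y^b ≤ 1 := Real.rpow_le_one hy.le u1.le hb0.le
  have hYle : Y ≤ y := by rw [hYy]; exact mul_le_of_le_one_right hy.le hyb
  have hKY : K*Y ≤ 1 := (mul_le_mul_of_nonneg_left hYle hK).trans u4.le
  have hKY0 : 0 ≤ K*Y := by positivity
  obtain ⟨A, hA⟩ : ∃ A, A = Af p K y := ⟨_, rfl⟩
  have hAe : A = D * y^(-b) * (1 + K*Y) := by rw [hA]; unfold Af; rw [← hb, hY, hD]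
  have hA0 : 0 < A := by rw [hAe]; positivity
  have hA2 : A ≤ 2*D*y^(-b) := by
    rw [hAe]
    have h0 : 0 < D * y^(-b) := by positivity
    have := mul_le_mul_of_nonneg_left (show 1 + K*Y ≤ 2 by linarith) h0.le
    linarith
  have hAp := Af_pow hp hK hy
  rw [← hA, ← hb, ← hY] at hAp
  rw [← hA] at haA hvA
  obtain ⟨μ, hμ⟩ : ∃ μ, μ = (1 + K*Y)^(p-1) := ⟨_, rfl⟩
  rw [← hμ] at hAp
  have hμ1 : 1 ≤ μ := by rw [hμ]; exact Real.one_le_rpow (by linarith) hp1.le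
  have hμ2 : μ ≤ 1 + 3*(K*Y) := by
    have : μ ≤ (1+K*Y)^(2:ℝ) := by
      rw [hμ]; exact Real.rpow_le_rpow_of_exponent_le (by linarith) (by linarith)
    rw [Real.rpow_two] at this
    have h2 : (K*Y)*(K*Y) ≤ (K*Y)*1 := mul_le_mul_of_nonneg_left hKY hKY0
    linarith
  obtain ⟨η, hη⟩ : ∃ η, η = y/(1+y) := ⟨_, rfl⟩
  have hη1 : η ≤ y := by rw [hη]; exact div_le_self hy.le (by linarith)
  have hη2 : y/2 ≤ η := by rw [hη]; exact div_le_div_of_nonneg_left hy.le (by linarith) (by linarith)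
  have hη0 : 0 < η := by linarith
  rw [← hη]
  -- bounds on v
  have hvV : v ≤ V * y^(1-b) := by
    refine hvA.trans ?_
    have e' : y^(1-b) = y^(-b) * y := by rw [← Real.rpow_add_one hy.ne']; congr 1; ring
    rw [hV, e', div_le_iff₀ h1b]
    have : 2*D/(1-b)*(y^(-b)*y)*(1-b) = 2*D*y^(-b)*y := by field_simp
    rw [this]
    exact mul_le_mul_of_nonneg_right hA2 hy.le
  have hd0 : 0 ≤ dd0 γ y := by unfold dd0; positivity
  have hd : dd0 γ y ≤ y^(-γ)*2 := by
    unfold dd0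
    exact mul_le_mul_of_nonneg_left (by linarith) (by positivity)
  have hvq : v^q ≤ V^q * y^γ := by
    refine (Real.rpow_le_rpow hv.le hvV (by linarith)).trans_eq ?_
    rw [Real.mul_rpow hV0.le (by positivity), ← Real.rpow_mul hy.le, hγ']; ring_nf
  have hvq1 : v^(q-1) ≤ V^(q-1) * y^((1-b)*(q-1)) := by
    refine (Real.rpow_le_rpow hv.le hvV (by linarith)).trans_eq ?_
    rw [Real.mul_rpow hV0.le (by positivity), ← Real.rpow_mul hy.le]
  have b1 : dd0 γ y * v^q ≤ 2*V^q := by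
    refine (mul_le_mul hd hvq (by positivity) (by positivity)).trans_eq ?_
    have : y^(-γ) * y^γ = 1 := by rw [← Real.rpow_add hy]; simp
    linear_combination 2*V^q*this
  have b2 : y^2*(dd0 γ y * v^(q-1)) ≤ 2*V^(q-1)*Y := by
    have := mul_le_mul_of_nonneg_left (mul_le_mul hd hvq1 (by positivity) (by positivity)) (sq_nonneg y)
    refine this.trans_eq ?_
    have : y^2 * y^(-γ) * y^((1-b)*(q-1)) = Y := by
      rw [hY, ← Real.rpow_natCast, ← Real.rpow_add hy, ← Real.rpow_add hy, hγ']
      congr 1; push_cast; ring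
    linear_combination 2*V^(q-1)*this
  have b3 : y^2*A^(p-2) ≤ (2*D)^(p-2)*Y := by
    have h1 : A^(p-2) ≤ (2*D*y^(-b))^(p-2) := Real.rpow_le_rpow hA0.le hA2 (by linarith)
    rw [Real.mul_rpow (by positivity) (by positivity), ← Real.rpow_mul hy.le] at h1
    refine (mul_le_mul_of_nonneg_left h1 (sq_nonneg y)).trans_eq ?_
    have : y^2 * y^(-b*(p-2)) = Y := by
      rw [hY, ← Real.rpow_natCast, ← Real.rpow_add hy]
      congr 1; push_cast; linear_combination -hbp
    linear_combination (2*D)^(p-2)*this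
  obtain ⟨ρ, hρ⟩ : ∃ ρ, ρ = w/A := ⟨_, rfl⟩
  have hρ0 : 0 ≤ ρ := by rw [hρ]; positivity
  have hwρ : w = ρ*A := by rw [hρ]; field_simp
  obtain ⟨r2, hr2⟩ : ∃ r, r = ρ^(p-2) := ⟨_, rfl⟩
  have hr20 : 0 ≤ r2 := by rw [hr2]; positivity
  have hwp2 : w^(p-2) = r2*A^(p-2) := by rw [hwρ, Real.mul_rpow hρ0 hA0.le, hr2]
  have hr1 : ρ^p = ρ^2*r2 := by
    rw [hr2, ← Real.rpow_natCast, ← Real.rpow_add_of_nonneg hρ0 (by norm_num) (by linarith)]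
    congr 1; push_cast; ring
  obtain ⟨err, herr⟩ : ∃ err, err = y^2*k*(2*q*dd0 γ y*v^(q-1) + p*w^(p-2)*dd0 γ y*v^q) := ⟨_, rfl⟩
  have herr2 : err/γ ≤ C1*Y + C2*Y*r2 := by
    rw [div_le_iff₀ hγ0]
    have g1 : C1*γ = 4*q*V^(q-1) := by rw [hC1]; field_simp
    have g2 : C2*γ = 2*p*V^q*(2*D)^(p-2) := by rw [hC2]; field_simp
    have g3 : (C1*Y + C2*Y*r2)*γ = 4*q*V^(q-1)*Y + 2*p*V^q*(2*D)^(p-2)*Y*r2 := by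
      linear_combination Y*g1 + Y*r2*g2
    rw [g3]
    have m1 : 2*q*(y^2*(dd0 γ y * v^(q-1))) ≤ 2*q*(2*V^(q-1)*Y) := mul_le_mul_of_nonneg_left b2 (by linarith)
    have m2 : (y^2*A^(p-2))*(dd0 γ y * v^q) ≤ ((2*D)^(p-2)*Y)*(2*V^q) :=
      mul_le_mul b3 b1 (by positivity) (by positivity)
    have m3 : p*r2*((y^2*A^(p-2))*(dd0 γ y * v^q)) ≤ p*r2*(((2*D)^(p-2)*Y)*(2*V^q)) :=
      mul_le_mul_of_nonneg_left m2 (by positivity)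
    have m4 : err ≤ y^2*(2*q*dd0 γ y*v^(q-1) + p*w^(p-2)*dd0 γ y*v^q) := by
      rw [herr]
      have : 0 ≤ y^2*(2*q*dd0 γ y*v^(q-1) + p*w^(p-2)*dd0 γ y*v^q) := by positivity
      have := mul_le_mul_of_nonneg_right hk1.le this
      linarith
    rw [hwp2] at m4
    linarith
  have hτ : 1 ≤ A*(y/v)/(1-b) := by
    rw [le_div_iff₀ h1b]
    rw [le_div_iff₀ h1b] at hvA
    have : A*(y/v) = A*y/v := by ring
    rw [this, le_div_iff₀ hv]; linarith
  have hδe : C*Y ≤ e*η := by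
    have h1 : y*(C*y^b) ≤ y*(e/2) := mul_le_mul_of_nonneg_left u6.le hy.le
    have h2 : e*(y/2) ≤ e*η := mul_le_mul_of_nonneg_left hη2 he0.le
    rw [hYy]; linarith
  have hδb : C*Y ≤ 1-b := (mul_le_mul_of_nonneg_left hYle hC0).trans u5.le
  have hC1Y : 0 ≤ C1*Y := by positivity
  have hC2Y : 0 ≤ C2*Y := by positivity
  have hCY : C*Y = 3*(K*Y) + C1*Y + C2*Y := by rw [hC]; ring
  have hμδ : μ ≤ 1 + C*Y := by linarith
  have hE12 : C1*Y + C2*Y ≤ C*Y := by linarith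
  have hG := GN_nonneg (b := b) (q := q) (γ := γ) (η := η) (h := η/γ) (r1 := ρ^p) (r2 := r2) (ρ := ρ) (α := a/A)
    (μ := μ) (τ := A*(y/v)/(1-b)) (err := err/γ) (E1 := C1*Y) (E2 := C2*Y) (δ := C*Y) (κ := (1+b)/γ) (e := e)
    hb1 hb0 hq1 hγ' (by field_simp) (by field_simp) (by positivity) (by rw [div_le_one hγ0]; linarith) H
    (by linarith) (by linarith) (by positivity) hδe hδb hμ1 hμδ hτ
    hρ0 hr20 (by rw [hρ]; exact div_le_div_of_nonneg_right haw hA0.le) (by rw [div_le_one hA0]; exact haA)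
    herr2 (by positivity) (by positivity) hE12 hr1
    (fun h => by
      have : r2 ≤ 1 := by rw [hr2]; exact Real.rpow_le_one hρ0 h (by linarith)
      exact ⟨this, mul_le_of_le_one_right hρ0 this⟩)
    (fun h => by
      have : 1 ≤ r2 := by rw [hr2]; exact Real.one_le_rpow h (by linarith)
      refine ⟨this, ?_⟩
      rw [hr1]
      have h2 : r2 ≤ ρ := by
        rw [hr2]
        exact (Real.rpow_le_rpow_of_exponent_le h (show p - 2 ≤ 1 by linarith)).trans_eq (Real.rpow_one ρ)
      have h3 : r2^2*r2 ≤ ρ^2*r2 := by gcongr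
      have h4 : 0 ≤ (r2-1)*(r2^2+r2-1) := mul_nonneg (by linarith) (by nlinarith)
      linarith)
  have hwp : w^p*y = ρ^p*(A*(b*μ)) := by
    rw [hwρ, Real.mul_rpow hρ0 hA0.le, ← hAp]
    have : A^p = A^(p-1)*A := by rw [← Real.rpow_add_one hA0.ne']; congr 1; ring
    rw [this]; ring
  have hwp' : y*w^(p-2)*A = r2*(b*μ) := by
    rw [hwp2, ← hAp]
    have : A^(p-1) = A^(p-2)*A := by rw [← Real.rpow_add_one hA0.ne']; congr 1; ring
    rw [this]; ring
  rw [← herr]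
  have key : (p-1)*q*w^p*y*(y/v) + q*(q-1)*w^2*(y/v)^2 + γ*(γ+1) - 2*γ*η
        - (γ - η)*a*(2*q*(y/v) + p*y*w^(p-2)) - err
      = γ * GN b q γ η (η/γ) (ρ^p) r2 ρ (a/A) μ (A*(y/v)/(1-b)) (err/γ) := by
    unfold GN
    generalize y/v = Z at *
    have t1 : (p-1)*q*w^p*y*Z = γ*(ρ^p*μ*(A*Z/(1-b))) := by
      have : γ*(ρ^p*μ*(A*Z/(1-b))) = q*ρ^p*μ*A*Z := by rw [hγ']; field_simp
      rw [this]
      linear_combination (p-1)*q*Z*hwp + q*Z*ρ^p*A*μ*hbp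
    have t2 : q*(q-1)*w^2*Z^2 = γ*((q-1)*(1-b)*ρ^2*(A*Z/(1-b))^2) := by
      rw [hγ', hwρ]; field_simp
    have t3 : (γ-η)*a*(2*q*Z + p*y*w^(p-2)) = γ*((1-η/γ)*(a/A)*(2*γ*(A*Z/(1-b)) + (1+b)*r2*μ)) := by
      have q1 : γ*((1-η/γ)*(a/A)*(2*γ*(A*Z/(1-b)) + (1+b)*r2*μ)) = (γ-η)*(a/A)*(2*γ*(A*Z/(1-b)) + (1+b)*r2*μ) := by
        field_simp
      have q2 : 2*γ*(A*Z/(1-b)) = 2*q*A*Z := by rw [hγ']; field_simp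
      have q3 : (1+b)*r2*μ = p*(y*w^(p-2)*A) := by rw [hwp']; linear_combination -r2*μ*hbp
      rw [q1, q2, q3]; field_simp
    have t4 : γ*(err/γ) = err := by field_simp
    linear_combination t1 + t2 - t3 + t4
  rw [key]
  exact mul_nonneg hγ0.le hG

theorem fin_alg {p q γ y k w v a : ℝ} (hy : 0 < y) (hv : 0 < v) :
    dd0 γ y * (q * v ^ (q-1)) * w ^ p * (1 - p)
      - dd0 γ y * (q * (q-1) * v ^ (q-2)) * w ^ 2
      - dd2 γ y * v ^ q - 2 * dd1 γ y * (q * v ^ (q-1)) * a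
      - p * w ^ (p-2) * dd1 γ y * v ^ q * a
      + 2 * k * dd0 γ y ^ 2 * v ^ q * (q * v ^ (q-1))
      + p * w ^ (p-2) * k * dd0 γ y ^ 2 * (v ^ q) ^ 2
    = -(dd0 γ y * v ^ q / y^2) * ((p-1)*q*w^p*y*(y/v) + q*(q-1)*w^2*(y/v)^2 + γ*(γ+1) - 2*γ*(y/(1+y))
        - (γ - y/(1+y))*a*(2*q*(y/v) + p*y*w^(p-2))
        - y^2*k*(2*q*dd0 γ y*v^(q-1) + p*w^(p-2)*dd0 γ y*v^q)) := by
  have e1 : v ^ (q-1) = v ^ q / v := Real.rpow_sub_one hv.ne' q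
  have e2 : v ^ (q-2) = v ^ q / v^2 := by
    have := Real.rpow_sub_natCast hv.ne' q 2
    exact_mod_cast this
  have e3 : dd1 γ y = dd0 γ y * (-γ + y/(1+y)) / y := by
    unfold dd1 dd0
    rw [Real.rpow_sub_one hy.ne']
    field_simp
  have e4 : dd2 γ y = dd0 γ y * (γ*(γ+1) - 2*γ*(y/(1+y))) / y^2 := by
    unfold dd2 dd0
    have : y ^ (-γ-2) = y ^ (-γ) / y^2 := by
      have := Real.rpow_sub_natCast hy.ne' (-γ) 2
      exact_mod_cast this
    rw [Real.rpow_sub_one hy.ne', this]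
    field_simp
  rw [e1, e2, e3, e4]
  generalize dd0 γ y = d
  generalize v ^ q = F
  generalize w ^ p = W
  generalize w ^ (p-2) = W2
  generalize y/(1+y) = η
  field_simp
  ring

/-- Lemma 5.3: for `2 < p ≤ 3`, `q > p-1`, `γ = q(1-β)` and `φ(y) = 1+y`, there
are `x₁, y₁, σ > 0` such that `𝒫J ≤ 0` in `Q = (0,x₁) × (0,y₁) × (T-σ,T)` for
every `k ∈ (0,1)`. -/
theorem PJ_nonpositive (p q L T : ℝ) (hp : 2 < p) (hp3 : p ≤ 3)
    (hq : p - 1 < q) (hL : 0 < L) (hT : 0 < T) (u : ℝ → ℝ → ℝ → ℝ)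
    (hsol : ClassicalSolution p L T u) (hgbu : IsolatedGBU L T u)
    (hmon : MonCond L T u) :
    ∃ x₁ y₁ σ : ℝ, 0 < x₁ ∧ 0 < y₁ ∧ 0 < σ ∧
      ∀ k : ℝ, 0 < k → k < 1 →
        ∀ x y t : ℝ, x ∈ Ioo (0:ℝ) x₁ → y ∈ Ioo (0:ℝ) y₁ → t ∈ Ioo (T - σ) T →
          PJ p q k u x y t ≤ 0 := by
  obtain ⟨K, hK, hA⟩ := A_bd hp hL hT hsol hgbu
  obtain ⟨γ, hγ⟩ : ∃ γ, γ = q * (1 - 1/(p-1)) := ⟨_, rfl⟩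
  obtain ⟨y1, hy1, hin⟩ := ineq hp hp3 hq hK hγ
  refine ⟨L/2, min y1 (L/2), T/2, by linarith, lt_min hy1 (by linarith), by linarith, ?_⟩
  intro k hk hk1 x y t hx hy ht
  have hya : y < y1 := hy.2.trans_le (min_le_left _ _)
  have hyb : y < L/2 := hy.2.trans_le (min_le_right _ _)
  have hxa : |x| < L/2 := by rw [abs_of_pos hx.1]; exact hx.2
  have hX : ((x, y), t) ∈ Om L T :=
    ⟨by simp; linarith, ⟨hy.1, by simp; linarith⟩, by simp; linarith [ht.1], ht.2⟩
  obtain ⟨z, id⟩ := PJ_id (k := k) hp hp3 (by linarith : 1 < q) hsol hX hγ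
  have hv0 : 0 ≤ u x y t := hsol.nonneg hX.1.le ⟨hX.2.1.1.le, hX.2.1.2.le⟩ hX.2.2
  rw [id]
  rcases hv0.eq_or_lt with h | h
  · rw [z h.symm, ← h, Real.zero_rpow (show q ≠ 0 by linarith), Real.zero_rpow (show q - 1 ≠ 0 by linarith)]
    simp
  · rw [fin_alg hy.1 h]
    obtain ⟨g1, g2⟩ := hA x y t hxa.le ⟨hy.1, hyb⟩ ⟨by linarith [ht.1], ht.2⟩
    have hG := hin y k (gradNorm u x y t) (u x y t) (pdy u x y t) hy.1 hya hk hk1 (Real.sqrt_nonneg _) h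
      (pdy_le x y t) g1 g2
    have hd : 0 ≤ dd0 γ y * u x y t ^ q / y^2 := by
      have hy0 := hy.1
      unfold dd0; positivity
    have hx0 := hx.1
    rw [neg_mul, mul_neg]
    exact neg_nonpos.2 (mul_nonneg (by positivity) (mul_nonneg hd hG))
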